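/- Let v: ℝⁿ → ℝ be a p-harmonic function (weak solution of div(|∇v|^{p-2}∇v) = 0) on all of ℝⁿ with linear growth, i.e. |v(x)| ≤ C(1 + |x|) for all x. If additionally v(0) = 0 and sup_{B_{1/2}} |v| = 1, then v is a nonzero affine linear function: v(x) = ⟨a, x⟩ for some a ∈ ℝⁿ with a ≠ 0. -/

import Mathlib

open MeasureTheory Metric
open scoped RealInnerProductSpace

namespace PLap

/-! ## Part A: algebraic inequalities for the vector field of the p-Laplacian -/

section PartA

lemma scalar_taylor (q : ℝ) : ∃ C : ℝ, 0 ≤ C ∧ ∀ t : ℝ, |t| ≤ 3/4 →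
    |(1 + t) ^ q - 1 - q * t| ≤ C * t ^ 2 := by
  have hcont : ContinuousOn (fun t : ℝ => (q - 1) * (1 + t) ^ (q - 1 - 1)) (Set.Icc (-(3/4)) (3/4)) := by
    apply ContinuousOn.mul continuousOn_const
    apply ContinuousOn.rpow_const (by fun_prop)
    intro x hx
    left
    have := hx.1
    linarith
  obtain ⟨C, hC⟩ := isCompact_Icc.exists_bound_of_continuousOn hcont
  have hC0 : 0 ≤ C := le_trans (norm_nonneg _) (hC 0 (by constructor <;> norm_num))
  have hd1 : ∀ r : ℝ, ∀ t ∈ Set.Icc (-(3/4):ℝ) (3/4),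
      HasDerivAt (fun t : ℝ => (1 + t) ^ r) (r * (1 + t) ^ (r - 1)) t := by
    intro r t ht
    have h1 : (1 + t) ≠ 0 := by have := ht.1; linarith
    have := ((hasDerivAt_id t).const_add 1).rpow_const (p := r) (Or.inl h1)
    simpa using this
  have hlip : ∀ t ∈ Set.Icc (-(3/4):ℝ) (3/4), |(1 + t) ^ (q - 1) - 1| ≤ C * |t| := by
    intro t ht
    have := (convex_Icc (-(3/4):ℝ) (3/4)).norm_image_sub_le_of_norm_hasDerivWithin_le
      (f := fun t : ℝ => (1 + t) ^ (q - 1)) (C := C) (x := 0) (y := t)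
      (fun x hx => (hd1 (q - 1) x hx).hasDerivWithinAt) (fun x hx => hC x hx)
      (by constructor <;> norm_num) ht
    simpa using this
  refine ⟨|q| * C, by positivity, ?_⟩
  intro t ht
  have hsub : ∀ x ∈ Set.Icc (-|t|) |t|, x ∈ Set.Icc (-(3/4):ℝ) (3/4) := by
    intro x hx
    exact ⟨by have := hx.1; linarith, by have := hx.2; linarith⟩
  have h2 := (convex_Icc (-|t|) |t|).norm_image_sub_le_of_norm_hasDerivWithin_le
      (f := fun t : ℝ => (1 + t) ^ q - q * t) (f' := fun t => q * (1 + t) ^ (q - 1) - q)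
      (C := |q| * C * |t|) (x := 0) (y := t)
      (fun x hx => ((hd1 q x (hsub x hx)).sub (by simpa using (hasDerivAt_id x).const_mul q)).hasDerivWithinAt)
      (fun x hx => by
        have h3 := hlip x (hsub x hx)
        have h4 : |x| ≤ |t| := abs_le.2 hx
        have : q * (1 + x) ^ (q - 1) - q = q * ((1 + x) ^ (q - 1) - 1) := by ring
        rw [this, norm_mul, Real.norm_eq_abs, Real.norm_eq_abs, mul_assoc]
        gcongr
        exact h3.trans (by gcongr))
      (by constructor <;> simp) (abs_le.1 le_rfl)
  have e1 : (1 + t) ^ q - 1 - q * t = ((1 + t) ^ q - q * t) - ((1 + 0) ^ q - q * 0) := by simp; ring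
  rw [e1]
  refine h2.trans (le_of_eq ?_)
  rw [sub_zero, Real.norm_eq_abs, mul_assoc, ← sq, sq_abs]

variable {E : Type*} [NormedAddCommGroup E] [InnerProductSpace ℝ E]

/-- the vector field of the p-Laplacian -/
noncomputable def F (p : ℝ) (x : E) : E := ‖x‖ ^ (p - 2) • x

lemma F_unit {p : ℝ} {e : E} (he : ‖e‖ = 1) : F p e = e := by simp [F, he]

lemma norm_F {p : ℝ} (hp : 1 < p) (x : E) : ‖F p x‖ = ‖x‖ ^ (p - 1) := by
  rw [F, norm_smul, Real.norm_eq_abs, abs_of_nonneg (by positivity)]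
  by_cases hx : ‖x‖ = 0
  · rw [hx, Real.zero_rpow (by linarith : p - 1 ≠ 0), mul_zero]
  · rw [← Real.rpow_add_one hx]; congr 1; ring

lemma F_smul {p : ℝ} {c : ℝ} (hc : 0 < c) (x : E) : F p (c • x) = c ^ (p - 1) • F p x := by
  simp only [F, norm_smul, Real.norm_eq_abs, abs_of_pos hc]
  rw [Real.mul_rpow hc.le (norm_nonneg _), smul_smul, smul_smul]
  congr 1
  have : c ^ (p - 1) = c ^ (p - 2) * c := by
    rw [← Real.rpow_add_one hc.ne']; congr 1; ring
  rw [this]; ring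

lemma continuous_F {p : ℝ} (hp : 1 < p) : Continuous (F p : E → E) := by
  rw [continuous_iff_continuousAt]
  intro x
  by_cases hx : x = 0
  · subst hx
    have h0 : F p (0:E) = 0 := by simp [F]
    unfold ContinuousAt
    rw [h0, tendsto_zero_iff_norm_tendsto_zero]
    simp only [norm_F hp]
    have : ContinuousAt (fun x : E => ‖x‖ ^ (p - 1)) 0 :=
      continuousAt_id.norm.rpow_const (Or.inr (by linarith))
    unfold ContinuousAt at this
    simpa [Real.zero_rpow (by linarith : p - 1 ≠ 0)] using this
  · unfold F
    exact (continuousAt_id.norm.rpow_const (Or.inl (by simpa using hx))).smul continuousAt_id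

lemma F_taylor (p : ℝ) (hp : 1 < p) (L : ℝ) (hL : 0 ≤ L) : ∃ C : ℝ, 0 < C ∧ ∀ e x : E, ‖e‖ = 1 → ‖x‖ ≤ L →
    ‖F p x - e - ((x - e) + ((p - 2) * ⟪e, x - e⟫) • e)‖ ≤ C * ‖x - e‖ ^ 2 := by
  obtain ⟨C, hC0, hC⟩ := scalar_taylor ((p - 2) / 2)
  set Q := |p - 2| with hQ
  have hQ0 : 0 ≤ Q := abs_nonneg _
  refine ⟨(Q / 2 + Q / 2 * 3 + C * 9 * 2) + 16 * (L ^ (p - 1) + 1 + ((L + 1) + Q * (L + 1))) + 1,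
    by positivity, ?_⟩
  intro e x he hx
  set z := x - e with hz
  have hxe : x = e + z := by simp [hz]
  have hinner : |⟪e, z⟫| ≤ ‖z‖ := by
    have := abs_real_inner_le_norm e z
    rwa [he, one_mul] at this
  by_cases hsmall : ‖z‖ ≤ 1/4
  · have hz0 := norm_nonneg z
    set t := 2 * ⟪e, z⟫ + ‖z‖ ^ 2 with ht
    have hnorm : ‖x‖ ^ 2 = 1 + t := by
      rw [hxe, norm_add_sq_real, he, ht]; ring
    have ht3 : |t| ≤ 3 * ‖z‖ := by
      rw [abs_le] at hinner ⊢
      constructor <;> nlinarith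
    have hrp : ‖x‖ ^ (p - 2) = (1 + t) ^ ((p - 2) / 2) := by
      rw [← hnorm, ← Real.rpow_natCast, ← Real.rpow_mul (norm_nonneg _)]
      congr 1; push_cast; ring
    have hT := hC t (ht3.trans (by linarith))
    set ρ := (1 + t) ^ ((p - 2) / 2) - 1 - (p - 2) / 2 * t with hρ
    have key : F p x - e - (z + ((p - 2) * ⟪e, z⟫) • e)
        = ((p - 2) / 2 * ‖z‖ ^ 2) • e + ((p - 2) / 2 * t) • z + ρ • (e + z) := by
      rw [F, hrp]
      have : (1 + t) ^ ((p - 2) / 2) = ρ + 1 + (p - 2) / 2 * t := by rw [hρ]; ring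
      rw [this, hxe, ht]
      module
    rw [key]
    have b1 : ‖((p - 2) / 2 * ‖z‖ ^ 2) • e‖ ≤ Q / 2 * ‖z‖ ^ 2 := by
      rw [norm_smul, he, mul_one, norm_mul, norm_div]
      simp [hQ]
    have b2 : ‖((p - 2) / 2 * t) • z‖ ≤ Q / 2 * 3 * ‖z‖ ^ 2 := by
      rw [norm_smul, norm_mul, norm_div, Real.norm_eq_abs t, Real.norm_eq_abs (p-2), ← hQ, Real.norm_two]
      calc Q / 2 * |t| * ‖z‖ ≤ Q / 2 * (3 * ‖z‖) * ‖z‖ := by gcongr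
        _ = _ := by ring
    have b3 : ‖ρ • (e + z)‖ ≤ C * 9 * 2 * ‖z‖ ^ 2 := by
      rw [norm_smul, Real.norm_eq_abs]
      have h1 : ‖e + z‖ ≤ 2 := (norm_add_le _ _).trans (by rw [he]; linarith)
      have h2 : t ^ 2 ≤ (3 * ‖z‖) ^ 2 := by rw [← sq_abs t]; gcongr
      calc |ρ| * ‖e + z‖ ≤ (C * (3 * ‖z‖) ^ 2) * 2 := by
            gcongr
            exact hT.trans (by gcongr)
        _ = _ := by ring
    have hLp : 0 ≤ 16 * (L ^ (p - 1) + 1 + ((L + 1) + Q * (L + 1))) := by positivity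
    calc _ ≤ Q / 2 * ‖z‖ ^ 2 + Q / 2 * 3 * ‖z‖ ^ 2 + C * 9 * 2 * ‖z‖ ^ 2 :=
          (norm_add₃_le).trans (by gcongr)
      _ ≤ _ := by nlinarith [sq_nonneg ‖z‖]
  · push Not at hsmall
    have hzL : ‖z‖ ≤ L + 1 := (norm_sub_le _ _).trans (by rw [he]; linarith)
    have h1 : ‖F p x‖ ≤ L ^ (p - 1) := by
      rw [norm_F hp]; exact Real.rpow_le_rpow (norm_nonneg _) hx (by linarith)
    have h2 : ‖((p - 2) * ⟪e, z⟫) • e‖ ≤ Q * (L + 1) := by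
      rw [norm_smul, he, mul_one, norm_mul]
      simp only [Real.norm_eq_abs]
      gcongr
      exact hinner.trans hzL
    have h3 : ‖F p x - e - (z + ((p - 2) * ⟪e, z⟫) • e)‖ ≤ L ^ (p - 1) + 1 + ((L + 1) + Q * (L + 1)) := by
      refine (norm_sub_le _ _).trans (add_le_add ((norm_sub_le _ _).trans (by rw [he]; linarith)) ?_)
      exact (norm_add_le _ _).trans (add_le_add hzL h2)
    have h4 : 1 ≤ 16 * ‖z‖ ^ 2 := by nlinarith
    have h5 : 0 ≤ L ^ (p - 1) + 1 + ((L + 1) + Q * (L + 1)) := by positivity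
    have h6 : 0 ≤ Q / 2 + Q / 2 * 3 + C * 9 * 2 := by positivity
    nlinarith [sq_nonneg ‖z‖]

lemma F_mono_pos (p : ℝ) (hp : 1 < p) (e x : E) (he : ‖e‖ = 1) (hne : x ≠ e) :
    0 < ⟪F p x - e, x - e⟫ := by
  by_cases hx : x = 0
  · subst hx; simp [F, he]
  have ha : 0 < ‖x‖ := by simpa using hx
  set a := ‖x‖ with hadef
  set b := ⟪x, e⟫ with hb
  have hba : b ≤ a := by have := real_inner_le_norm x e; rwa [he, mul_one] at this
  have e1 : ⟪F p x - e, x - e⟫ = a ^ (p - 2) * (a ^ 2 - b) - b + 1 := by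
    simp only [F, inner_sub_left, inner_sub_right, real_inner_smul_left, real_inner_self_eq_norm_sq, he,
      real_inner_comm x e, ← hb, ← hadef]
    ring
  rw [e1]
  set k := a ^ (p - 2) with hk
  have hk0 : 0 < k := by positivity
  have hka : k * a = a ^ (p - 1) := by
    rw [hk, ← Real.rpow_add_one ha.ne']; congr 1; ring
  -- = (k a - 1)(a - 1) + (k + 1)(a - b)
  have e2 : k * (a ^ 2 - b) - b + 1 = (k * a - 1) * (a - 1) + (k + 1) * (a - b) := by ring
  rw [e2]
  rcases lt_trichotomy a 1 with h | h | h
  · have : k * a < 1 := by rw [hka]; exact Real.rpow_lt_one ha.le h (by linarith)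
    nlinarith
  · have hlt : b < a := by
      refine lt_of_le_of_ne hba ?_
      intro hbb
      apply hne
      have h1 : ⟪x, e⟫ = 1 := by rw [← hb, hbb, h]
      exact (inner_eq_one_iff_of_norm_eq_one (𝕜 := ℝ) (by rw [← hadef, h]) he).1 h1
    rw [h]
    nlinarith
  · have : 1 < k * a := by rw [hka]; exact Real.one_lt_rpow h (by linarith)
    nlinarith

lemma F_coercive [FiniteDimensional ℝ E] (p : ℝ) (hp : 1 < p) (L : ℝ) (hL : 0 ≤ L) :
    ∃ c : ℝ, 0 < c ∧ ∀ e x : E, ‖e‖ = 1 → ‖x‖ ≤ L → c * ‖x - e‖ ^ 2 ≤ ⟪F p x - e, x - e⟫ := by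
  obtain ⟨C, hC0, hC⟩ := F_taylor (E := E) p hp L hL
  set m := min 1 (p - 1) with hm
  have hm0 : 0 < m := lt_min one_pos (by linarith)
  set r := m / (2 * C) with hr
  have hr0 : 0 < r := by positivity
  let K : Set (E × E) := (sphere 0 1 ×ˢ closedBall 0 L) ∩ {q | r ≤ ‖q.2 - q.1‖}
  have hK : IsCompact K :=
    ((isCompact_sphere _ _).prod (isCompact_closedBall _ _)).inter_right
      (isClosed_le (by fun_prop) (by fun_prop))
  have hnear : ∀ e x : E, ‖e‖ = 1 → ‖x‖ ≤ L → ‖x - e‖ ≤ r →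
      m / 2 * ‖x - e‖ ^ 2 ≤ ⟪F p x - e, x - e⟫ := by
    intro e x he hx hxr
    have h1 := hC e x he hx
    set z := x - e
    set R := F p x - e - (z + ((p - 2) * ⟪e, z⟫) • e) with hR
    have h2 : F p x - e = R + (z + ((p - 2) * ⟪e, z⟫) • e) := by rw [hR]; abel
    rw [h2]
    simp only [inner_add_left, real_inner_smul_left, real_inner_self_eq_norm_sq]
    have h3 : |⟪R, z⟫| ≤ C * ‖z‖ ^ 2 * ‖z‖ := (abs_real_inner_le_norm _ _).trans (by gcongr)
    have h3' : C * ‖z‖ ^ 2 * ‖z‖ ≤ m / 2 * ‖z‖ ^ 2 := by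
      have : C * ‖z‖ ≤ m / 2 := by
        calc C * ‖z‖ ≤ C * r := by gcongr
          _ = m / 2 := by rw [hr]; field_simp
      calc C * ‖z‖ ^ 2 * ‖z‖ = (C * ‖z‖) * ‖z‖ ^ 2 := by ring
        _ ≤ _ := by gcongr
    have h4 : ⟪e, z⟫ ^ 2 ≤ ‖z‖ ^ 2 := by
      have := abs_real_inner_le_norm e z
      rw [he, one_mul] at this
      rw [← sq_abs]; gcongr
    have h5 : m * ‖z‖ ^ 2 ≤ ‖z‖ ^ 2 + (p - 2) * ⟪e, z⟫ * ⟪e, z⟫ := by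
      rcases le_total 2 p with h | h
      · have : m ≤ 1 := min_le_left _ _
        nlinarith [sq_nonneg ‖z‖, sq_nonneg ⟪e, z⟫]
      · have : m ≤ p - 1 := min_le_right _ _
        nlinarith [sq_nonneg ‖z‖, sq_nonneg ⟪e, z⟫]
    have := (abs_le.1 h3).1
    linarith
  by_cases hne : K.Nonempty
  · have hcont : ContinuousOn (fun q : E × E => ⟪F p q.2 - q.1, q.2 - q.1⟫) K := by
      have := continuous_F (E := E) hp
      fun_prop
    obtain ⟨q, hq, hmin⟩ := hK.exists_isMinOn hne hcont
    have hqe : ‖q.1‖ = 1 := by have := hq.1.1; simpa using this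
    have hpos : 0 < ⟪F p q.2 - q.1, q.2 - q.1⟫ := by
      apply F_mono_pos p hp _ _ hqe
      intro h
      have := hq.2
      simp [h] at this
      linarith
    set c0 := ⟪F p q.2 - q.1, q.2 - q.1⟫
    refine ⟨min (m / 2) (c0 / (L + 1) ^ 2), by positivity, ?_⟩
    intro e x he hx
    rcases le_total ‖x - e‖ r with h | h
    · refine le_trans ?_ (hnear e x he hx h)
      gcongr
      exact min_le_left _ _
    · have h1 : c0 ≤ ⟪F p x - e, x - e⟫ := hmin (a := (e, x)) ⟨⟨by simpa using he, by simpa using hx⟩, h⟩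
      refine le_trans ?_ h1
      have hzL : ‖x - e‖ ≤ L + 1 := (norm_sub_le _ _).trans (by rw [he]; linarith)
      calc min (m / 2) (c0 / (L + 1) ^ 2) * ‖x - e‖ ^ 2 ≤ c0 / (L + 1) ^ 2 * (L + 1) ^ 2 := by
            gcongr
            exact min_le_right _ _
        _ = c0 := by field_simp
  · refine ⟨m / 2, by positivity, ?_⟩
    intro e x he hx
    apply hnear e x he hx
    by_contra h
    push Not at h
    exact hne ⟨(e, x), ⟨by simpa using he, by simpa using hx⟩, h.le⟩

end PartA


/-! ## Part B: weak solutions, rescaling, and Lipschitz test functions -/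

section PartB

set_option linter.unusedSectionVars false

variable {E : Type*} [NormedAddCommGroup E] [InnerProductSpace ℝ E] [FiniteDimensional ℝ E]
  [CompleteSpace E] [MeasurableSpace E] [BorelSpace E]

/-- Everywhere differentiable functions satisfying the (formal) weak equation. -/
structure PH (p : ℝ) (u : E → ℝ) : Prop where
  diff : Differentiable ℝ u
  weak : ∀ φ : E → ℝ, ContDiff ℝ 1 φ → HasCompactSupport φ →
        ∫ x, ‖gradient u x‖ ^ (p - 2) * ⟪gradient u x, gradient φ x⟫ = 0

lemma norm_gradient (u : E → ℝ) (x : E) : ‖gradient u x‖ = ‖fderiv ℝ u x‖ := by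
  simp [gradient]

lemma measurable_gradient (u : E → ℝ) : Measurable (gradient u) := by
  unfold gradient
  exact (LinearIsometryEquiv.continuous _).measurable.comp (measurable_fderiv ℝ u)

lemma PH.weak' {p : ℝ} {u : E → ℝ} (hu : PH p u) (φ : E → ℝ) (h1 : ContDiff ℝ 1 φ)
    (h2 : HasCompactSupport φ) : ∫ x, fderiv ℝ φ x (F p (gradient u x)) = 0 := by
  rw [← hu.weak φ h1 h2]
  congr 1
  ext x
  rw [F, map_smul, smul_eq_mul, real_inner_comm, inner_gradient_left]

lemma hasFDerivAt_rescale {u : E → ℝ} (hu : Differentiable ℝ u) (x₀ : E) (r m c : ℝ) (x : E) :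
    HasFDerivAt (fun x => m * (u (x₀ + r • x) - c)) ((m * r) • fderiv ℝ u (x₀ + r • x)) x := by
  have h1 : HasFDerivAt (fun x : E => x₀ + r • x) (r • ContinuousLinearMap.id ℝ E) x :=
    ((hasFDerivAt_id x).const_smul r).const_add x₀
  have h2 := (((hu (x₀ + r • x)).hasFDerivAt.comp x h1).sub_const c).const_mul m
  refine h2.congr_fderiv ?_
  ext v
  simp
  ring

lemma gradient_rescale {u : E → ℝ} (hu : Differentiable ℝ u) (x₀ : E) (r m c : ℝ) (x : E) :
    gradient (fun x => m * (u (x₀ + r • x) - c)) x = (m * r) • gradient u (x₀ + r • x) := by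
  unfold gradient
  rw [(hasFDerivAt_rescale hu x₀ r m c x).fderiv]
  simp

lemma integral_rescale (f : E → ℝ) (x₀ : E) (r : ℝ) (hf : ∫ x, f x = 0) :
    ∫ x, f (x₀ + r • x) = 0 := by
  have := Measure.integral_comp_smul (volume : Measure E) (fun y => f (x₀ + y)) r
  rw [this, integral_add_left_eq_self (μ := (volume : Measure E)) f x₀, hf, smul_zero]

lemma PH.rescale {p : ℝ} {u : E → ℝ} (hu : PH p u) (x₀ : E) {r m : ℝ} (hr : 0 < r) (hm : 0 < m) (c : ℝ) :
    PH p (fun x => m * (u (x₀ + r • x) - c)) := by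
  refine ⟨fun x => (hasFDerivAt_rescale hu.diff x₀ r m c x).differentiableAt, ?_⟩
  intro φ h1 h2
  have hmr : 0 < m * r := by positivity
  let χ : E → ℝ := fun y => φ (r⁻¹ • (y - x₀))
  have hχ1 : ContDiff ℝ 1 χ := h1.comp (by fun_prop)
  have hχ2 : HasCompactSupport χ := by
    have : χ = φ ∘ ((Homeomorph.subRight x₀).trans (Homeomorph.smulOfNeZero r⁻¹ (inv_ne_zero hr.ne'))) := by
      ext y; simp [χ]
    rw [this]
    exact h2.comp_homeomorph _
  have hφχ : ∀ x, φ x = χ (x₀ + r • x) := by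
    intro x; simp [χ, smul_smul, hr.ne']
  have hfd : ∀ x, fderiv ℝ φ x = r • fderiv ℝ χ (x₀ + r • x) := by
    intro x
    have h := hasFDerivAt_rescale (hχ1.differentiable one_ne_zero) x₀ r 1 0 x
    have e : (fun x => 1 * (χ (x₀ + r • x) - 0)) = φ := by ext x; rw [hφχ]; ring
    rw [e] at h
    rw [h.fderiv, one_mul]
  have key := integral_rescale (fun y => fderiv ℝ χ y (F p (gradient u y))) x₀ r (hu.weak' χ hχ1 hχ2)
  have : ∀ x, ‖gradient (fun x => m * (u (x₀ + r • x) - c)) x‖ ^ (p - 2) *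
      ⟪gradient (fun x => m * (u (x₀ + r • x) - c)) x, gradient φ x⟫
      = (r * (m * r) ^ (p - 1)) * fderiv ℝ χ (x₀ + r • x) (F p (gradient u (x₀ + r • x))) := by
    intro x
    rw [real_inner_comm, inner_gradient_left, ← smul_eq_mul, ← map_smul]
    change fderiv ℝ φ x (F p (gradient _ x)) = _
    rw [gradient_rescale hu.diff, F_smul hmr, map_smul, hfd]
    simp
    ring
  simp_rw [this]
  rw [integral_const_mul, key, mul_zero]

lemma integral_fderiv_zero (φ : E → ℝ) (hφ : Differentiable ℝ φ) (hc : HasCompactSupport φ) {M : ℝ}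
    (hM : ∀ x, ‖fderiv ℝ φ x‖ ≤ M) (e : E) : ∫ x, fderiv ℝ φ x e = 0 := by
  have hIntg : Integrable (fun x => fderiv ℝ φ x e) := by
    have hcs : HasCompactSupport (fun x => fderiv ℝ φ x e) := hc.fderiv_apply ℝ e
    rw [← integrableOn_iff_integrable_of_support_subset (subset_tsupport _)]
    refine Measure.integrableOn_of_bounded (M := M * ‖e‖) hcs.measure_lt_top.ne
      (measurable_fderiv_apply_const ℝ φ e).aestronglyMeasurable ?_
    exact Filter.Eventually.of_forall (fun x => (ContinuousLinearMap.le_opNorm _ _).trans (by gcongr; exact hM x))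
  have h := integral_bilinear_hasLineDerivAt_right_eq_neg_left_of_integrable (μ := (volume : Measure E))
    (f := fun _ => (1:ℝ)) (f' := fun _ => (0:ℝ)) (g := φ) (g' := fun x => fderiv ℝ φ x e) (v := e)
    (B := ContinuousLinearMap.mul ℝ ℝ) (by simp) (by simpa using hIntg)
    (by simpa using hφ.continuous.integrable_of_hasCompactSupport hc)
    (fun x _ => by simpa using (hasFDerivAt_const (𝕜 := ℝ) (1:ℝ) x).hasLineDerivAt e) (fun x _ => (hφ x).hasFDerivAt.hasLineDerivAt e)
  simpa using h

/-- The weak equation can be tested against differentiable Lipschitz functions. -/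
lemma PH.weakL {p : ℝ} (hp : 1 < p) {u : E → ℝ} (hu : PH p u) {L : ℝ} (hL : ∀ x ∈ ball (0:E) 2, ‖gradient u x‖ ≤ L)
    (φ : E → ℝ) (hφ : Differentiable ℝ φ) (hsupp : ∀ x, 1 < ‖x‖ → φ x = 0) {M : ℝ}
    (hM : ∀ x, ‖fderiv ℝ φ x‖ ≤ M) : ∫ x, fderiv ℝ φ x (F p (gradient u x)) = 0 := by
  have hL0 : 0 ≤ L := (norm_nonneg _).trans (hL 0 (by simp))
  have hM0 : 0 ≤ M := (norm_nonneg _).trans (hM 0)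
  let B : ℕ → ContDiffBump (0:E) := fun k => ⟨1 / (4 * ((k:ℝ) + 1)), 1 / (2 * ((k:ℝ) + 1)), by positivity, by
    apply one_div_lt_one_div_of_lt <;> nlinarith [(Nat.cast_nonneg k : (0:ℝ) ≤ k)]⟩
  have hBout : ∀ k, (B k).rOut = 1 / (2 * ((k:ℝ) + 1)) := fun k => rfl
  have hBout2 : ∀ k, (B k).rOut ≤ 1/2 := by
    intro k; rw [hBout]
    apply one_div_le_one_div_of_le <;> nlinarith [(Nat.cast_nonneg k : (0:ℝ) ≤ k)]
  have hBlim : Filter.Tendsto (fun k => (B k).rOut) Filter.atTop (nhds 0) := by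
    have h := (tendsto_one_div_add_atTop_nhds_zero_nat (𝕜 := ℝ)).const_mul (1/2)
    rw [mul_zero] at h
    refine h.congr ?_
    intro k; rw [hBout]; field_simp
  let g : E → (E →L[ℝ] ℝ) := fderiv ℝ φ
  have hgm : Measurable g := measurable_fderiv ℝ φ
  have hgloc : LocallyIntegrable g := by
    have hconst : LocallyIntegrable (fun _ : E => M) := (continuous_const).locallyIntegrable
    exact hconst.mono hgm.aestronglyMeasurable
      (Filter.Eventually.of_forall (fun x => (hM x).trans (le_abs_self _)))
  have hgint : ∀ k x, Integrable (fun t => (B k).normed volume t • g (x - t)) := by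
    intro k x
    have hBi : Integrable (fun t => M * (B k).normed volume t) := ((B k).integrable_normed).const_mul M
    refine hBi.mono' ?_ ?_
    · exact ((B k).continuous_normed.measurable.smul (hgm.comp (measurable_const.sub measurable_id))).aestronglyMeasurable
    · refine Filter.Eventually.of_forall (fun t => ?_)
      rw [norm_smul, Real.norm_eq_abs, abs_of_nonneg ((B k).nonneg_normed t), mul_comm]
      gcongr
      · exact (B k).nonneg_normed t
      · exact hM _
  let f : ℕ → E → ℝ := fun k => convolution ((B k).normed volume) φ (ContinuousLinearMap.lsmul ℝ ℝ) volume
  have hfC : ∀ k, ContDiff ℝ 1 (f k) := fun k =>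
    HasCompactSupport.contDiff_convolution_left (n := 1) _ (B k).hasCompactSupport_normed
      ((B k).contDiff_normed) hφ.continuous.locallyIntegrable
  have hfd : ∀ k x, fderiv ℝ (f k) x = ∫ t, (B k).normed volume t • g (x - t) := by
    intro k x
    apply HasFDerivAt.fderiv
    have hBi : Integrable (fun t => M * (B k).normed volume t) := ((B k).integrable_normed).const_mul M
    have := hasFDerivAt_integral_of_dominated_of_fderiv_le (𝕜 := ℝ) (μ := (volume : Measure E)) (s := Set.univ)
      (F := fun x t => (B k).normed volume t • φ (x - t)) (x₀ := x)
      (F' := fun x t => (B k).normed volume t • g (x - t))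
      (bound := fun t => M * (B k).normed volume t) Filter.univ_mem
      (Filter.Eventually.of_forall (fun y =>
        ((B k).continuous_normed.smul (hφ.continuous.comp (by fun_prop))).aestronglyMeasurable))
      (((B k).continuous_normed.smul (hφ.continuous.comp (by fun_prop))).integrable_of_hasCompactSupport
        ((B k).hasCompactSupport_normed.smul_right))
      ((hgint k x).aestronglyMeasurable)
      (Filter.Eventually.of_forall (fun t y _ => by
        rw [norm_smul, Real.norm_eq_abs, abs_of_nonneg ((B k).nonneg_normed t), mul_comm]
        gcongr
        · exact (B k).nonneg_normed t
        · exact hM _))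
      hBi
      (Filter.Eventually.of_forall (fun t y _ => by
        have h1 : HasFDerivAt (fun y => φ (y - t)) (g (y - t)) y := by
          have := (hφ (y - t)).hasFDerivAt.comp y ((hasFDerivAt_id y).sub_const t)
          exact this.congr_fderiv (by ext w; simp [g])
        exact h1.const_smul ((B k).normed volume t)))
    exact this
  have hfbound : ∀ k x, ‖fderiv ℝ (f k) x‖ ≤ M := by
    intro k x
    rw [hfd]
    calc _ ≤ ∫ t, M * (B k).normed volume t := by
          apply norm_integral_le_of_norm_le (((B k).integrable_normed).const_mul M)
          refine Filter.Eventually.of_forall (fun t => ?_)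
          rw [norm_smul, Real.norm_eq_abs, abs_of_nonneg ((B k).nonneg_normed t), mul_comm]
          gcongr
          · exact (B k).nonneg_normed t
          · exact hM _
      _ = M := by rw [integral_const_mul, (B k).integral_normed, mul_one]
  have hfsupp : ∀ k x, 3/2 < ‖x‖ → f k x = 0 := by
    intro k x hx
    have : ∀ t, (B k).normed volume t • φ (x - t) = 0 := by
      intro t
      by_cases ht : t ∈ ball (0:E) (B k).rOut
      · rw [hsupp, smul_zero]
        have h1 : ‖t‖ < 1/2 := by have := mem_ball_zero_iff.1 ht; linarith [hBout2 k]
        have := norm_sub_norm_le x t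
        linarith
      · rw [← (B k).support_normed_eq (μ := volume)] at ht
        rw [Function.notMem_support.1 ht, zero_smul]
    change ∫ t, (B k).normed volume t • φ (x - t) = 0
    simp_rw [this]; simp
  have hfc : ∀ k, HasCompactSupport (f k) := fun k =>
    HasCompactSupport.intro (isCompact_closedBall (0:E) (3/2))
      (fun x hx => hfsupp k x (by simpa using hx))
  have hfdsupp : ∀ k x, x ∉ closedBall (0:E) (3/2) → fderiv ℝ (f k) x = 0 := by
    intro k x hx
    have hev : f k =ᶠ[nhds x] fun _ => 0 := by
      filter_upwards [isClosed_closedBall.isOpen_compl.mem_nhds hx] with y hy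
      exact hfsupp k y (by simpa using hy)
    rw [hev.fderiv_eq]; simp
  have hlim : ∀ᵐ x, Filter.Tendsto (fun k => fderiv ℝ (f k) x) Filter.atTop (nhds (g x)) := by
    have := ContDiffBump.ae_convolution_tendsto_right_of_locallyIntegrable (μ := (volume : Measure E))
      (φ := B) (K := 2) hBlim (Filter.Eventually.of_forall (fun k => by
        change 1 / (2 * ((k:ℝ) + 1)) ≤ 2 * (1 / (4 * ((k:ℝ) + 1)))
        apply le_of_eq; field_simp; norm_num)) hgloc
    filter_upwards [this] with x hx
    refine hx.congr (fun k => ?_)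
    rw [hfd]; simp [convolution]
  have hFm : Measurable (fun x => F p (gradient u x)) := (continuous_F hp).measurable.comp (measurable_gradient u)
  have hT := tendsto_integral_of_dominated_convergence (μ := (volume : Measure E))
    (F := fun k x => fderiv ℝ (f k) x (F p (gradient u x)))
    (f := fun x => g x (F p (gradient u x)))
    ((closedBall (0:E) (3/2)).indicator (fun _ => M * L ^ (p - 1)))
    (fun k => by
      have hc : Continuous (fderiv ℝ (f k)) := (hfC k).continuous_fderiv one_ne_zero
      exact (isBoundedBilinearMap_apply.continuous.comp_stronglyMeasurable
        (hc.stronglyMeasurable.prodMk hFm.stronglyMeasurable)).aestronglyMeasurable)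
    ((integrable_indicator_iff measurableSet_closedBall).2
      (integrableOn_const (isCompact_closedBall (0:E) (3/2)).measure_lt_top.ne))
    (fun k => Filter.Eventually.of_forall (fun x => by
      by_cases hx : x ∈ closedBall (0:E) (3/2)
      · rw [Set.indicator_of_mem hx]
        refine (ContinuousLinearMap.le_opNorm _ _).trans ?_
        gcongr
        · exact hfbound k x
        · rw [norm_F hp]
          have hx2 : x ∈ ball (0:E) 2 := by
            rw [mem_closedBall_zero_iff] at hx; rw [mem_ball_zero_iff]; linarith
          exact Real.rpow_le_rpow (norm_nonneg _) (hL x hx2) (by linarith)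
      · rw [Set.indicator_of_notMem hx, hfdsupp k x hx]; simp))
    (by
      filter_upwards [hlim] with x hx
      exact ((ContinuousLinearMap.apply ℝ ℝ (F p (gradient u x))).continuous.tendsto _).comp hx)
  have h0 : (fun k => ∫ x, fderiv ℝ (f k) x (F p (gradient u x))) = fun _ => 0 := by
    ext k; exact hu.weak' (f k) (hfC k) (hfc k)
  rw [h0] at hT
  exact tendsto_nhds_unique hT tendsto_const_nhds

end PartB


/-! ## Part C: polynomial bumps and the Caccioppoli inequality -/

section PartC

set_option linter.unusedSectionVars false

variable {E : Type*} [NormedAddCommGroup E] [InnerProductSpace ℝ E] [FiniteDimensional ℝ E]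
  [CompleteSpace E] [MeasurableSpace E] [BorelSpace E]

lemma hasDerivAt_maxpow (k : ℕ) (t : ℝ) :
    HasDerivAt (fun t : ℝ => (max 0 t) ^ (k + 2)) ((k + 2) * (max 0 t) ^ (k + 1)) t := by
  rcases lt_trichotomy t 0 with h | h | h
  · have : (fun t : ℝ => (max 0 t) ^ (k + 2)) =ᶠ[nhds t] fun _ => 0 := by
      filter_upwards [gt_mem_nhds h] with s hs
      rw [max_eq_left hs.le]; simp
    rw [max_eq_left h.le]
    simpa using (hasDerivAt_const t (0:ℝ)).congr_of_eventuallyEq this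
  · subst h
    simp only [max_self]
    rw [zero_pow (by omega), mul_zero, hasDerivAt_iff_isLittleO]
    simp only [max_self, sub_zero, smul_zero]
    rw [zero_pow (by omega)]
    simp only [sub_zero]
    have h1 : (fun t : ℝ => max 0 t ^ (k+2)) =O[nhds 0] fun t : ℝ => t ^ (k+2) := by
      refine Asymptotics.IsBigO.of_bound 1 (Filter.Eventually.of_forall fun t => ?_)
      rw [one_mul, norm_pow, norm_pow]
      gcongr
      rw [Real.norm_eq_abs, Real.norm_eq_abs, abs_of_nonneg (le_max_left _ _)]
      exact max_le (abs_nonneg _) (le_abs_self _)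
    refine h1.trans_isLittleO ?_
    simpa using Asymptotics.isLittleO_pow_pow (𝕜 := ℝ) (m := 1) (n := k+2) (by omega)
  · have : (fun t : ℝ => (max 0 t) ^ (k + 2)) =ᶠ[nhds t] fun t => t ^ (k+2) := by
      filter_upwards [lt_mem_nhds h] with s hs
      rw [max_eq_right hs.le]
    rw [max_eq_right h.le]
    have h2 := (hasDerivAt_pow (k+2) t).congr_of_eventuallyEq this
    have e1 : ((k:ℝ) + 2) * t ^ (k + 1) = ((k + 2 : ℕ) : ℝ) * t ^ (k + 2 - 1) := by
      push_cast
      rfl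
    rw [e1]; exact h2

/-- The truncated paraboloid. -/
noncomputable def qq (x : E) : ℝ := max 0 (1 - ‖x‖ ^ 2)

lemma qq_nonneg (x : E) : 0 ≤ qq x := le_max_left _ _
lemma qq_le_one (x : E) : qq x ≤ 1 := by
  unfold qq; exact max_le zero_le_one (by nlinarith [sq_nonneg ‖x‖])
lemma continuous_qq : Continuous (qq : E → ℝ) := by unfold qq; fun_prop
lemma qq_eq_zero {x : E} (h : 1 ≤ ‖x‖) : qq x = 0 := by
  unfold qq; exact max_eq_left (by nlinarith)
lemma qq_neg (x : E) : qq (-x) = qq x := by simp [qq]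

lemma hasFDerivAt_qq_pow (k : ℕ) (x : E) :
    HasFDerivAt (fun x : E => qq x ^ (k + 2))
      ((-(2 * (k + 2) * qq x ^ (k + 1))) • (innerSL ℝ x)) x := by
  have h1 : HasFDerivAt (fun x : E => 1 - ‖x‖ ^ 2) (-(2 • innerSL ℝ x)) x :=
    (HasStrictFDerivAt.hasFDerivAt (hasStrictFDerivAt_norm_sq x)).const_sub 1
  have h2 := (hasDerivAt_maxpow k (1 - ‖x‖ ^ 2)).comp_hasFDerivAt x h1
  refine h2.congr_fderiv ?_
  ext v
  simp [qq]
  ring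

lemma differentiable_qq_pow (k : ℕ) : Differentiable ℝ (fun x : E => qq x ^ (k + 2)) :=
  fun x => (hasFDerivAt_qq_pow k x).differentiableAt

lemma contDiff_qq_pow (k : ℕ) : ContDiff ℝ 1 (fun x : E => qq x ^ (k + 2)) := by
  rw [contDiff_one_iff_fderiv]
  refine ⟨differentiable_qq_pow k, ?_⟩
  have : fderiv ℝ (fun x : E => qq x ^ (k + 2)) =
      fun x => (-(2 * (k + 2) * qq x ^ (k + 1))) • (innerSL ℝ x) := by
    ext1 x; exact (hasFDerivAt_qq_pow k x).fderiv
  rw [this]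
  have := continuous_qq (E := E)
  fun_prop

lemma hasCompactSupport_qq_pow (k : ℕ) : HasCompactSupport (fun x : E => qq x ^ (k + 1)) :=
  HasCompactSupport.intro (isCompact_closedBall (0:E) 1)
    (fun x hx => by
      rw [qq_eq_zero (by simpa using (not_le.1 (fun h => hx (mem_closedBall_zero_iff.2 h))).le)]
      simp)

/-- Bounded measurable functions are integrable on bounded sets. -/
lemma integrableOn_ball_of_bdd {f : E → ℝ} (hf : Measurable f) (x : E) (r : ℝ) {M : ℝ}
    (hM : ∀ y ∈ ball x r, |f y| ≤ M) : IntegrableOn f (ball x r) := by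
  refine Measure.integrableOn_of_bounded (M := M) measure_ball_lt_top.ne hf.aestronglyMeasurable ?_
  exact (ae_restrict_iff' measurableSet_ball).2 (Filter.Eventually.of_forall (fun y hy => hM y hy))

lemma F_lip (p : ℝ) (hp : 1 < p) (L : ℝ) (hL : 0 < L) : ∃ C > 0, ∀ e x : E, ‖e‖ = 1 → ‖x‖ ≤ L →
    ‖F p x - e‖ ≤ C * ‖x - e‖ := by
  obtain ⟨C, hC, h⟩ := F_taylor (E := E) p hp L hL.le
  refine ⟨C * (L + 1) + 1 + |p - 2|, by positivity, ?_⟩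
  intro e x he hx
  have h1 := h e x he hx
  have h2 : ‖x - e‖ ≤ L + 1 := (norm_sub_le _ _).trans (by rw [he]; linarith)
  have h3 : ‖(x-e) + ((p-2)*⟪e,x-e⟫)•e‖ ≤ (1 + |p-2|) * ‖x-e‖ := by
    refine (norm_add_le _ _).trans ?_
    rw [norm_smul, he, mul_one, Real.norm_eq_abs, abs_mul]
    have := abs_real_inner_le_norm e (x-e)
    rw [he, one_mul] at this
    nlinarith [abs_nonneg (p-2)]
  have h4 : ‖F p x - e‖ ≤ ‖F p x - e - ((x-e) + ((p-2)*⟪e,x-e⟫)•e)‖ + ‖(x-e) + ((p-2)*⟪e,x-e⟫)•e‖ := by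
    have := norm_add_le (F p x - e - ((x-e) + ((p-2)*⟪e,x-e⟫)•e)) ((x-e) + ((p-2)*⟪e,x-e⟫)•e)
    rwa [sub_add_cancel] at this
  have h5 : C * ‖x-e‖^2 ≤ C * (L+1) * ‖x-e‖ := by
    rw [sq, mul_assoc]
    gcongr
  nlinarith

lemma gradient_sub_affine {u : E → ℝ} (hu : Differentiable ℝ u) (c : ℝ) (e : E) (x : E) :
    HasFDerivAt (fun x => u x - c - ⟪e, x⟫) (innerSL ℝ (gradient u x - e)) x := by
  have h1 := ((hu x).hasFDerivAt.sub_const c).sub ((innerSL ℝ e).hasFDerivAt (x := x))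
  refine HasFDerivAt.congr_fderiv h1 ?_
  ext v
  simp [inner_gradient_left]

lemma caccioppoli (p : ℝ) (hp : 1 < p) (L : ℝ) (hL0 : 0 < L) : ∃ C > 0, ∀ (u : E → ℝ) (e : E) (c : ℝ),
    PH p u → (∀ x ∈ ball (0:E) 2, ‖gradient u x‖ ≤ L) → ‖e‖ = 1 →
    ∫ x in ball (0:E) (1/2), ‖gradient u x - e‖ ^ 2 ≤ C * ∫ x in ball (0:E) 1, (u x - c - ⟪e, x⟫) ^ 2 := by
  obtain ⟨c0, hc0, hco⟩ := F_coercive (E := E) p hp L hL0.le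
  obtain ⟨C2, hC2, hlip⟩ := F_lip (E := E) p hp L hL0
  let C3 := 32 * C2 ^ 2 / c0
  have hC3 : 0 < C3 := by positivity
  refine ⟨C3 / (c0 / 2 * (3/4)^4), by positivity, ?_⟩
  intro u e c hu hL he
  set w : E → ℝ := fun x => u x - c - ⟪e, x⟫ with hw
  have hwd : ∀ x, HasFDerivAt w (innerSL ℝ (gradient u x - e)) x := gradient_sub_affine hu.diff c e
  have hwdiff : Differentiable ℝ w := fun x => (hwd x).differentiableAt
  have hwc : Continuous w := hwdiff.continuous
  have hgm := measurable_gradient u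
  have hgw : ∀ x ∈ ball (0:E) 2, ‖gradient u x - e‖ ≤ L + 1 := fun x hx =>
    (norm_sub_le _ _).trans (by rw [he]; linarith [hL x hx])
  obtain ⟨W, hW⟩ : ∃ W, ∀ x ∈ closedBall (0:E) 1, ‖w x‖ ≤ W :=
    (isCompact_closedBall (0:E) 1).exists_bound_of_continuousOn hwc.continuousOn
  have hW0 : 0 ≤ W := (norm_nonneg _).trans (hW 0 (by simp))
  let φ : E → ℝ := fun x => qq x ^ 4 * w x
  have hφd : ∀ x, HasFDerivAt φ (qq x ^ 4 • innerSL ℝ (gradient u x - e) +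
      w x • ((-(2 * ((2:ℕ) + 2) * qq x ^ 3)) • (innerSL ℝ x))) x := by
    intro x
    exact (hasFDerivAt_qq_pow 2 x).mul (hwd x)
  have hφdiff : Differentiable ℝ φ := fun x => (hφd x).differentiableAt
  have hfd : ∀ x v, fderiv ℝ φ x v = qq x ^ 4 * ⟪gradient u x - e, v⟫ - 8 * qq x ^ 3 * w x * ⟪x, v⟫ := by
    intro x v
    rw [(hφd x).fderiv]
    simp only [add_apply, smul_apply, innerSL_apply_apply, smul_eq_mul]
    push_cast
    ring
  have hq0 := qq_nonneg (E := E)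
  have hq1 := qq_le_one (E := E)
  have hfd0 : ∀ x, 1 ≤ ‖x‖ → fderiv ℝ φ x = 0 := by
    intro x hx
    ext v
    rw [hfd, qq_eq_zero hx]; simp
  have hφM : ∀ x, ‖fderiv ℝ φ x‖ ≤ (L + 1) + 8 * W := by
    intro x
    by_cases hx : 1 ≤ ‖x‖
    · rw [hfd0 x hx, norm_zero]; positivity
    · push Not at hx
      refine ContinuousLinearMap.opNorm_le_bound _ (by positivity) (fun v => ?_)
      rw [hfd, Real.norm_eq_abs]
      have h1 := hgw x (by rw [mem_ball_zero_iff]; linarith)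
      have h2 := hW x (by rw [mem_closedBall_zero_iff]; linarith)
      calc |qq x ^ 4 * ⟪gradient u x - e, v⟫ - 8 * qq x ^ 3 * w x * ⟪x, v⟫|
          ≤ qq x ^ 4 * |⟪gradient u x - e, v⟫| + 8 * qq x ^ 3 * ‖w x‖ * |⟪x, v⟫| := by
            refine (abs_sub _ _).trans (le_of_eq ?_)
            rw [abs_mul, abs_mul, abs_mul, abs_mul, abs_of_nonneg (pow_nonneg (hq0 x) 4),
              abs_of_nonneg (pow_nonneg (hq0 x) 3), Real.norm_eq_abs]
            norm_num
        _ ≤ 1 * ((L+1) * ‖v‖) + 8 * 1 * W * (1 * ‖v‖) := by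
            have h3 := pow_le_one₀ (n := 4) (hq0 x) (hq1 x)
            have h4 := pow_le_one₀ (n := 3) (hq0 x) (hq1 x)
            gcongr
            · exact (abs_real_inner_le_norm _ _).trans (by gcongr)
            · exact (abs_real_inner_le_norm _ _).trans (by gcongr)
        _ = _ := by ring
  have hsupp : ∀ x, 1 < ‖x‖ → φ x = 0 := fun x hx => by simp [φ, qq_eq_zero hx.le]
  have hcs : HasCompactSupport φ := HasCompactSupport.intro (isCompact_closedBall (0:E) 1)
    (fun x hx => hsupp x (by simpa using hx))
  have i1 := hu.weakL hp hL φ hφdiff hsupp hφM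
  have i2 := integral_fderiv_zero φ hφdiff hcs hφM e
  have m1 : Measurable (fun x => fderiv ℝ φ x (F p (gradient u x))) := by
    have : (fun x => fderiv ℝ φ x (F p (gradient u x))) = fun x => qq x ^ 4 * ⟪gradient u x - e, F p (gradient u x)⟫ - 8 * qq x ^ 3 * w x * ⟪x, F p (gradient u x)⟫ := by
      ext x; rw [hfd]
    rw [this]
    have a1 := continuous_qq (E := E).measurable
    have a2 := hwc.measurable
    have a3 : Measurable (fun x => F p (gradient u x)) := (continuous_F hp).measurable.comp hgm
    fun_prop
  have m2 : Measurable (fun x => fderiv ℝ φ x e) := measurable_fderiv_apply_const ℝ φ e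
  have hsub : ball (0:E) 1 ⊆ ball (0:E) 2 := ball_subset_ball (by norm_num)
  have k1 : IntegrableOn (fun x => fderiv ℝ φ x (F p (gradient u x))) (ball (0:E) 1) := by
    refine integrableOn_ball_of_bdd m1 0 1 (M := ((L + 1) + 8 * W) * L ^ (p - 1)) (fun x hx => ?_)
    rw [← Real.norm_eq_abs]
    refine (ContinuousLinearMap.le_opNorm _ _).trans ?_
    gcongr
    · exact hφM x
    · rw [norm_F hp]
      exact Real.rpow_le_rpow (norm_nonneg _) (hL x (hsub hx)) (by linarith)
  have k2 : IntegrableOn (fun x => fderiv ℝ φ x e) (ball (0:E) 1) := by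
    refine integrableOn_ball_of_bdd m2 0 1 (M := ((L + 1) + 8 * W) * 1) (fun x hx => ?_)
    rw [← Real.norm_eq_abs]
    refine (ContinuousLinearMap.le_opNorm _ _).trans ?_
    rw [he]
    gcongr
    exact hφM x
  have k3 : IntegrableOn (fun x => w x ^ 2) (ball (0:E) 1) :=
    integrableOn_ball_of_bdd (by fun_prop) 0 1 (M := W ^ 2) (fun x hx => by
      rw [abs_of_nonneg (sq_nonneg _), ← sq_abs]
      gcongr
      exact hW x (ball_subset_closedBall hx))
  have k4 : IntegrableOn (fun x => c0 / 2 * (qq x ^ 4 * ‖gradient u x - e‖ ^ 2)) (ball (0:E) 1) := by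
    refine integrableOn_ball_of_bdd ?_ 0 1 (M := c0 / 2 * (1 * (L+1) ^ 2)) (fun x hx => ?_)
    · have a1 := continuous_qq (E := E).measurable
      fun_prop
    · rw [abs_of_nonneg (mul_nonneg (by positivity) (mul_nonneg (pow_nonneg (hq0 x) 4) (sq_nonneg _)))]
      gcongr
      · exact pow_le_one₀ (hq0 x) (hq1 x)
      · exact hgw x (hsub hx)
  have z1 : ∫ x in ball (0:E) 1, fderiv ℝ φ x (F p (gradient u x)) = 0 := by
    rw [setIntegral_eq_integral_of_forall_compl_eq_zero, i1]
    intro x hx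
    rw [hfd0 x (by simpa using hx)]; simp
  have z2 : ∫ x in ball (0:E) 1, fderiv ℝ φ x e = 0 := by
    rw [setIntegral_eq_integral_of_forall_compl_eq_zero, i2]
    intro x hx
    rw [hfd0 x (by simpa using hx)]; simp
  have key : ∫ x in ball (0:E) 1, c0 / 2 * (qq x ^ 4 * ‖gradient u x - e‖ ^ 2) ≤
      ∫ x in ball (0:E) 1, (fderiv ℝ φ x (F p (gradient u x)) - fderiv ℝ φ x e + C3 * w x ^ 2) := by
    refine setIntegral_mono_on k4 ((k1.sub k2).add (k3.const_mul C3)) measurableSet_ball (fun x hx => ?_)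
    have h1 := hco e _ he (hL x (hsub hx))
    have h2 := hlip e _ he (hL x (hsub hx))
    rw [← map_sub, hfd]
    rw [real_inner_comm] at h1
    set A := ‖gradient u x - e‖
    have h3 : |⟪x, F p (gradient u x) - e⟫| ≤ C2 * A := by
      refine (abs_real_inner_le_norm _ _).trans ?_
      have : ‖x‖ ≤ 1 := by rw [mem_ball_zero_iff] at hx; exact hx.le
      nlinarith [norm_nonneg (F p (gradient u x) - e)]
    have hA : 0 ≤ A := norm_nonneg _
    have h4 : w x * ⟪x, F p (gradient u x) - e⟫ ≤ |w x| * (C2 * A) := by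
      refine (le_abs_self _).trans ?_
      rw [abs_mul]; gcongr
    have h5 : 8 * |w x| * (C2 * A) * qq x ≤ c0 / 2 * (qq x ^ 2 * A ^ 2) + C3 * w x ^ 2 := by
      have : C3 * w x ^ 2 = 32 * C2 ^ 2 / c0 * |w x| ^ 2 := by rw [sq_abs]
      rw [this]
      have hsq : 0 ≤ (c0 * (qq x * A) - 8 * C2 * |w x|) ^ 2 / (2 * c0) := by positivity
      have e1 : (c0 * (qq x * A) - 8 * C2 * |w x|) ^ 2 / (2 * c0) =
        c0 / 2 * (qq x ^ 2 * A ^ 2) + 32 * C2 ^ 2 / c0 * |w x| ^ 2 - 8 * |w x| * (C2 * A) * qq x := by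
        field_simp
        ring
      linarith
    have hq := hq0 x
    have h6 : 8 * qq x ^ 3 * (w x * ⟪x, F p (gradient u x) - e⟫) ≤ qq x ^ 2 * (c0 / 2 * (qq x ^ 2 * A ^ 2) + C3 * w x ^ 2) := by
      calc _ ≤ 8 * qq x ^ 3 * (|w x| * (C2 * A)) := by gcongr
        _ = qq x ^ 2 * (8 * |w x| * (C2 * A) * qq x) := by ring
        _ ≤ _ := by gcongr
    have h7 : qq x ^ 2 * (C3 * w x ^ 2) ≤ 1 * (C3 * w x ^ 2) := by
      gcongr; exact pow_le_one₀ hq (hq1 x)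
    have h8 : qq x ^ 4 * (c0 * A ^ 2) ≤ qq x ^ 4 * ⟪gradient u x - e, F p (gradient u x) - e⟫ := by
      gcongr
    nlinarith
  have hR : ∫ x in ball (0:E) 1, (fderiv ℝ φ x (F p (gradient u x)) - fderiv ℝ φ x e + C3 * w x ^ 2) = C3 * ∫ x in ball (0:E) 1, w x ^ 2 := by
    have := integral_add (k1.sub k2) (k3.const_mul C3)
    simp only [Pi.sub_apply] at this
    rw [this, integral_sub k1 k2, z1, z2, integral_const_mul]
    ring
  have hLb : c0 / 2 * (3/4)^4 * ∫ x in ball (0:E) (1/2), ‖gradient u x - e‖ ^ 2 ≤ ∫ x in ball (0:E) 1, c0 / 2 * (qq x ^ 4 * ‖gradient u x - e‖ ^ 2) := by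
    have hsb : ball (0:E) (1/2) ⊆ ball (0:E) 1 := ball_subset_ball (by norm_num)
    rw [← integral_const_mul]
    refine le_trans ?_ (setIntegral_mono_set k4 (Filter.Eventually.of_forall fun x => ?_) (Filter.Eventually.of_forall hsb))
    · refine setIntegral_mono_on ?_ (k4.mono_set hsb) measurableSet_ball (fun x hx => ?_)
      · refine integrableOn_ball_of_bdd (by fun_prop) 0 (1/2) (M := c0 / 2 * (3/4)^4 * (L+1)^2) (fun x hx => ?_)
        rw [abs_of_nonneg (by positivity)]
        gcongr
        exact hgw x (hsub (hsb hx))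
      · rw [mul_assoc]
        gcongr
        rw [mem_ball_zero_iff] at hx
        exact (le_max_right _ _).trans' (by nlinarith [norm_nonneg x])
    · exact mul_nonneg (by positivity) (mul_nonneg (pow_nonneg (hq0 x) 4) (sq_nonneg _))
  rw [div_mul_eq_mul_div, le_div_iff₀ (by positivity), mul_comm]
  linarith

end PartC

/-! ## Part D1: integral tools -/

section PartD

set_option linter.unusedSectionVars false

variable {E : Type*} [NormedAddCommGroup E] [InnerProductSpace ℝ E] [FiniteDimensional ℝ E]
  [CompleteSpace E] [MeasurableSpace E] [BorelSpace E]

lemma integral_comp_affine (f : E → ℝ) (x : E) {s : ℝ} (hs : 0 < s) :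
    ∫ z, f (x + s • z) = (s ^ Module.finrank ℝ E)⁻¹ * ∫ y, f y := by
  rw [Measure.integral_comp_smul (volume : Measure E) (fun y => f (x + y)) s,
    integral_add_left_eq_self (μ := (volume : Measure E)) f x, smul_eq_mul, abs_of_pos (by positivity)]

lemma setIntegral_ball_comp (f : E → ℝ) (x : E) {s : ℝ} (hs : 0 < s) (r : ℝ) :
    ∫ z in ball (0:E) r, f (x + s • z) =
      (s ^ Module.finrank ℝ E)⁻¹ * ∫ y in ball x (s * r), f y := by
  rw [← integral_indicator measurableSet_ball, ← integral_indicator measurableSet_ball,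
    ← integral_comp_affine _ x hs]
  congr 1
  ext z
  by_cases hz : z ∈ ball (0:E) r
  · rw [Set.indicator_of_mem hz, Set.indicator_of_mem]
    rw [mem_ball_zero_iff] at hz
    simp [norm_smul, abs_of_pos hs]
    gcongr
  · rw [Set.indicator_of_notMem hz, Set.indicator_of_notMem]
    rw [mem_ball_zero_iff, not_lt] at hz
    simp [norm_smul, abs_of_pos hs]
    gcongr

lemma jensen_sq {α : Type*} [MeasurableSpace α] {μ : Measure α} {φ g : α → ℝ} (h0 : ∀ x, 0 ≤ φ x)
    (h1 : Integrable φ μ) (h2 : Integrable (fun x => φ x * g x) μ)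
    (h3 : Integrable (fun x => φ x * g x ^ 2) μ) :
    (∫ x, φ x * g x ∂μ) ^ 2 ≤ (∫ x, φ x ∂μ) * ∫ x, φ x * g x ^ 2 ∂μ := by
  have key : ∀ t : ℝ, 0 ≤ (∫ x, φ x ∂μ) * (t * t) + (-2 * ∫ x, φ x * g x ∂μ) * t + ∫ x, φ x * g x ^ 2 ∂μ := by
    intro t
    have e : (∫ x, φ x ∂μ) * (t * t) + (-2 * ∫ x, φ x * g x ∂μ) * t + ∫ x, φ x * g x ^ 2 ∂μ
      = ∫ x, φ x * (t - g x) ^ 2 ∂μ := by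
      have e2 : (fun x => φ x * (t - g x) ^ 2) = fun x => (φ x * (t * t) + (φ x * g x) * (-2 * t)) + φ x * g x ^ 2 := by
        ext x; ring
      rw [e2]
      have a1 := h1.mul_const (t * t)
      have a2 := h2.mul_const (-2 * t)
      have := integral_add (a1.add a2) h3
      simp only [Pi.add_apply] at this
      rw [this, integral_add a1 a2, integral_mul_const, integral_mul_const]
      ring
    rw [e]
    exact integral_nonneg fun x => mul_nonneg (h0 x) (sq_nonneg _)
  have := discrim_le_zero key
  unfold discrim at this
  nlinarith

lemma lintegral_le_of_setIntegral {f : E → ℝ} {s : Set E} (hf : IntegrableOn f s) (h0 : ∀ x, 0 ≤ f x) :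
    ∫⁻ x in s, ENNReal.ofReal (f x) = ENNReal.ofReal (∫ x in s, f x) :=
  (ofReal_integral_eq_lintegral_ofReal hf (Filter.Eventually.of_forall h0)).symm

/-- `L²` bound for difference quotients. -/
lemma diff_quot {w : E → ℝ} (hw : Differentiable ℝ w) {L r : ℝ}
    (hL : ∀ x ∈ ball (0:E) 1, ‖gradient w x‖ ≤ L) (h : E) (hr : r + ‖h‖ ≤ 1) :
    ∫ x in ball (0:E) r, (w (x + h) - w x) ^ 2 ≤ ‖h‖ ^ 2 * ∫ x in ball (0:E) 1, ‖gradient w x‖ ^ 2 := by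
  have hgm := measurable_gradient w
  have hwc : Continuous w := hw.continuous
  have hIntg : IntegrableOn (fun x => ‖gradient w x‖ ^ 2) (ball (0:E) 1) :=
    integrableOn_ball_of_bdd (by fun_prop) 0 1 (M := L ^ 2) (fun x hx => by
      rw [abs_of_nonneg (by positivity)]
      gcongr; exact hL x hx)
  have hmem : ∀ x ∈ ball (0:E) r, ∀ t ∈ Set.Icc (0:ℝ) 1, x + t • h ∈ ball (0:E) 1 := by
    intro x hx t ht
    rw [mem_ball_zero_iff] at hx ⊢
    calc ‖x + t • h‖ ≤ ‖x‖ + |t| * ‖h‖ := (norm_add_le _ _).trans (by rw [norm_smul, Real.norm_eq_abs])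
      _ < r + 1 * ‖h‖ := by
        rw [abs_of_nonneg ht.1]
        have := mul_le_mul_of_nonneg_right ht.2 (norm_nonneg h)
        linarith
      _ ≤ 1 := by linarith
  have hpt : ∀ x ∈ ball (0:E) r, (w (x + h) - w x) ^ 2 ≤ ‖h‖ ^ 2 * ∫ t in Set.Icc (0:ℝ) 1, ‖gradient w (x + t • h)‖ ^ 2 := by
    intro x hx
    have hd : ∀ t : ℝ, HasDerivAt (fun t : ℝ => w (x + t • h)) ⟪gradient w (x + t • h), h⟫ t := by
      intro t
      have h1 : HasDerivAt (fun t : ℝ => x + t • h) h t := by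
        simpa using ((hasDerivAt_id t).smul_const h).const_add x
      have h2 := (hw (x + t • h)).hasFDerivAt.comp_hasDerivAt t h1
      rw [← inner_gradient_left] at h2
      exact h2
    have hbd : ∀ t ∈ Set.Icc (0:ℝ) 1, |⟪gradient w (x + t • h), h⟫| ≤ L * ‖h‖ := fun t ht =>
      (abs_real_inner_le_norm _ _).trans (by gcongr; exact hL _ (hmem x hx t ht))
    have hm : Measurable (fun t : ℝ => gradient w (x + t • h)) := hgm.comp (by fun_prop)
    have hi1 : IntegrableOn (fun t : ℝ => ⟪gradient w (x + t • h), h⟫) (Set.Icc 0 1) := by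
      refine Measure.integrableOn_of_bounded (M := L * ‖h‖) (by simp) (Measurable.aestronglyMeasurable (by fun_prop)) ?_
      exact (ae_restrict_iff' measurableSet_Icc).2 (Filter.Eventually.of_forall hbd)
    have hi2 : IntegrableOn (fun t : ℝ => ⟪gradient w (x + t • h), h⟫ ^ 2) (Set.Icc 0 1) := by
      refine Measure.integrableOn_of_bounded (M := (L * ‖h‖) ^ 2) (by simp) (Measurable.aestronglyMeasurable (by fun_prop)) ?_
      refine (ae_restrict_iff' measurableSet_Icc).2 (Filter.Eventually.of_forall fun t ht => ?_)
      rw [Real.norm_eq_abs, abs_of_nonneg (sq_nonneg _), ← sq_abs]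
      gcongr; exact hbd t ht
    have hi3 : IntegrableOn (fun t : ℝ => ‖gradient w (x + t • h)‖ ^ 2) (Set.Icc 0 1) := by
      refine Measure.integrableOn_of_bounded (M := L ^ 2) (by simp) (Measurable.aestronglyMeasurable (by fun_prop)) ?_
      refine (ae_restrict_iff' measurableSet_Icc).2 (Filter.Eventually.of_forall fun t ht => ?_)
      rw [Real.norm_eq_abs, abs_of_nonneg (sq_nonneg _)]
      gcongr; exact hL _ (hmem x hx t ht)
    have hftc : ∫ t in Set.Icc (0:ℝ) 1, ⟪gradient w (x + t • h), h⟫ = w (x + h) - w x := by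
      have := intervalIntegral.integral_eq_sub_of_hasDerivAt (a := 0) (b := 1) (fun t _ => hd t)
        ((intervalIntegrable_iff_integrableOn_Icc_of_le zero_le_one).2 hi1)
      rw [intervalIntegral.integral_of_le zero_le_one, ← integral_Icc_eq_integral_Ioc] at this
      simpa using this
    have hJ := jensen_sq (μ := volume.restrict (Set.Icc (0:ℝ) 1)) (φ := fun _ => 1)
      (g := fun t => ⟪gradient w (x + t • h), h⟫) (fun _ => zero_le_one) (by simp) (by simp only [one_mul]; exact hi1) (by simp only [one_mul]; exact hi2)
    simp only [one_mul] at hJ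
    rw [hftc] at hJ
    refine hJ.trans ?_
    have : ∫ t in Set.Icc (0:ℝ) 1, (1:ℝ) = 1 := by simp
    rw [this, one_mul, ← integral_const_mul]
    refine setIntegral_mono_on hi2 (hi3.const_mul _) measurableSet_Icc (fun t ht => ?_)
    rw [← sq_abs, ← mul_pow]
    gcongr
    rw [mul_comm]; exact abs_real_inner_le_norm _ _
  have hprod : IntegrableOn (fun q : E × ℝ => ‖gradient w (q.1 + q.2 • h)‖ ^ 2) ((ball (0:E) r) ×ˢ (Set.Icc (0:ℝ) 1)) (volume.prod volume) := by
    refine Measure.integrableOn_of_bounded (M := L ^ 2) ?_ ?_ ?_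
    · rw [Measure.prod_prod]
      exact ENNReal.mul_ne_top measure_ball_lt_top.ne (by simp)
    · have hm : Measurable (fun q : E × ℝ => gradient w (q.1 + q.2 • h)) := hgm.comp (by fun_prop)
      exact Measurable.aestronglyMeasurable (by fun_prop)
    · refine (ae_restrict_iff' (measurableSet_ball.prod measurableSet_Icc)).2 (Filter.Eventually.of_forall fun q hq => ?_)
      rw [Real.norm_eq_abs, abs_of_nonneg (sq_nonneg _)]
      gcongr; exact hL _ (hmem _ hq.1 _ hq.2)
  rw [IntegrableOn, ← Measure.prod_restrict] at hprod
  have hlhs : IntegrableOn (fun x => (w (x + h) - w x) ^ 2) (ball (0:E) r) := by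
    have : Continuous (fun x => (w (x + h) - w x) ^ 2) := by fun_prop
    exact (this.continuousOn.integrableOn_compact (isCompact_closedBall (0:E) r)).mono_set ball_subset_closedBall
  calc ∫ x in ball (0:E) r, (w (x + h) - w x) ^ 2
      ≤ ∫ x in ball (0:E) r, ‖h‖ ^ 2 * ∫ t in Set.Icc (0:ℝ) 1, ‖gradient w (x + t • h)‖ ^ 2 :=
        setIntegral_mono_on hlhs (hprod.integral_prod_left.const_mul _) measurableSet_ball hpt
    _ = ‖h‖ ^ 2 * ∫ t in Set.Icc (0:ℝ) 1, ∫ x in ball (0:E) r, ‖gradient w (x + t • h)‖ ^ 2 := by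
        rw [integral_const_mul, integral_integral_swap hprod]
    _ ≤ ‖h‖ ^ 2 * ∫ t in Set.Icc (0:ℝ) 1, ∫ x in ball (0:E) 1, ‖gradient w x‖ ^ 2 := by
        refine mul_le_mul_of_nonneg_left ?_ (sq_nonneg _)
        refine setIntegral_mono_on hprod.integral_prod_right (by simp) measurableSet_Icc (fun t ht => ?_)
        have e1 := setIntegral_ball_comp (fun y => ‖gradient w y‖ ^ 2) (t • h) one_pos r
        simp only [one_smul, one_pow, inv_one, one_mul] at e1
        simp_rw [add_comm _ (t • h)]
        rw [e1]
        refine setIntegral_mono_set hIntg (Filter.Eventually.of_forall fun x => sq_nonneg _) (Filter.Eventually.of_forall ?_)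
        intro y (hy : y ∈ ball (t • h) r)
        change y ∈ ball (0:E) 1
        have hy2 : y - t • h ∈ ball (0:E) r := by
          rw [mem_ball_zero_iff]; rwa [mem_ball, dist_eq_norm] at hy
        have := hmem _ hy2 t ht
        rwa [sub_add_cancel] at this
    _ = _ := by simp

end PartD

/-! ## Part D2: almost harmonic functions and the mean value property -/

section PartD2

set_option linter.unusedSectionVars false

variable {E : Type*} [NormedAddCommGroup E] [InnerProductSpace ℝ E] [FiniteDimensional ℝ E]
  [CompleteSpace E] [MeasurableSpace E] [BorelSpace E]

/-- Functions that are harmonic up to a quadratic error in the gradient. -/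
structure AH (K : ℝ) (w : E → ℝ) : Prop where
  diff : Differentiable ℝ w
  bdd : ∃ L, ∀ x ∈ ball (0:E) 1, ‖gradient w x‖ ≤ L
  weak : ∀ χ : E → ℝ, ContDiff ℝ 1 χ → (∀ x, 1 ≤ ‖x‖ → χ x = 0) →
    |∫ x, fderiv ℝ χ x (gradient w x)| ≤ K * ∫ x in ball (0:E) 1, ‖fderiv ℝ χ x‖ * ‖gradient w x‖ ^ 2

/-- weighted averages -/
noncomputable def MM (w : E → ℝ) (x : E) (s : ℝ) : ℝ := ∫ z, qq z ^ 3 * w (x + s • z)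
noncomputable def kk (w : E → ℝ) (x : E) (s : ℝ) : ℝ := ∫ z, qq z ^ 3 * ⟪gradient w (x + s • z), z⟫

lemma integrable_qq_mul {g : E → ℝ} (hg : Continuous g) (k : ℕ) : Integrable (fun z => qq z ^ (k + 1) * g z) := by
  have h1 := continuous_qq (E := E)
  refine Continuous.integrable_of_hasCompactSupport (by fun_prop) ?_
  exact (hasCompactSupport_qq_pow k).mul_right

lemma integrable_qq (k : ℕ) : Integrable (fun z : E => qq z ^ (k + 1)) := by
  simpa using integrable_qq_mul (E := E) (g := fun _ => 1) continuous_const k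

lemma integral_qq_pos : 0 < ∫ z : E, qq z ^ 3 := by
  have h1 := continuous_qq (E := E)
  refine Continuous.integral_pos_of_hasCompactSupport_nonneg_nonzero (x := 0) (by fun_prop) (hasCompactSupport_qq_pow 2)
    (fun x => pow_nonneg (qq_nonneg x) 3) ?_
  simp [qq]

lemma MM_zero (w : E → ℝ) (x : E) : MM w x 0 = (∫ z : E, qq z ^ 3) * w x := by
  simp [MM, integral_mul_const]

lemma mem_ball_seg {x z : E} {s : ℝ} (hs : ‖x‖ + |s| < 1) (hz : ‖z‖ ≤ 1) : x + s • z ∈ ball (0:E) 1 := by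
  rw [mem_ball_zero_iff]
  calc ‖x + s • z‖ ≤ ‖x‖ + |s| * ‖z‖ := (norm_add_le _ _).trans (by rw [norm_smul, Real.norm_eq_abs])
    _ ≤ ‖x‖ + |s| * 1 := by gcongr
    _ < 1 := by linarith

lemma hasDerivAt_MM {w : E → ℝ} (hw : Differentiable ℝ w) {L : ℝ}
    (hL : ∀ x ∈ ball (0:E) 1, ‖gradient w x‖ ≤ L) (x : E) (s : ℝ) (hs : ‖x‖ + |s| < 1) :
    HasDerivAt (MM w x) (kk w x s) s := by
  have hL0 : 0 ≤ L := (norm_nonneg _).trans (hL 0 (by simp))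
  have hgm := measurable_gradient w
  have hwc := hw.continuous
  have hqc := continuous_qq (E := E)
  have hset : {t : ℝ | ‖x‖ + |t| < 1} ∈ nhds s :=
    (isOpen_lt (by fun_prop) continuous_const).mem_nhds hs
  refine (hasDerivAt_integral_of_dominated_loc_of_deriv_le (μ := (volume : Measure E))
    (F := fun s z => qq z ^ 3 * w (x + s • z)) (F' := fun s z => qq z ^ 3 * ⟪gradient w (x + s • z), z⟫)
    (bound := fun z => qq z ^ 3 * L) hset ?_ ?_ ?_ ?_ ?_ ?_).2
  · exact Filter.Eventually.of_forall fun t => Continuous.aestronglyMeasurable (by fun_prop)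
  · exact integrable_qq_mul (by fun_prop) 2
  · have : Measurable (fun z => gradient w (x + s • z)) := hgm.comp (by fun_prop)
    have := hqc.measurable
    exact Measurable.aestronglyMeasurable (by fun_prop)
  · refine Filter.Eventually.of_forall fun z t ht => ?_
    rw [norm_mul, Real.norm_eq_abs, abs_of_nonneg (pow_nonneg (qq_nonneg z) 3)]
    rcases le_or_gt 1 ‖z‖ with hz | hz
    · rw [qq_eq_zero hz]; simp
    · gcongr
      · exact pow_nonneg (qq_nonneg z) 3
      · refine (norm_inner_le_norm _ _).trans ?_
        have := hL _ (mem_ball_seg ht hz.le)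
        nlinarith [norm_nonneg z, norm_nonneg (gradient w (x + t • z))]
  · exact (integrable_qq 2).mul_const L
  · refine Filter.Eventually.of_forall fun z t ht => ?_
    have h1 : HasDerivAt (fun t : ℝ => x + t • z) z t := by
      simpa using ((hasDerivAt_id t).smul_const z).const_add x
    have h2 := (hw (x + t • z)).hasFDerivAt.comp_hasDerivAt t h1
    rw [← inner_gradient_left] at h2
    exact h2.const_mul _

lemma kk_bound {K : ℝ} (hK : 0 ≤ K) {w : E → ℝ} (hw : AH K w) (x : E) (s : ℝ) (hs0 : 0 < s) (hs : ‖x‖ + s ≤ 1) :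
    |kk w x s| ≤ K * (s ^ Module.finrank ℝ E)⁻¹ * ∫ y in ball x s, ‖gradient w y‖ ^ 2 := by
  obtain ⟨L, hL⟩ := hw.bdd
  have hgm := measurable_gradient w
  let χ : E → ℝ := fun y => qq (s⁻¹ • (y - x)) ^ 4
  have hχ1 : ContDiff ℝ 1 χ := (contDiff_qq_pow (E := E) 2).comp (by fun_prop)
  have hfd : ∀ y v, fderiv ℝ χ y v = -8 * s⁻¹ * (qq (s⁻¹ • (y - x)) ^ 3 * ⟪v, s⁻¹ • (y - x)⟫) := by
    intro y v
    have h1 : HasFDerivAt (fun y : E => s⁻¹ • (y - x)) (s⁻¹ • ContinuousLinearMap.id ℝ E) y :=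
      ((hasFDerivAt_id y).sub_const x).const_smul s⁻¹
    have h2 := HasFDerivAt.comp (g := fun x : E => qq x ^ (2 + 2)) y (hasFDerivAt_qq_pow (E := E) 2 (s⁻¹ • (y - x))) h1
    have h3 : HasFDerivAt χ _ y := h2
    rw [h3.fderiv]
    rw [real_inner_comm]
    simp only [ContinuousLinearMap.comp_apply, smul_apply, innerSL_apply_apply, ContinuousLinearMap.id_apply, inner_smul_right, smul_eq_mul]
    push_cast
    ring
  have hbd : ∀ y, ‖fderiv ℝ χ y‖ ≤ 8 * s⁻¹ := by
    intro y
    refine ContinuousLinearMap.opNorm_le_bound _ (by positivity) (fun v => ?_)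
    rw [hfd, Real.norm_eq_abs, abs_mul, abs_mul, abs_of_pos (inv_pos.2 hs0)]
    rw [show |(-8:ℝ)| = 8 by norm_num]
    refine mul_le_mul_of_nonneg_left ?_ (by positivity)
    rcases le_or_gt 1 ‖s⁻¹ • (y - x)‖ with hz | hz
    · rw [qq_eq_zero hz]; simp
    · rw [abs_mul, abs_of_nonneg (pow_nonneg (qq_nonneg _) 3)]
      have h1 := abs_real_inner_le_norm v (s⁻¹ • (y - x))
      have h2 := pow_le_one₀ (n := 3) (qq_nonneg (s⁻¹ • (y - x))) (qq_le_one _)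
      calc _ ≤ 1 * (‖v‖ * ‖s⁻¹ • (y - x)‖) := by gcongr
        _ ≤ 1 * (‖v‖ * 1) := by gcongr
        _ = ‖v‖ := by ring
  have hout : ∀ y, y ∉ ball x s → 1 ≤ ‖s⁻¹ • (y - x)‖ := by
    intro y hy
    rw [mem_ball, dist_eq_norm, not_lt] at hy
    rw [norm_smul, Real.norm_eq_abs, abs_of_pos (inv_pos.2 hs0)]
    rw [inv_mul_eq_div, le_div_iff₀ hs0]; linarith
  have hfd0 : ∀ y, y ∉ ball x s → fderiv ℝ χ y = 0 := by
    intro y hy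
    ext v
    rw [hfd, qq_eq_zero (hout y hy)]; simp
  have hsub : ball x s ⊆ ball (0:E) 1 := by
    refine ball_subset_ball' ?_
    rw [dist_zero_right]; linarith
  have hIntg : IntegrableOn (fun x => ‖gradient w x‖ ^ 2) (ball (0:E) 1) :=
    integrableOn_ball_of_bdd (by fun_prop) 0 1 (M := L ^ 2) (fun x hx => by
      rw [abs_of_nonneg (by positivity)]
      gcongr; exact hL x hx)
  have hχ0 : ∀ y, 1 ≤ ‖y‖ → χ y = 0 := by
    intro y hy
    have : y ∉ ball x s := fun h => by
      have := hsub h; rw [mem_ball_zero_iff] at this; linarith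
    simp only [χ]
    rw [qq_eq_zero (hout y this)]; simp
  have hweak := hw.weak χ hχ1 hχ0
  have hR : ∫ y in ball (0:E) 1, ‖fderiv ℝ χ y‖ * ‖gradient w y‖ ^ 2 ≤ 8 * s⁻¹ * ∫ y in ball x s, ‖gradient w y‖ ^ 2 := by
    have e1 : ∫ y in ball (0:E) 1, ‖fderiv ℝ χ y‖ * ‖gradient w y‖ ^ 2 = ∫ y in ball x s, ‖fderiv ℝ χ y‖ * ‖gradient w y‖ ^ 2 := by
      refine setIntegral_eq_of_subset_of_forall_sdiff_eq_zero measurableSet_ball hsub ?_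
      intro y hy
      rw [hfd0 y hy.2]; simp
    rw [e1, ← integral_const_mul]
    refine setIntegral_mono_on ?_ ((hIntg.mono_set hsub).const_mul _) measurableSet_ball (fun y hy => ?_)
    · have hfm : Measurable (fun y => fderiv ℝ χ y) := measurable_fderiv ℝ χ
      refine integrableOn_ball_of_bdd (by fun_prop) x s (M := 8 * s⁻¹ * L ^ 2) (fun y hy => ?_)
      rw [abs_of_nonneg (by positivity)]
      gcongr
      · exact hbd y
      · exact hL y (hsub hy)
    · gcongr; exact hbd y
  have hLq : ∫ y, fderiv ℝ χ y (gradient w y) = -8 * s⁻¹ * (s ^ Module.finrank ℝ E * kk w x s) := by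
    simp_rw [hfd]
    rw [integral_const_mul]
    congr 1
    have := integral_comp_affine (fun y => qq (s⁻¹ • (y - x)) ^ 3 * ⟪gradient w y, s⁻¹ • (y - x)⟫) x hs0
    have e2 : ∀ z : E, s⁻¹ • (x + s • z - x) = z := fun z => by simp [smul_smul, hs0.ne']
    simp_rw [e2] at this
    unfold kk
    rw [this]
    field_simp
  rw [hLq] at hweak
  rw [abs_mul, abs_mul, abs_mul, abs_of_pos (inv_pos.2 hs0), abs_of_pos (pow_pos hs0 _)] at hweak
  have h8 : |(-8:ℝ)| = 8 := by norm_num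
  rw [h8] at hweak
  have h9 : 8 * s⁻¹ * (s ^ Module.finrank ℝ E * |kk w x s|) ≤ 8 * s⁻¹ * (K * ∫ y in ball x s, ‖gradient w y‖ ^ 2) := by
    refine hweak.trans ((mul_le_mul_of_nonneg_left hR hK).trans (le_of_eq (by ring)))
  have h10 := le_of_mul_le_mul_left h9 (by positivity)
  rw [mul_comm K, mul_assoc, inv_mul_eq_div, le_div_iff₀ (by positivity), mul_comm]
  exact h10

end PartD2

/-! ## Part D3: one step of improvement for almost harmonic functions -/

section PartD3

set_option linter.unusedSectionVars false

variable {E : Type*} [NormedAddCommGroup E] [InnerProductSpace ℝ E] [FiniteDimensional ℝ E]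
  [CompleteSpace E] [MeasurableSpace E] [BorelSpace E]

lemma avg_small {w : E → ℝ} (hw : Differentiable ℝ w) {L r δ : ℝ}
    (hL : ∀ x ∈ ball (0:E) 1, ‖gradient w x‖ ≤ L) (hδ : 0 ≤ δ) (hr : r + δ ≤ 1) :
    ∫ x in ball (0:E) r, ((∫ z : E, qq z ^ 3) * w x - MM w x δ) ^ 2 ≤
      (∫ z : E, qq z ^ 3) ^ 2 * δ ^ 2 * ∫ x in ball (0:E) 1, ‖gradient w x‖ ^ 2 := by
  have hwc := hw.continuous
  have hqc := continuous_qq (E := E)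
  set J := ∫ z : E, qq z ^ 3 with hJ
  have hJ0 : 0 < J := integral_qq_pos
  set D := ∫ x in ball (0:E) 1, ‖gradient w x‖ ^ 2 with hD
  have hD0 : 0 ≤ D := integral_nonneg fun x => sq_nonneg _
  have hpt : ∀ x, (J * w x - MM w x δ) ^ 2 ≤ J * ∫ z, qq z ^ 3 * (w (x + δ • z) - w x) ^ 2 := by
    intro x
    have e1 : J * w x - MM w x δ = - ∫ z, qq z ^ 3 * (w (x + δ • z) - w x) := by
      have a1 := integrable_qq_mul (E := E) (g := fun z => w (x + δ • z)) (by fun_prop) 2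
      have a2 := integrable_qq_mul (E := E) (g := fun z => w x) (by fun_prop) 2
      simp_rw [mul_sub]
      rw [integral_sub a1 a2, integral_mul_const]
      unfold MM
      ring
    rw [e1, neg_sq]
    exact jensen_sq (fun z => pow_nonneg (qq_nonneg z) 3) (integrable_qq 2)
      (integrable_qq_mul (by fun_prop) 2) (integrable_qq_mul (by fun_prop) 2)
  have hcont : Continuous (fun q : E × E => qq q.2 ^ 3 * (w (q.1 + δ • q.2) - w q.1) ^ 2) := by fun_prop
  have hprod : Integrable (fun q : E × E => qq q.2 ^ 3 * (w (q.1 + δ • q.2) - w q.1) ^ 2)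
      ((volume.restrict (ball (0:E) r)).prod volume) := by
    have h1 : IntegrableOn (fun q : E × E => qq q.2 ^ 3 * (w (q.1 + δ • q.2) - w q.1) ^ 2)
        ((ball (0:E) r) ×ˢ Set.univ) (volume.prod volume) := by
      have h2 := hcont.continuousOn.integrableOn_compact (μ := (volume : Measure E).prod volume)
        ((isCompact_closedBall (0:E) r).prod (isCompact_closedBall (0:E) 1))
      have h3 := h2.mono_set (Set.prod_mono (ball_subset_closedBall (x := (0:E)) (ε := r)) (le_refl (closedBall (0:E) 1)))
      refine h3.of_forall_sdiff_eq_zero (measurableSet_ball.prod MeasurableSet.univ) ?_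
      rintro ⟨a, b⟩ hab
      have : 1 ≤ ‖b‖ := by
        by_contra hb
        push Not at hb
        exact hab.2 ⟨hab.1.1, by simpa using hb.le⟩
      simp [qq_eq_zero this]
    rw [IntegrableOn, ← Measure.prod_restrict, Measure.restrict_univ] at h1
    exact h1
  have hMc : Continuous (fun x => MM w x δ) := by
    unfold MM
    have := continuous_parametric_integral_of_continuous (μ := (volume : Measure E)) (s := closedBall (0:E) 1)
      (f := fun x z => qq z ^ 3 * w (x + δ • z)) (by fun_prop) (isCompact_closedBall _ _)
    refine this.congr fun x => ?_
    refine setIntegral_eq_integral_of_forall_compl_eq_zero (fun z hz => ?_)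
    rw [qq_eq_zero (by simpa using (not_le.1 (fun h => hz (mem_closedBall_zero_iff.2 h))).le)]
    simp
  have hlhs : IntegrableOn (fun x => (J * w x - MM w x δ) ^ 2) (ball (0:E) r) := by
    have : Continuous (fun x => (J * w x - MM w x δ) ^ 2) := by fun_prop
    exact (this.continuousOn.integrableOn_compact (isCompact_closedBall (0:E) r)).mono_set ball_subset_closedBall
  calc ∫ x in ball (0:E) r, (J * w x - MM w x δ) ^ 2
      ≤ ∫ x in ball (0:E) r, J * ∫ z, qq z ^ 3 * (w (x + δ • z) - w x) ^ 2 :=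
        setIntegral_mono hlhs (hprod.integral_prod_left.const_mul _) hpt
    _ = J * ∫ z, ∫ x in ball (0:E) r, qq z ^ 3 * (w (x + δ • z) - w x) ^ 2 := by
        rw [integral_const_mul, integral_integral_swap hprod]
    _ ≤ J * ∫ z : E, qq z ^ 3 * (δ ^ 2 * D) := by
        refine mul_le_mul_of_nonneg_left ?_ hJ0.le
        refine integral_mono hprod.integral_prod_right ((integrable_qq 2).mul_const _) (fun z => ?_)
        change ∫ x in ball (0:E) r, qq z ^ 3 * (w (x + δ • z) - w x) ^ 2 ≤ qq z ^ 3 * (δ ^ 2 * D)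
        rw [integral_const_mul]
        rcases le_or_gt 1 ‖z‖ with hz | hz
        · rw [qq_eq_zero hz]; simp
        · refine mul_le_mul_of_nonneg_left ?_ (pow_nonneg (qq_nonneg z) 3)
          have h1 : ‖δ • z‖ ≤ δ := by
            rw [norm_smul, Real.norm_eq_abs, abs_of_nonneg hδ]; nlinarith
          refine (diff_quot hw hL (δ • z) (by linarith)).trans ?_
          gcongr
    _ = _ := by rw [integral_mul_const]; ring

lemma MM_diff {K : ℝ} (hK : 0 ≤ K) {w : E → ℝ} (hw : AH K w) {x : E} {δ : ℝ} (hx : ‖x‖ ≤ 1/4)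
    (hδ : 0 < δ) (hδ2 : δ ≤ 1/4) :
    |MM w x (1/2) - MM w x δ| ≤ K * (δ ^ Module.finrank ℝ E)⁻¹ * ∫ y in ball (0:E) 1, ‖gradient w y‖ ^ 2 := by
  obtain ⟨L, hL⟩ := hw.bdd
  have hgm := measurable_gradient w
  have hIntg : IntegrableOn (fun x => ‖gradient w x‖ ^ 2) (ball (0:E) 1) :=
    integrableOn_ball_of_bdd (by fun_prop) 0 1 (M := L ^ 2) (fun x hx => by
      rw [abs_of_nonneg (by positivity)]
      gcongr; exact hL x hx)
  set D := ∫ x in ball (0:E) 1, ‖gradient w x‖ ^ 2 with hD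
  have hD0 : 0 ≤ D := integral_nonneg fun x => sq_nonneg _
  have h := Convex.norm_image_sub_le_of_norm_hasDerivWithin_le (𝕜 := ℝ) (f := MM w x) (f' := kk w x)
    (s := Set.Icc δ (1/2)) (x := δ) (y := 1/2) (C := K * (δ ^ Module.finrank ℝ E)⁻¹ * D)
    (fun s hs => (hasDerivAt_MM hw.diff hL x s (by rw [abs_of_pos (hδ.trans_le hs.1)]; linarith [hs.2])).hasDerivWithinAt)
    (fun s hs => by
      have hs0 := hδ.trans_le hs.1
      have h1 := kk_bound hK hw x s hs0 (by linarith [hs.2])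
      refine h1.trans ?_
      have h2 : ∫ y in ball x s, ‖gradient w y‖ ^ 2 ≤ D := by
        refine setIntegral_mono_set hIntg (Filter.Eventually.of_forall fun x => sq_nonneg _) (Filter.Eventually.of_forall ?_)
        refine ball_subset_ball' ?_
        rw [dist_zero_right]; linarith [hs.2]
      have h3 : (s ^ Module.finrank ℝ E)⁻¹ ≤ (δ ^ Module.finrank ℝ E)⁻¹ := by
        gcongr; exact hs.1
      gcongr)
    (convex_Icc _ _) ⟨le_refl _, by linarith⟩ ⟨by linarith, le_refl _⟩
  rw [Real.norm_eq_abs, Real.norm_eq_abs] at h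
  refine h.trans ?_
  have h4 : |1/2 - δ| ≤ 1 := by rw [abs_le]; constructor <;> linarith
  exact mul_le_of_le_one_right (by positivity) h4

lemma cube_taylor (a b B : ℝ) (ha : |a| ≤ B) (hb : |b| ≤ B) :
    |(max 0 b) ^ 3 - (max 0 a) ^ 3 - 3 * (max 0 a) ^ 2 * (b - a)| ≤ 5 * B * (b - a) ^ 2 := by
  rw [abs_le] at ha hb
  rcases le_total 0 a with h1 | h1 <;> rcases le_total 0 b with h2 | h2
  · rw [max_eq_right h1, max_eq_right h2]
    have : b ^ 3 - a ^ 3 - 3 * a ^ 2 * (b - a) = (b + 2 * a) * (b - a) ^ 2 := by ring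
    rw [this, abs_mul, abs_of_nonneg (sq_nonneg (b-a)), abs_of_nonneg (by linarith)]
    gcongr; linarith
  · rw [max_eq_right h1, max_eq_left h2]
    have : (0:ℝ) ^ 3 - a ^ 3 - 3 * a ^ 2 * (b - a) = (2 * a - 3 * b) * a ^ 2 := by ring
    rw [this, abs_of_nonneg (mul_nonneg (by linarith) (sq_nonneg _))]
    have h3 : a ^ 2 ≤ (b - a) ^ 2 := by nlinarith
    have h4 : 2 * a - 3 * b ≤ 5 * B := by linarith
    have h5 : 0 ≤ 5 * B := by linarith
    gcongr
  · rw [max_eq_left h1, max_eq_right h2]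
    have : b ^ 3 - 0 ^ 3 - 3 * 0 ^ 2 * (b - a) = b * b ^ 2 := by ring
    rw [this, abs_of_nonneg (by positivity)]
    have h3 : b ^ 2 ≤ (b - a) ^ 2 := by nlinarith
    have h4 : b ≤ 5 * B := by linarith
    have h5 : 0 ≤ 5 * B := by linarith
    gcongr
  · rw [max_eq_left h1, max_eq_left h2]
    simp
    have : 0 ≤ B := by linarith
    positivity

lemma qq_taylor (z ζ : E) (hζ : ‖ζ‖ ≤ 1/2) :
    |qq (z - ζ) ^ 3 - qq z ^ 3 - 6 * qq z ^ 2 * ⟪z, ζ⟫| ≤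
      (ball (0:E) (3/2)).indicator (fun _ => 200 * ‖ζ‖ ^ 2) z := by
  by_cases hz : z ∈ ball (0:E) (3/2)
  · rw [Set.indicator_of_mem hz]
    rw [mem_ball_zero_iff] at hz
    have e1 : ‖z - ζ‖ ^ 2 = ‖z‖ ^ 2 - 2 * ⟪z, ζ⟫ + ‖ζ‖ ^ 2 := norm_sub_sq_real z ζ
    have hzn := norm_nonneg z
    have hζn := norm_nonneg ζ
    have h0 : ‖z - ζ‖ ≤ 2 := (norm_sub_le _ _).trans (by linarith)
    have h1 : |1 - ‖z‖ ^ 2| ≤ 3 := by rw [abs_le]; constructor <;> nlinarith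
    have h2 : |1 - ‖z - ζ‖ ^ 2| ≤ 3 := by
      rw [abs_le]; constructor <;> nlinarith [norm_nonneg (z - ζ)]
    have h3 := cube_taylor (1 - ‖z‖ ^ 2) (1 - ‖z - ζ‖ ^ 2) 3 h1 h2
    have h4 := abs_real_inner_le_norm z ζ
    have h5 : |⟪z, ζ⟫| ≤ 3/2 * ‖ζ‖ := h4.trans (by gcongr)
    have e2 : (1 - ‖z - ζ‖ ^ 2) - (1 - ‖z‖ ^ 2) = 2 * ⟪z, ζ⟫ - ‖ζ‖ ^ 2 := by rw [e1]; ring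
    rw [e2] at h3
    have h6 : |2 * ⟪z, ζ⟫ - ‖ζ‖ ^ 2| ≤ 7/2 * ‖ζ‖ := by
      rw [abs_le] at h5 ⊢
      constructor <;> nlinarith
    have h7 : (2 * ⟪z, ζ⟫ - ‖ζ‖ ^ 2) ^ 2 ≤ (7/2 * ‖ζ‖) ^ 2 := by
      rw [← sq_abs]; gcongr
    have hq := qq_nonneg z
    have hq1 := qq_le_one z
    have h8 : 3 * qq z ^ 2 * ‖ζ‖ ^ 2 ≤ 3 * ‖ζ‖ ^ 2 := by
      have : qq z ^ 2 ≤ 1 := pow_le_one₀ hq hq1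
      nlinarith [sq_nonneg ‖ζ‖]
    have h9 : 0 ≤ 3 * qq z ^ 2 * ‖ζ‖ ^ 2 := by positivity
    change |qq (z - ζ) ^ 3 - qq z ^ 3 - 3 * qq z ^ 2 * (2 * ⟪z, ζ⟫ - ‖ζ‖ ^ 2)| ≤ _ at h3
    rw [abs_le] at h3 ⊢
    constructor <;> nlinarith
  · rw [Set.indicator_of_notMem hz]
    rw [mem_ball_zero_iff, not_lt] at hz
    have h1 : 1 ≤ ‖z - ζ‖ := by have := norm_sub_norm_le z ζ; linarith
    rw [qq_eq_zero h1, qq_eq_zero (by linarith : 1 ≤ ‖z‖)]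
    simp

lemma MM_taylor {w : E → ℝ} (hwc : Continuous w) : ∃ (c : ℝ) (a : E),
    |c| ≤ ∫ z in ball (0:E) (3/2), |w ((1/2:ℝ) • z)| ∧ ‖a‖ ≤ 12 * ∫ z in ball (0:E) (3/2), |w ((1/2:ℝ) • z)| ∧
    ∀ x, ‖x‖ ≤ 1/4 → |MM w x (1/2) - c - ⟪a, x⟫| ≤ 800 * ‖x‖ ^ 2 * ∫ z in ball (0:E) (3/2), |w ((1/2:ℝ) • z)| := by
  have hqc := continuous_qq (E := E)
  set W := ∫ z in ball (0:E) (3/2), |w ((1/2:ℝ) • z)| with hW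
  have hIntg : IntegrableOn (fun z => |w ((1/2:ℝ) • z)|) (ball (0:E) (3/2)) := by
    have : Continuous (fun z : E => |w ((1/2:ℝ) • z)|) := by fun_prop
    exact (this.continuousOn.integrableOn_compact (isCompact_closedBall (0:E) _)).mono_set ball_subset_closedBall
  have hgen : ∀ (k : E → ℝ) (A : ℝ), 0 ≤ A → (∀ z, |k z| ≤ (ball (0:E) (3/2)).indicator (fun _ => A) z) →
      |∫ z, k z * w ((1/2:ℝ) • z)| ≤ A * W := by
    intro k A hA hk
    rw [hW, ← integral_const_mul, ← integral_indicator measurableSet_ball, ← Real.norm_eq_abs]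
    refine norm_integral_le_of_norm_le ((integrable_indicator_iff measurableSet_ball).2 (hIntg.const_mul A))
      (Filter.Eventually.of_forall fun z => ?_)
    have := hk z
    rw [norm_mul, Real.norm_eq_abs, Real.norm_eq_abs]
    by_cases hz : z ∈ ball (0:E) (3/2)
    · rw [Set.indicator_of_mem hz] at this ⊢
      gcongr
    · rw [Set.indicator_of_notMem hz] at this ⊢
      have : |k z| = 0 := le_antisymm this (abs_nonneg _)
      rw [this, zero_mul]
  have hout : ∀ z : E, z ∉ ball (0:E) (3/2) → qq z = 0 := by
    intro z hz
    rw [mem_ball_zero_iff, not_lt] at hz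
    exact qq_eq_zero (by linarith)
  have hain : Integrable (fun z : E => (12 * (qq z ^ 2 * w ((1/2:ℝ) • z))) • z) := by
    refine Continuous.integrable_of_hasCompactSupport (by fun_prop) ?_
    exact ((hasCompactSupport_qq_pow 1).mul_right.mul_left).smul_right
  refine ⟨∫ z, qq z ^ 3 * w ((1/2:ℝ) • z), ∫ z, (12 * (qq z ^ 2 * w ((1/2:ℝ) • z))) • z, ?_, ?_, ?_⟩
  · have := hgen (fun z => qq z ^ 3) 1 zero_le_one (fun z => by
      by_cases hz : z ∈ ball (0:E) (3/2)
      · rw [Set.indicator_of_mem hz, abs_of_nonneg (pow_nonneg (qq_nonneg z) 3)]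
        exact pow_le_one₀ (qq_nonneg z) (qq_le_one z)
      · rw [Set.indicator_of_notMem hz, hout z hz]; simp)
    simpa using this
  · rw [hW, ← integral_const_mul, ← integral_indicator measurableSet_ball]
    refine norm_integral_le_of_norm_le ((integrable_indicator_iff measurableSet_ball).2 (hIntg.const_mul 12))
      (Filter.Eventually.of_forall fun z => ?_)
    by_cases hz : z ∈ ball (0:E) (3/2)
    · rw [Set.indicator_of_mem hz, norm_smul, Real.norm_eq_abs, abs_mul, abs_mul,
        abs_of_nonneg (pow_nonneg (qq_nonneg z) 2)]
      have h1 : qq z ^ 2 * ‖z‖ ≤ 1 := by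
        rcases le_or_gt 1 ‖z‖ with h | h
        · rw [qq_eq_zero h]; simp
        · have := pow_le_one₀ (n := 2) (qq_nonneg z) (qq_le_one z)
          nlinarith [norm_nonneg z, pow_nonneg (qq_nonneg z) 2]
      have h2 := abs_nonneg (w ((1/2:ℝ) • z))
      have h12 : |(12:ℝ)| = 12 := by norm_num
      rw [h12]
      nlinarith
    · rw [Set.indicator_of_notMem hz, hout z hz]; simp
  · intro x hx
    have e1 : MM w x (1/2) = ∫ z, qq (z - (2:ℝ) • x) ^ 3 * w ((1/2:ℝ) • z) := by
      unfold MM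
      rw [← integral_sub_right_eq_self (μ := (volume : Measure E)) _ ((2:ℝ) • x)]
      congr 1
      ext z
      congr 2
      rw [smul_sub, smul_smul]; norm_num
    have e2 : ⟪∫ z, (12 * (qq z ^ 2 * w ((1/2:ℝ) • z))) • z, x⟫ = ∫ z, 6 * qq z ^ 2 * ⟪z, (2:ℝ) • x⟫ * w ((1/2:ℝ) • z) := by
      rw [real_inner_comm, ← integral_inner hain]
      congr 1
      ext z
      rw [inner_smul_right, inner_smul_right, real_inner_comm]
      ring
    have i0 : Integrable (fun z => qq (z - (2:ℝ) • x) ^ 3 * w ((1/2:ℝ) • z)) := by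
      refine Continuous.integrable_of_hasCompactSupport (by fun_prop) ?_
      refine HasCompactSupport.mul_right ?_
      exact (hasCompactSupport_qq_pow (E := E) 2).comp_homeomorph (Homeomorph.subRight ((2:ℝ) • x))
    have i1 := integrable_qq_mul (E := E) (g := fun z => w ((1/2:ℝ) • z)) (by fun_prop) 2
    have i2 : Integrable (fun z => 6 * qq z ^ 2 * ⟪z, (2:ℝ) • x⟫ * w ((1/2:ℝ) • z)) := by
      have := (integrable_qq_mul (E := E) (g := fun z => ⟪z, (2:ℝ) • x⟫ * w ((1/2:ℝ) • z)) (by fun_prop) 1).const_mul 6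
      refine this.congr (Filter.Eventually.of_forall fun z => ?_)
      simp only []
      ring
    have i3 := integral_sub (i0.sub i1) i2
    simp only [Pi.sub_apply] at i3
    rw [e1, e2, ← integral_sub i0 i1, ← i3]
    have h2x : ‖(2:ℝ) • x‖ = 2 * ‖x‖ := by rw [norm_smul]; norm_num
    have := hgen (fun z => qq (z - (2:ℝ) • x) ^ 3 - qq z ^ 3 - 6 * qq z ^ 2 * ⟪z, (2:ℝ) • x⟫) (200 * ‖(2:ℝ) • x‖ ^ 2)
      (by positivity) (fun z => qq_taylor z ((2:ℝ) • x) (by rw [h2x]; linarith))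
    rw [h2x] at this
    refine le_trans (le_of_eq ?_) (this.trans (le_of_eq (by ring)))
    congr 2
    ext z
    ring

lemma three_sq (p q s : ℝ) : (p + -q + s) ^ 2 ≤ 3 * (p ^ 2 + q ^ 2 + s ^ 2) := by
  nlinarith [sq_nonneg (p + q), sq_nonneg (p - s), sq_nonneg (q + s)]

set_option maxHeartbeats 1000000 in
lemma AH_step (K : ℝ) (hK : 0 ≤ K) : ∃ C > 0, ∀ (w : E → ℝ), AH K w → ∀ D I0 : ℝ,
    ∫ x in ball (0:E) 1, ‖gradient w x‖ ^ 2 ≤ D → ∫ x in ball (0:E) 1, w x ^ 2 ≤ I0 →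
    ∃ (c : ℝ) (a : E), c ^ 2 ≤ C * I0 ∧ ‖a‖ ^ 2 ≤ C * I0 ∧ ∀ r δ : ℝ, 0 < r → r ≤ 1/4 → 0 < δ → δ ≤ 1/4 →
      ∫ x in ball (0:E) r, (w x - c - ⟪a, x⟫) ^ 2 ≤
        C * (r ^ (Module.finrank ℝ E + 4) * I0 + δ ^ 2 * D + ((δ ^ Module.finrank ℝ E)⁻¹ * D) ^ 2) := by
  set n := Module.finrank ℝ E with hn
  set J := ∫ z : E, qq z ^ 3 with hJ
  have hJ0 : 0 < J := integral_qq_pos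
  set V := (volume (ball (0:E) 1)).toReal with hV
  have hV0 : 0 ≤ V := ENNReal.toReal_nonneg
  -- C1 bounds W^2
  obtain ⟨C1, hC1, hWI⟩ : ∃ C1 > 0, ∀ w : E → ℝ, Continuous w →
      (∫ z in ball (0:E) (3/2), |w ((1/2:ℝ) • z)|) ^ 2 ≤ C1 * ∫ x in ball (0:E) 1, w x ^ 2 := by
    refine ⟨((1/2 : ℝ) ^ n)⁻¹ ^ 2 * V + 1, by positivity, fun w hw => ?_⟩
    have h1 := setIntegral_ball_comp (fun y => |w y|) (0:E) (s := 1/2) (by norm_num) (3/2)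
    simp only [zero_add] at h1
    rw [h1, mul_pow, ← hn]
    have iw : IntegrableOn (fun y => |w y|) (ball (0:E) 1) := by
      have : Continuous (fun z : E => |w z|) := by fun_prop
      exact (this.continuousOn.integrableOn_compact (isCompact_closedBall (0:E) _)).mono_set ball_subset_closedBall
    have iw2 : IntegrableOn (fun y => |w y| ^ 2) (ball (0:E) 1) := by
      have : Continuous (fun z : E => |w z| ^ 2) := by fun_prop
      exact (this.continuousOn.integrableOn_compact (isCompact_closedBall (0:E) _)).mono_set ball_subset_closedBall
    have h2 : ∫ y in ball (0:E) (1/2 * (3/2)), |w y| ≤ ∫ y in ball (0:E) 1, |w y| :=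
      setIntegral_mono_set iw (Filter.Eventually.of_forall fun x => abs_nonneg _)
        (Filter.Eventually.of_forall (ball_subset_ball (by norm_num)))
    have h20 : 0 ≤ ∫ y in ball (0:E) (1/2 * (3/2)), |w y| := integral_nonneg fun x => abs_nonneg _
    have h3 := jensen_sq (μ := volume.restrict (ball (0:E) 1)) (φ := fun _ => 1) (g := fun x => |w x|)
      (fun _ => zero_le_one) (integrableOn_const measure_ball_lt_top.ne) (by simp only [one_mul]; exact iw) (by simp only [one_mul]; exact iw2)
    simp only [one_mul, sq_abs] at h3
    have h4 : ∫ x in ball (0:E) 1, (1:ℝ) = V := by simp [hV, Measure.real]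
    rw [h4] at h3
    have h5 : (∫ y in ball (0:E) (1/2 * (3/2)), |w y|) ^ 2 ≤ V * ∫ x in ball (0:E) 1, w x ^ 2 := (by gcongr : _ ≤ _).trans h3
    have h6 : 0 ≤ ∫ x in ball (0:E) 1, w x ^ 2 := integral_nonneg fun x => sq_nonneg _
    calc _ ≤ ((1/2 : ℝ) ^ n)⁻¹ ^ 2 * (V * ∫ x in ball (0:E) 1, w x ^ 2) := by gcongr
      _ ≤ _ := by nlinarith
  let C := C1 * (144 / J ^ 2) + 3 + 3 * K ^ 2 * V / J ^ 2 + 3 * 800 ^ 2 * C1 * V / J ^ 2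
  have hCa : C1 * (144 / J ^ 2) ≤ C := by
    have : 0 ≤ 3 + 3 * K ^ 2 * V / J ^ 2 + 3 * 800 ^ 2 * C1 * V / J ^ 2 := by positivity
    simp only [C]; linarith
  have hCb : 3 ≤ C := by
    have : 0 ≤ C1 * (144 / J ^ 2) + 3 * K ^ 2 * V / J ^ 2 + 3 * 800 ^ 2 * C1 * V / J ^ 2 := by positivity
    simp only [C]; linarith
  have hCc : 3 * K ^ 2 * V / J ^ 2 ≤ C := by
    have : 0 ≤ C1 * (144 / J ^ 2) + 3 + 3 * 800 ^ 2 * C1 * V / J ^ 2 := by positivity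
    simp only [C]; linarith
  have hCd : 3 * 800 ^ 2 * C1 * V / J ^ 2 ≤ C := by
    have : 0 ≤ C1 * (144 / J ^ 2) + 3 + 3 * K ^ 2 * V / J ^ 2 := by positivity
    simp only [C]; linarith
  have hC0 : 0 < C := by linarith
  refine ⟨C, hC0, ?_⟩
  intro w hw D I0 hD hI
  obtain ⟨L, hL⟩ := hw.bdd
  have hwc := hw.diff.continuous
  obtain ⟨c, a, hc, ha, hT⟩ := MM_taylor hwc
  have hW2 := hWI w hwc
  set W := ∫ z in ball (0:E) (3/2), |w ((1/2:ℝ) • z)| with hW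
  have hW0 : 0 ≤ W := integral_nonneg fun z => abs_nonneg _
  have hI0 : 0 ≤ I0 := le_trans (integral_nonneg fun x => sq_nonneg _) hI
  have hD0 : 0 ≤ D := le_trans (integral_nonneg fun x => sq_nonneg _) hD
  have hW3 : W ^ 2 ≤ C1 * I0 := hW2.trans (by gcongr)
  refine ⟨J⁻¹ * c, J⁻¹ • a, ?_, ?_, ?_⟩
  · have h1 : c ^ 2 ≤ W ^ 2 := by rw [← sq_abs]; gcongr
    calc (J⁻¹ * c) ^ 2 = (1 / J ^ 2) * c ^ 2 := by field_simp
      _ ≤ (144 / J ^ 2) * (C1 * I0) := by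
          have : 1 / J ^ 2 ≤ 144 / J ^ 2 := by gcongr; norm_num
          have h2 := h1.trans hW3
          gcongr
      _ = C1 * (144 / J ^ 2) * I0 := by ring
      _ ≤ C * I0 := by gcongr
  · have h1 : ‖a‖ ^ 2 ≤ (12 * W) ^ 2 := by gcongr
    calc ‖J⁻¹ • a‖ ^ 2 = (1 / J ^ 2) * ‖a‖ ^ 2 := by
          rw [norm_smul, Real.norm_eq_abs, abs_of_pos (inv_pos.2 hJ0)]; field_simp
      _ ≤ (1 / J ^ 2) * (12 * W) ^ 2 := by gcongr
      _ = (144 / J ^ 2) * W ^ 2 := by ring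
      _ ≤ (144 / J ^ 2) * (C1 * I0) := by gcongr
      _ = C1 * (144 / J ^ 2) * I0 := by ring
      _ ≤ C * I0 := by gcongr
  intro r δ hr0 hr hδ0 hδ
  set A := (δ ^ n)⁻¹ * D with hA
  have hA0 : 0 ≤ A := by positivity
  set Br := (volume (ball (0:E) r)).toReal with hBr
  have hBrV : Br = r ^ n * V := by
    rw [hBr, hV, Measure.addHaar_ball_of_pos (volume : Measure E) 0 hr0, ENNReal.toReal_mul, ENNReal.toReal_ofReal (by positivity)]
  have hpt : ∀ x ∈ ball (0:E) r, (w x - J⁻¹ * c - ⟪J⁻¹ • a, x⟫) ^ 2 ≤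
      3 / J ^ 2 * (J * w x - MM w x δ) ^ 2 + (3 * K ^ 2 / J ^ 2 * A ^ 2 + 3 * 800 ^ 2 * C1 / J ^ 2 * (r ^ 4 * I0)) := by
    intro x hx
    rw [mem_ball_zero_iff] at hx
    have h1 := MM_diff hK hw (x := x) (by linarith) hδ0 hδ
    have h1' : |MM w x (1/2) - MM w x δ| ≤ K * A := by
      refine h1.trans ?_
      rw [hA, ← mul_assoc]
      gcongr
    have h2 := hT x (by linarith)
    have h2' : |MM w x (1/2) - c - ⟪a, x⟫| ≤ 800 * r ^ 2 * W := h2.trans (by gcongr)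
    have e1 : w x - J⁻¹ * c - ⟪J⁻¹ • a, x⟫ = J⁻¹ * ((J * w x - MM w x δ) + -(MM w x (1/2) - MM w x δ) + (MM w x (1/2) - c - ⟪a, x⟫)) := by
      rw [inner_smul_left]; simp only [conj_trivial]; field_simp; ring
    have h3 : (MM w x (1/2) - MM w x δ) ^ 2 ≤ (K * A) ^ 2 := by rw [← sq_abs]; gcongr
    have h4 : (MM w x (1/2) - c - ⟪a, x⟫) ^ 2 ≤ (800 * r ^ 2 * W) ^ 2 := by rw [← sq_abs]; gcongr
    have h6 : (800 * r ^ 2 * W) ^ 2 ≤ 800 ^ 2 * r ^ 4 * (C1 * I0) := by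
      have : (800 * r ^ 2 * W) ^ 2 = 800 ^ 2 * r ^ 4 * W ^ 2 := by ring
      rw [this]; gcongr
    rw [e1, mul_pow]
    calc _ ≤ J⁻¹ ^ 2 * (3 * ((J * w x - MM w x δ) ^ 2 + (K * A) ^ 2 + 800 ^ 2 * r ^ 4 * (C1 * I0))) := by
          refine mul_le_mul_of_nonneg_left ((three_sq _ _ _).trans ?_) (by positivity)
          linarith
      _ = _ := by field_simp; ring
  have hMc : Continuous (fun x => MM w x δ) := by
    have hqc := continuous_qq (E := E)
    unfold MM
    have := continuous_parametric_integral_of_continuous (μ := (volume : Measure E)) (s := closedBall (0:E) 1)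
      (f := fun x z => qq z ^ 3 * w (x + δ • z)) (by fun_prop) (isCompact_closedBall _ _)
    refine this.congr fun x => ?_
    refine setIntegral_eq_integral_of_forall_compl_eq_zero (fun z hz => ?_)
    rw [qq_eq_zero (by simpa using (not_le.1 (fun h => hz (mem_closedBall_zero_iff.2 h))).le)]
    simp
  have hion : ∀ g : E → ℝ, Continuous g → IntegrableOn g (ball (0:E) r) := fun g hg =>
    (hg.continuousOn.integrableOn_compact (isCompact_closedBall (0:E) _)).mono_set ball_subset_closedBall
  have hsm := avg_small hw.diff (r := r) hL hδ0.le (by linarith)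
  calc ∫ x in ball (0:E) r, (w x - J⁻¹ * c - ⟪J⁻¹ • a, x⟫) ^ 2
      ≤ ∫ x in ball (0:E) r, (3 / J ^ 2 * (J * w x - MM w x δ) ^ 2 + (3 * K ^ 2 / J ^ 2 * A ^ 2 + 3 * 800 ^ 2 * C1 / J ^ 2 * (r ^ 4 * I0))) :=
        setIntegral_mono_on (hion _ (by fun_prop)) (hion _ (by fun_prop)) measurableSet_ball hpt
    _ = 3 / J ^ 2 * (∫ x in ball (0:E) r, (J * w x - MM w x δ) ^ 2) + Br * (3 * K ^ 2 / J ^ 2 * A ^ 2 + 3 * 800 ^ 2 * C1 / J ^ 2 * (r ^ 4 * I0)) := by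
        rw [integral_add (hion _ (by fun_prop)) (hion _ (by fun_prop)), integral_const_mul, setIntegral_const]
        simp [hBr, Measure.real]
    _ ≤ 3 / J ^ 2 * (J ^ 2 * δ ^ 2 * D) + (r ^ n * V) * (3 * K ^ 2 / J ^ 2 * A ^ 2 + 3 * 800 ^ 2 * C1 / J ^ 2 * (r ^ 4 * I0)) := by
        rw [hBrV]
        have := hsm.trans (mul_le_mul_of_nonneg_left hD (by positivity))
        gcongr
    _ = 3 * (δ ^ 2 * D) + r ^ n * (3 * K ^ 2 * V / J ^ 2 * A ^ 2) + 3 * 800 ^ 2 * C1 * V / J ^ 2 * (r ^ (n + 4) * I0) := by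
        field_simp; ring
    _ ≤ C * (δ ^ 2 * D) + 1 * (C * A ^ 2) + C * (r ^ (n + 4) * I0) := by
        have : r ^ n ≤ 1 := pow_le_one₀ hr0.le (by linarith)
        gcongr
    _ = _ := by ring

end PartD3

/-! ## Part E: the linear change of variables -/

section PartE

set_option linter.unusedSectionVars false

variable {E : Type*} [NormedAddCommGroup E] [InnerProductSpace ℝ E] [FiniteDimensional ℝ E]
  [CompleteSpace E] [MeasurableSpace E] [BorelSpace E]

/-- Stretching by `s` in the direction `e`. -/
noncomputable def TT (e : E) (s : ℝ) : E →L[ℝ] E :=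
  ContinuousLinearMap.id ℝ E + (s - 1) • (innerSL ℝ e).smulRight e

lemma TT_apply (e : E) (s : ℝ) (z : E) : TT e s z = z + ((s - 1) * ⟪e, z⟫) • e := by
  simp only [TT, add_apply, smul_apply, ContinuousLinearMap.smulRight_apply,
    ContinuousLinearMap.id_apply, innerSL_apply_apply, smul_smul]

lemma TT_comp {e : E} (he : ‖e‖ = 1) (s s' : ℝ) (z : E) : TT e s (TT e s' z) = TT e (s * s') z := by
  simp only [TT_apply, inner_add_right, inner_smul_right, real_inner_self_eq_norm_sq, he, add_assoc, ← add_smul]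
  congr 2
  ring

lemma TT_one (e : E) (z : E) : TT e 1 z = z := by simp [TT_apply]

lemma TT_symm (e : E) (s : ℝ) (x y : E) : ⟪TT e s x, y⟫ = ⟪x, TT e s y⟫ := by
  simp only [TT_apply, inner_add_left, inner_add_right, inner_smul_left, inner_smul_right, conj_trivial,
    real_inner_comm x e]
  ring

lemma TT_norm {e : E} (he : ‖e‖ = 1) (s : ℝ) (z : E) : ‖TT e s z‖ ≤ (2 + |s|) * ‖z‖ := by
  rw [TT_apply]
  have h1 := abs_real_inner_le_norm e z
  rw [he, one_mul] at h1
  calc _ ≤ ‖z‖ + |s - 1| * |⟪e, z⟫| * 1 := by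
        refine (norm_add_le _ _).trans ?_
        rw [norm_smul, he, Real.norm_eq_abs, abs_mul]
    _ ≤ ‖z‖ + (|s| + 1) * ‖z‖ * 1 := by
        have : |s - 1| ≤ |s| + 1 := by simpa using abs_sub s 1
        gcongr
    _ = _ := by ring

lemma TT_sq {e : E} (he : ‖e‖ = 1) {s p : ℝ} (hs : s ^ 2 = p - 1) (z : E) :
    TT e s (TT e s z) = z + ((p - 2) * ⟪e, z⟫) • e := by
  rw [TT_comp he, TT_apply]
  congr 3
  linarith

lemma TT_inv {e : E} (he : ‖e‖ = 1) {s : ℝ} (hs : s ≠ 0) (z : E) : TT e s⁻¹ (TT e s z) = z := by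
  rw [TT_comp he, inv_mul_cancel₀ hs, TT_one]

lemma TT_inv' {e : E} (he : ‖e‖ = 1) {s : ℝ} (hs : s ≠ 0) (z : E) : TT e s (TT e s⁻¹ z) = z := by
  rw [TT_comp he, mul_inv_cancel₀ hs, TT_one]

lemma TT_det {e : E} (he : ‖e‖ = 1) (s : ℝ) : LinearMap.det (TT e s : E →ₗ[ℝ] E) = s := by
  have : (TT e s : E →ₗ[ℝ] E) = LinearMap.transvection ((s - 1) • (innerSL ℝ e : E →ₗ[ℝ] ℝ)) e := by
    ext z
    simp [TT_apply, LinearMap.transvection.apply]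
  rw [this, LinearMap.transvection.det]
  simp [real_inner_self_eq_norm_sq, he]

lemma integral_TT {e : E} (he : ‖e‖ = 1) {s : ℝ} (hs : s ≠ 0) (f : E → ℝ) :
    ∫ z, f (TT e s z) = |s|⁻¹ * ∫ y, f y := by
  have hemb : MeasurableEmbedding (fun z => TT e s z) := by
    refine Topology.IsClosedEmbedding.measurableEmbedding ?_
    refine LinearMap.isClosedEmbedding_of_injective (f := (TT e s : E →ₗ[ℝ] E)) ?_
    rw [LinearMap.ker_eq_bot]
    intro a b hab
    have := congrArg (TT e s⁻¹) hab
    simpa [TT_inv he hs] using this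
  rw [← hemb.integral_map (g := f)]
  have h := Measure.map_linearMap_addHaar_eq_smul_addHaar (volume : Measure E) (f := (TT e s : E →ₗ[ℝ] E))
    (by rw [TT_det he]; exact hs)
  rw [TT_det he] at h
  have h' : Measure.map (fun z => TT e s z) (volume : Measure E) = ENNReal.ofReal |s⁻¹| • volume := h
  rw [h', integral_smul_measure, ENNReal.toReal_ofReal (abs_nonneg _), abs_inv, smul_eq_mul]

lemma integral_tT {e : E} (he : ‖e‖ = 1) {s τ : ℝ} (hs : s ≠ 0) (hτ : 0 < τ) (f : E → ℝ) :
    ∫ z, f (τ • TT e s z) = (|s|⁻¹ * (τ ^ Module.finrank ℝ E)⁻¹) * ∫ y, f y := by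
  have := integral_TT he hs (fun y => f (τ • y))
  rw [this]
  have h2 := integral_comp_affine f 0 hτ
  simp only [zero_add] at h2
  rw [h2]; ring

noncomputable def tau (s : ℝ) : ℝ := 1 / (2 * (2 + |s|))

lemma tau_pos (s : ℝ) : 0 < tau s := by unfold tau; positivity

lemma tau_norm {e : E} (he : ‖e‖ = 1) (s : ℝ) (z : E) : ‖tau s • TT e s z‖ ≤ 1/2 * ‖z‖ := by
  rw [norm_smul, Real.norm_eq_abs, abs_of_pos (tau_pos s)]
  calc tau s * ‖TT e s z‖ ≤ tau s * ((2 + |s|) * ‖z‖) := by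
        have := (tau_pos s).le
        have := TT_norm he s z
        gcongr
    _ = _ := by
        unfold tau
        have : 2 + |s| ≠ 0 := by positivity
        field_simp

lemma hasFDerivAt_tT {w : E → ℝ} (hw : Differentiable ℝ w) (e : E) (s τ : ℝ) (z : E) :
    HasFDerivAt (fun z => w (τ • TT e s z)) ((fderiv ℝ w (τ • TT e s z)).comp (τ • TT e s)) z := by
  have h1 : HasFDerivAt (fun z => τ • TT e s z) (τ • TT e s) z := (TT e s).hasFDerivAt.const_smul τ
  exact ((hw (τ • TT e s z)).hasFDerivAt).comp z h1

lemma gradient_tT {w : E → ℝ} (hw : Differentiable ℝ w) (e : E) (s τ : ℝ) (z : E) :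
    gradient (fun z => w (τ • TT e s z)) z = τ • TT e s (gradient w (τ • TT e s z)) := by
  refine ext_inner_right ℝ fun y => ?_
  have h := hasFDerivAt_tT hw e s τ z
  rw [gradient, InnerProductSpace.toDual_symm_apply, h.fderiv, inner_smul_left, TT_symm, gradient,
    InnerProductSpace.toDual_symm_apply]
  simp

lemma fderiv_zero_of_supp {χ : E → ℝ} (hχ : ContDiff ℝ 1 χ) {r : ℝ} (hr : 0 < r) (h0 : ∀ x, r ≤ ‖x‖ → χ x = 0) (x : E)
    (hx : r ≤ ‖x‖) : fderiv ℝ χ x = 0 := by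
  have h1 : ∀ y, r < ‖y‖ → fderiv ℝ χ y = 0 := by
    intro y hy
    have : χ =ᶠ[nhds y] fun _ => 0 := by
      filter_upwards [(isOpen_lt continuous_const continuous_norm).mem_nhds hy] with z hz
      exact h0 z (le_of_lt hz)
    rw [this.fderiv_eq]; simp
  have hc : Continuous (fun t : ℝ => fderiv ℝ χ (t • x)) :=
    (hχ.continuous_fderiv one_ne_zero).comp (by fun_prop)
  have ht : Filter.Tendsto (fun t : ℝ => fderiv ℝ χ (t • x)) (nhdsWithin 1 (Set.Ioi 1)) (nhds (fderiv ℝ χ ((1:ℝ) • x))) :=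
    (hc.tendsto 1).mono_left nhdsWithin_le_nhds
  have ht2 : Filter.Tendsto (fun t : ℝ => fderiv ℝ χ (t • x)) (nhdsWithin 1 (Set.Ioi 1)) (nhds 0) := by
    refine tendsto_const_nhds.congr' ?_
    filter_upwards [self_mem_nhdsWithin] with t ht
    have ht' : (1:ℝ) < t := ht
    rw [h1]
    rw [norm_smul, Real.norm_eq_abs, abs_of_pos (by linarith)]
    nlinarith
  have := tendsto_nhds_unique ht ht2
  simpa using this

end PartE

/-! ## Part E2: flat p-harmonic functions become almost harmonic -/

section PartE2

set_option linter.unusedSectionVars false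

variable {E : Type*} [NormedAddCommGroup E] [InnerProductSpace ℝ E] [FiniteDimensional ℝ E]
  [CompleteSpace E] [MeasurableSpace E] [BorelSpace E]

lemma integrable_of_supp_ball {f : E → ℝ} (hf : Measurable f) {M r : ℝ} (hM : ∀ x ∈ ball (0:E) r, |f x| ≤ M)
    (h0 : ∀ x, r ≤ ‖x‖ → f x = 0) : Integrable f := by
  have h1 := integrableOn_ball_of_bdd hf 0 r hM
  rw [← integrable_indicator_iff measurableSet_ball] at h1
  refine h1.congr (Filter.Eventually.of_forall fun x => ?_)
  by_cases hx : x ∈ ball (0:E) r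
  · rw [Set.indicator_of_mem hx]
  · rw [Set.indicator_of_notMem hx, h0 x]
    simpa using hx

lemma gradient_sub_affine' {u : E → ℝ} (hu : Differentiable ℝ u) (c : ℝ) (e : E) (x : E) :
    gradient (fun x => u x - c - ⟪e, x⟫) x = gradient u x - e := by
  refine ext_inner_right ℝ fun y => ?_
  rw [gradient, InnerProductSpace.toDual_symm_apply, (gradient_sub_affine hu c e x).fderiv, innerSL_apply_apply]

/-- the transformed error function -/
noncomputable def wt (u : E → ℝ) (e : E) (c s : ℝ) : E → ℝ :=
  fun z => u (tau s • TT e s z) - c - ⟪e, tau s • TT e s z⟫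

lemma differentiable_wt {u : E → ℝ} (hu : Differentiable ℝ u) (e : E) (c s : ℝ) : Differentiable ℝ (wt u e c s) := by
  have hw : Differentiable ℝ (fun x => u x - c - ⟪e, x⟫) := fun x => (gradient_sub_affine hu c e x).differentiableAt
  exact fun z => (hasFDerivAt_tT hw e s (tau s) z).differentiableAt

lemma gradient_wt {u : E → ℝ} (hu : Differentiable ℝ u) (e : E) (c s : ℝ) (z : E) :
    gradient (wt u e c s) z = tau s • TT e s (gradient u (tau s • TT e s z) - e) := by
  have hw : Differentiable ℝ (fun x => u x - c - ⟪e, x⟫) := fun x => (gradient_sub_affine hu c e x).differentiableAt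
  have := gradient_tT hw e s (tau s) z
  rw [gradient_sub_affine' hu] at this
  exact this

lemma grad_le_wt {u : E → ℝ} (hu : Differentiable ℝ u) {e : E} (he : ‖e‖ = 1) (c : ℝ) {s : ℝ} (hs : s ≠ 0) (z : E) :
    ‖gradient u (tau s • TT e s z) - e‖ ≤ ((tau s)⁻¹ * (2 + |s⁻¹|)) * ‖gradient (wt u e c s) z‖ := by
  rw [gradient_wt hu, norm_smul, Real.norm_eq_abs, abs_of_pos (tau_pos s)]
  have h1 := TT_norm he s⁻¹ (TT e s (gradient u (tau s • TT e s z) - e))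
  rw [TT_inv he hs] at h1
  refine h1.trans (le_of_eq ?_)
  have := (tau_pos s).ne'
  field_simp

set_option maxHeartbeats 1000000 in
lemma AH_of_PH (p : ℝ) (hp : 1 < p) (s : ℝ) (hs : s ^ 2 = p - 1) (L : ℝ) (hL0 : 0 < L) :
    ∃ K > 0, ∀ (u : E → ℝ) (e : E) (c : ℝ), PH p u → (∀ x ∈ ball (0:E) 2, ‖gradient u x‖ ≤ L) → ‖e‖ = 1 →
    AH K (wt u e c s) := by
  have hs0 : s ≠ 0 := by rintro rfl; norm_num at hs; linarith
  obtain ⟨C, hC, hF⟩ := F_taylor (E := E) p hp L hL0.le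
  set τ := tau s with hτd
  have hτ : 0 < τ := tau_pos s
  set B := τ⁻¹ * (2 + |s⁻¹|) with hB
  have hB0 : 0 < B := by positivity
  refine ⟨τ ^ 2 * C * B ^ 3, by positivity, ?_⟩
  intro u e c hu hL he
  have hgm := measurable_gradient u
  have hgb : ∀ x ∈ ball (0:E) 2, ‖gradient u x - e‖ ≤ L + 1 := fun x hx =>
    (norm_sub_le _ _).trans (by rw [he]; linarith [hL x hx])
  have hmap : ∀ z : E, ‖z‖ < 1 → τ • TT e s z ∈ ball (0:E) 2 := fun z hz => by
    rw [mem_ball_zero_iff]; have := tau_norm he s z; linarith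
  refine ⟨differentiable_wt hu.diff e c s, ⟨1/2 * (L + 1), fun z hz => ?_⟩, fun χ hχ hsupp => ?_⟩
  · rw [mem_ball_zero_iff] at hz
    rw [gradient_wt hu.diff]
    refine (tau_norm he s _).trans ?_
    have := hgb _ (hmap z hz)
    gcongr
  have hχd := hχ.differentiable one_ne_zero
  have hχ0 := fderiv_zero_of_supp hχ one_pos hsupp
  have hχc := hχ.continuous_fderiv one_ne_zero
  obtain ⟨M, hM⟩ : ∃ M, ∀ x, ‖fderiv ℝ χ x‖ ≤ M := by
    obtain ⟨M, hM⟩ := (isCompact_closedBall (0:E) 1).exists_bound_of_continuousOn hχc.continuousOn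
    refine ⟨max M 0, fun x => ?_⟩
    rcases le_or_gt 1 ‖x‖ with h | h
    · rw [hχ0 x h, norm_zero]; exact le_max_right _ _
    · exact (hM x (by simpa using h.le)).trans (le_max_left _ _)
  have hM0 : 0 ≤ M := (norm_nonneg _).trans (hM 0)
  set ψ : E → ℝ := fun y => χ (τ⁻¹ • TT e s⁻¹ y) with hψ
  have hψf : ∀ y, HasFDerivAt ψ _ y := fun y => hasFDerivAt_tT hχd e s⁻¹ τ⁻¹ y
  have hψd : Differentiable ℝ ψ := fun y => (hψf y).differentiableAt
  have hψC : ContDiff ℝ 1 ψ := by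
    have : ContDiff ℝ 1 (fun y => τ⁻¹ • TT e s⁻¹ y) := (TT e s⁻¹).contDiff.const_smul _
    exact hχ.comp this
  have hinv : ∀ z, τ⁻¹ • TT e s⁻¹ (τ • TT e s z) = z := fun z => by
    rw [map_smul, TT_inv he hs0, smul_smul, inv_mul_cancel₀ hτ.ne', one_smul]
  have hinv' : ∀ z, τ • TT e s (τ⁻¹ • TT e s⁻¹ z) = z := fun z => by
    rw [map_smul, TT_inv' he hs0, smul_smul, mul_inv_cancel₀ hτ.ne', one_smul]
  have hψs : ∀ y, 1 ≤ ‖y‖ → ψ y = 0 := by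
    intro y hy
    apply hsupp
    by_contra hcon
    have h1 := tau_norm he s (τ⁻¹ • TT e s⁻¹ y)
    rw [hinv' y] at h1
    linarith
  have hψ0 := fderiv_zero_of_supp hψC one_pos hψs
  have hψapp : ∀ y ξ, fderiv ℝ ψ y ξ = fderiv ℝ χ (τ⁻¹ • TT e s⁻¹ y) (τ⁻¹ • TT e s⁻¹ ξ) := fun y ξ => by
    rw [(hψf y).fderiv]; simp
  have hψn : ∀ y, ‖fderiv ℝ ψ y‖ ≤ B * ‖fderiv ℝ χ (τ⁻¹ • TT e s⁻¹ y)‖ := by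
    intro y
    refine ContinuousLinearMap.opNorm_le_bound _ (by positivity) fun ξ => ?_
    rw [hψapp]
    refine (ContinuousLinearMap.le_opNorm _ _).trans ?_
    have : ‖τ⁻¹ • TT e s⁻¹ ξ‖ ≤ B * ‖ξ‖ := by
      rw [norm_smul, Real.norm_eq_abs, abs_of_pos (inv_pos.2 hτ), hB, mul_assoc]
      have := TT_norm he s⁻¹ ξ
      gcongr
    calc _ ≤ ‖fderiv ℝ χ (τ⁻¹ • TT e s⁻¹ y)‖ * (B * ‖ξ‖) := by gcongr
      _ = _ := by ring
  have hψM : ∀ y, ‖fderiv ℝ ψ y‖ ≤ B * M := fun y => (hψn y).trans (by gcongr; exact hM _)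
  have hψcs : HasCompactSupport ψ := by
    refine HasCompactSupport.intro (isCompact_closedBall (0:E) 1) fun y hy => hψs y ?_
    simp only [mem_closedBall, dist_zero_right, not_le] at hy; exact hy.le
  have h1 := hu.weakL hp hL ψ hψd (fun y hy => hψs y hy.le) hψM
  have h2 := integral_fderiv_zero ψ hψd hψcs hψM e
  have hFm : Measurable (F p : E → E) := (continuous_F hp).measurable
  have hψm : Continuous (fderiv ℝ ψ) := hψC.continuous_fderiv one_ne_zero
  -- generic integrability
  have hgenI : ∀ (X : E → E) (N : ℝ), Measurable X → (∀ y ∈ ball (0:E) 1, ‖X y‖ ≤ N) →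
      Integrable (fun y => fderiv ℝ ψ y (X y)) := by
    intro X N hX hN
    refine integrable_of_supp_ball (r := 1) (M := B * M * N) ?_ ?_ ?_
    · have := hψm.measurable
      fun_prop
    · intro y hy
      rw [← Real.norm_eq_abs]
      refine (ContinuousLinearMap.le_opNorm _ _).trans ?_
      have a1 := hψM y
      have a2 := hN y hy
      gcongr
    · intro y hy; rw [hψ0 y hy]; simp
  set w' : E → E := fun y => gradient u y - e with hw'
  have hw'm : Measurable w' := hgm.sub_const e
  set A0 : E → E := fun ξ => ξ + ((p - 2) * ⟪e, ξ⟫) • e with hA0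
  have hA0c : Continuous A0 := by fun_prop
  have hsub : ∀ y ∈ ball (0:E) 1, y ∈ ball (0:E) 2 := fun y hy => ball_subset_ball (by norm_num) hy
  have i1 : Integrable (fun y => fderiv ℝ ψ y (F p (gradient u y))) := by
    refine hgenI _ (L ^ (p - 1)) (hFm.comp hgm) fun y hy => ?_
    rw [norm_F hp]
    exact Real.rpow_le_rpow (norm_nonneg _) (hL y (hsub y hy)) (by linarith)
  have i2 : Integrable (fun y => fderiv ℝ ψ y e) := hgenI (fun _ => e) 1 measurable_const fun y hy => he.le
  have i3 : Integrable (fun y => fderiv ℝ ψ y (A0 (w' y))) := by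
    refine hgenI _ ((2 + |s|) * ((2 + |s|) * (L + 1))) (hA0c.measurable.comp hw'm) fun y hy => ?_
    have : A0 (w' y) = TT e s (TT e s (w' y)) := (TT_sq he hs _).symm
    rw [this]
    refine (TT_norm he s _).trans ?_
    gcongr
    refine (TT_norm he s _).trans ?_
    gcongr
    exact hgb y (hsub y hy)
  set G : E → E := fun y => F p (gradient u y) - e - A0 (w' y) with hG
  have hGint : ∫ y, fderiv ℝ ψ y (A0 (w' y)) = - ∫ y, fderiv ℝ ψ y (G y) := by
    have e0 : ∀ y, fderiv ℝ ψ y (G y) = fderiv ℝ ψ y (F p (gradient u y)) - fderiv ℝ ψ y e - fderiv ℝ ψ y (A0 (w' y)) := by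
      intro y; rw [hG]; simp only [map_sub]
    have e3 := integral_sub (i1.sub i2) i3
    simp only [Pi.sub_apply] at e3
    simp_rw [e0]
    rw [e3, integral_sub i1 i2, h1, h2]
    ring
  set H : E → ℝ := fun y => ‖fderiv ℝ ψ y‖ * ‖w' y‖ ^ 2 with hH
  have iH : Integrable H := by
    refine integrable_of_supp_ball (r := 1) (M := B * M * (L + 1) ^ 2) ?_ ?_ ?_
    · have := hψm.measurable
      fun_prop
    · intro y hy
      rw [abs_of_nonneg (by positivity)]
      have a1 := hψM y
      have a2 : ‖w' y‖ ≤ L + 1 := hgb y (hsub y hy)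
      simp only [hH]
      gcongr
    · intro y hy; simp only [hH]; rw [hψ0 y hy]; simp
  have hGH : |∫ y, fderiv ℝ ψ y (G y)| ≤ C * ∫ y, H y := by
    rw [← integral_const_mul, ← Real.norm_eq_abs]
    refine norm_integral_le_of_norm_le (iH.const_mul C) (Filter.Eventually.of_forall fun y => ?_)
    rcases le_or_gt 1 ‖y‖ with h | h
    · simp only [hH]; rw [hψ0 y h]; simp
    · refine (ContinuousLinearMap.le_opNorm _ _).trans ?_
      have := hF e (gradient u y) he (hL y (hsub y (by simpa using h)))
      have h4 : ‖G y‖ ≤ C * ‖w' y‖ ^ 2 := this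
      calc _ ≤ ‖fderiv ℝ ψ y‖ * (C * ‖w' y‖ ^ 2) := by gcongr
        _ = _ := by simp only [hH]; ring
  set κ := |s|⁻¹ * (τ ^ Module.finrank ℝ E)⁻¹ with hκ
  have hκ0 : 0 ≤ κ := by positivity
  have hch : ∫ z, fderiv ℝ χ z (gradient (wt u e c s) z) = τ ^ 2 * (κ * ∫ y, fderiv ℝ ψ y (A0 (w' y))) := by
    rw [hκ, ← integral_tT he hs0 hτ, ← integral_const_mul]
    congr 1
    ext z
    rw [hψapp, hinv, gradient_wt hu.diff]
    have : A0 (w' (τ • TT e s z)) = TT e s (TT e s (w' (τ • TT e s z))) := (TT_sq he hs _).symm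
    rw [this, TT_inv he hs0]
    simp only [map_smul, smul_eq_mul]
    rw [← hτd]
    simp only [hw', map_sub]
    field_simp
  have hHle : κ * ∫ y, H y ≤ B ^ 3 * ∫ x in ball (0:E) 1, ‖fderiv ℝ χ x‖ * ‖gradient (wt u e c s) x‖ ^ 2 := by
    rw [hκ, ← integral_tT he hs0 hτ, ← integral_const_mul, ← integral_indicator measurableSet_ball]
    have hgwm := measurable_gradient (wt u e c s)
    have hχm := hχc.measurable
    have hgw : ∀ z ∈ ball (0:E) 1, ‖gradient (wt u e c s) z‖ ≤ L + 1 := fun z hz => by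
      rw [mem_ball_zero_iff] at hz
      rw [gradient_wt hu.diff]
      refine (tau_norm he s _).trans ?_
      have := hgb _ (hmap z hz)
      change 1/2 * ‖gradient u (τ • TT e s z) - e‖ ≤ _
      linarith [norm_nonneg (gradient u (τ • TT e s z) - e)]
    refine integral_mono_of_nonneg (Filter.Eventually.of_forall fun z => ?_) ?_ (Filter.Eventually.of_forall fun z => ?_)
    · simp only [hH, Pi.zero_apply]; positivity
    · rw [integrable_indicator_iff measurableSet_ball]
      refine integrableOn_ball_of_bdd (M := B ^ 3 * (M * (L + 1) ^ 2)) (by fun_prop) 0 1 fun z hz => ?_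
      rw [abs_of_nonneg (by positivity)]
      have a1 := hM z
      have a2 := hgw z hz
      gcongr
    · have a1 := hψn (τ • TT e s z)
      rw [hinv] at a1
      have a2 : ‖w' (τ • TT e s z)‖ ≤ B * ‖gradient (wt u e c s) z‖ := grad_le_wt hu.diff he c hs0 z
      rcases le_or_gt 1 ‖z‖ with h | h
      · rw [hχ0 z h, norm_zero, mul_zero] at a1
        have : ‖fderiv ℝ ψ (τ • TT e s z)‖ = 0 := le_antisymm a1 (norm_nonneg _)
        simp only [hH]
        rw [this, zero_mul]
        refine Set.indicator_nonneg (fun x _ => ?_) _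
        positivity
      · rw [Set.indicator_of_mem (by simpa using h)]
        calc H (τ • TT e s z) ≤ (B * ‖fderiv ℝ χ z‖) * (B * ‖gradient (wt u e c s) z‖) ^ 2 := by
              simp only [hH]; gcongr
          _ = _ := by ring
  rw [hch, abs_mul, abs_mul, abs_of_nonneg hκ0, abs_of_nonneg (sq_nonneg τ), hGint, abs_neg]
  calc _ ≤ τ ^ 2 * (κ * (C * ∫ y, H y)) := by gcongr
    _ = τ ^ 2 * C * (κ * ∫ y, H y) := by ring
    _ ≤ τ ^ 2 * C * (B ^ 3 * ∫ x in ball (0:E) 1, ‖fderiv ℝ χ x‖ * ‖gradient (wt u e c s) x‖ ^ 2) := by gcongr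
    _ = _ := by ring

end PartE2

/-! ## Part E3: one step improvement of flatness -/

section PartE3

set_option linter.unusedSectionVars false

variable {E : Type*} [NormedAddCommGroup E] [InnerProductSpace ℝ E] [FiniteDimensional ℝ E]
  [CompleteSpace E] [MeasurableSpace E] [BorelSpace E]

lemma tT_inv {e : E} (he : ‖e‖ = 1) {s τ : ℝ} (hs : s ≠ 0) (hτ : 0 < τ) (z : E) :
    τ⁻¹ • TT e s⁻¹ (τ • TT e s z) = z := by
  rw [map_smul, TT_inv he hs, smul_smul, inv_mul_cancel₀ hτ.ne', one_smul]

lemma tT_inv' {e : E} (he : ‖e‖ = 1) {s τ : ℝ} (hs : s ≠ 0) (hτ : 0 < τ) (z : E) :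
    τ • TT e s (τ⁻¹ • TT e s⁻¹ z) = z := by
  rw [map_smul, TT_inv' he hs, smul_smul, mul_inv_cancel₀ hτ.ne', one_smul]

lemma integrable_tT {e : E} (he : ‖e‖ = 1) {s τ : ℝ} (hs : s ≠ 0) (hτ : 0 < τ) {f : E → ℝ} (hf : Integrable f) :
    Integrable (fun z => f (τ • TT e s z)) := by
  have h1 : Integrable (fun y => f (τ • y)) := (integrable_comp_smul_iff volume f hτ.ne').2 hf
  have hemb : MeasurableEmbedding (fun z => TT e s z) := by
    refine Topology.IsClosedEmbedding.measurableEmbedding ?_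
    refine LinearMap.isClosedEmbedding_of_injective (f := (TT e s : E →ₗ[ℝ] E)) ?_
    rw [LinearMap.ker_eq_bot]
    intro a b hab
    have := congrArg (TT e s⁻¹) hab
    simpa [TT_inv he hs] using this
  have h := Measure.map_linearMap_addHaar_eq_smul_addHaar (volume : Measure E) (f := (TT e s : E →ₗ[ℝ] E))
    (by rw [TT_det he]; exact hs)
  rw [TT_det he] at h
  have h' : Measure.map (fun z => TT e s z) (volume : Measure E) = ENNReal.ofReal |s⁻¹| • volume := h
  have h2 : Integrable (fun y => f (τ • y)) (Measure.map (fun z => TT e s z) (volume : Measure E)) := by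
    rw [h']
    exact h1.smul_measure ENNReal.ofReal_ne_top
  exact hemb.integrable_map_iff.1 h2

lemma tT_le {e : E} (he : ‖e‖ = 1) {s : ℝ} (hs : s ≠ 0) {f : E → ℝ} (h0 : ∀ x, 0 ≤ f x) {r : ℝ}
    (hf : IntegrableOn f (ball (0:E) (1/2 * r))) :
    ∫ z in ball (0:E) r, f (tau s • TT e s z) ≤
      (|s|⁻¹ * (tau s ^ Module.finrank ℝ E)⁻¹) * ∫ y in ball (0:E) (1/2 * r), f y := by
  rw [← integral_indicator measurableSet_ball, ← integral_indicator measurableSet_ball, ← integral_tT he hs (tau_pos s)]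
  refine integral_mono_of_nonneg (Filter.Eventually.of_forall fun z => ?_)
    (integrable_tT he hs (tau_pos s) ((integrable_indicator_iff measurableSet_ball).2 hf))
    (Filter.Eventually.of_forall fun z => ?_)
  · exact Set.indicator_nonneg (fun x _ => h0 _) _
  · by_cases hz : z ∈ ball (0:E) r
    · have h2 : tau s • TT e s z ∈ ball (0:E) (1/2 * r) := by
        rw [mem_ball_zero_iff] at hz ⊢
        have := tau_norm he s z
        linarith
      simp only [Set.indicator_of_mem hz, Set.indicator_of_mem h2, le_refl]
    · simp only [Set.indicator_of_notMem hz]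
      exact Set.indicator_nonneg (fun x _ => h0 _) _

lemma tT_inv_norm {e : E} (he : ‖e‖ = 1) {s : ℝ} (y : E) :
    ‖(tau s)⁻¹ • TT e s⁻¹ y‖ ≤ ((tau s)⁻¹ * (2 + |s⁻¹|)) * ‖y‖ := by
  rw [norm_smul, Real.norm_eq_abs, abs_of_pos (inv_pos.2 (tau_pos s)), mul_assoc]
  have := TT_norm he s⁻¹ y
  have := inv_pos.2 (tau_pos s)
  gcongr

lemma tT_ge {e : E} (he : ‖e‖ = 1) {s : ℝ} (hs : s ≠ 0) {f : E → ℝ} (h0 : ∀ x, 0 ≤ f x) {ρ : ℝ}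
    (hf : IntegrableOn (fun z => f (tau s • TT e s z)) (ball (0:E) (((tau s)⁻¹ * (2 + |s⁻¹|)) * ρ))) :
    (|s|⁻¹ * (tau s ^ Module.finrank ℝ E)⁻¹) * ∫ y in ball (0:E) ρ, f y ≤
      ∫ z in ball (0:E) (((tau s)⁻¹ * (2 + |s⁻¹|)) * ρ), f (tau s • TT e s z) := by
  rw [← integral_indicator measurableSet_ball, ← integral_indicator measurableSet_ball, ← integral_tT he hs (tau_pos s)]
  refine integral_mono_of_nonneg (Filter.Eventually.of_forall fun z => ?_)
    ((integrable_indicator_iff measurableSet_ball).2 hf) (Filter.Eventually.of_forall fun z => ?_)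
  · exact Set.indicator_nonneg (fun x _ => h0 _) _
  · by_cases hz : tau s • TT e s z ∈ ball (0:E) ρ
    · have h2 : z ∈ ball (0:E) (((tau s)⁻¹ * (2 + |s⁻¹|)) * ρ) := by
        rw [mem_ball_zero_iff] at hz ⊢
        have := tT_inv_norm he (s := s) (tau s • TT e s z)
        rw [tT_inv he hs (tau_pos s)] at this
        refine this.trans_lt ?_
        have := inv_pos.2 (tau_pos s)
        gcongr
      simp only [Set.indicator_of_mem hz, Set.indicator_of_mem h2, le_refl]
    · simp only [Set.indicator_of_notMem hz]
      exact Set.indicator_nonneg (fun x _ => h0 _) _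

lemma integrableOn_ball_of_continuous {g : E → ℝ} (hg : Continuous g) (x : E) (r : ℝ) : IntegrableOn g (ball x r) :=
  (hg.continuousOn.integrableOn_compact (isCompact_closedBall x r)).mono_set ball_subset_closedBall

set_option maxHeartbeats 1000000 in
lemma one_step_unit (p : ℝ) (hp : 1 < p) (L : ℝ) (hL0 : 0 < L) : ∃ C > 0, ∃ B > 0, ∀ (u : E → ℝ) (e : E) (c I : ℝ),
    PH p u → (∀ x ∈ ball (0:E) 2, ‖gradient u x‖ ≤ L) → ‖e‖ = 1 →
    ∫ x in ball (0:E) 1, (u x - c - ⟪e, x⟫) ^ 2 ≤ I →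
    ∃ (c' : ℝ) (e' : E), ‖e' - e‖ ^ 2 ≤ C * I ∧ ∀ ρ δ : ℝ, 0 < ρ → B * ρ ≤ 1/4 → 0 < δ → δ ≤ 1/4 →
      ∫ x in ball (0:E) ρ, (u x - c' - ⟪e', x⟫) ^ 2 ≤
        C * (ρ ^ (Module.finrank ℝ E + 4) * I + δ ^ 2 * I + ((δ ^ Module.finrank ℝ E)⁻¹ * I) ^ 2) := by
  set n := Module.finrank ℝ E with hn
  set s := Real.sqrt (p - 1) with hsd
  have hs : s ^ 2 = p - 1 := Real.sq_sqrt (by linarith)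
  have hs0 : s ≠ 0 := by intro h; rw [h] at hs; norm_num at hs; linarith
  obtain ⟨K, hK, hAH⟩ := AH_of_PH (E := E) p hp s hs L hL0
  obtain ⟨C1, hC1, hst⟩ := AH_step (E := E) K hK.le
  obtain ⟨C2, hC2, hcac⟩ := caccioppoli (E := E) p hp L hL0
  have hτ := tau_pos s
  set κ := |s|⁻¹ * (tau s ^ n)⁻¹ with hκ
  have hκ0 : 0 < κ := by have := abs_pos.2 hs0; positivity
  set B := (tau s)⁻¹ * (2 + |s⁻¹|) with hB
  have hB0 : 0 < B := by positivity
  let C := B ^ 2 * (C1 * κ) + κ⁻¹ * C1 * (B ^ (n + 4) * κ + κ * C2 + (κ * C2) ^ 2)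
  have hC0 : 0 < C := by positivity
  refine ⟨C, hC0, B, hB0, ?_⟩
  intro u e c I hu hL he hI
  have hI0 : 0 ≤ I := le_trans (integral_nonneg fun x => sq_nonneg _) hI
  have huc := hu.diff.continuous
  have hgm := measurable_gradient u
  have hTc : Continuous (fun z => tau s • TT e s z) := by
    have := (TT e s).continuous
    fun_prop
  have hI1 : ∫ z in ball (0:E) 1, wt u e c s z ^ 2 ≤ κ * I := by
    refine (tT_le he hs0 (f := fun y => (u y - c - ⟪e, y⟫) ^ 2) (fun x => sq_nonneg _)
      (integrableOn_ball_of_continuous (by fun_prop) _ _)).trans ?_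
    refine mul_le_mul_of_nonneg_left (le_trans ?_ hI) hκ0.le
    exact setIntegral_mono_set (integrableOn_ball_of_continuous (by fun_prop) _ _)
      (Filter.Eventually.of_forall fun x => sq_nonneg _)
      (Filter.Eventually.of_forall (ball_subset_ball (by norm_num)))
  have hgi : IntegrableOn (fun y => ‖gradient u y - e‖ ^ 2) (ball (0:E) (1/2 * 1)) := by
    refine integrableOn_ball_of_bdd (M := (L + 1) ^ 2) (by fun_prop) 0 _ fun y hy => ?_
    rw [abs_of_nonneg (by positivity)]
    have : ‖gradient u y - e‖ ≤ L + 1 := (norm_sub_le _ _).trans (by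
      rw [he]; linarith [hL y (ball_subset_ball (by norm_num) hy)])
    gcongr
  have hD1 : ∫ z in ball (0:E) 1, ‖gradient (wt u e c s) z‖ ^ 2 ≤ κ * C2 * I := by
    have h1 := tT_le he hs0 (f := fun y => ‖gradient u y - e‖ ^ 2) (fun x => sq_nonneg _) hgi
    have h2 : ∫ z in ball (0:E) 1, ‖gradient (wt u e c s) z‖ ^ 2 ≤
        ∫ z in ball (0:E) 1, ‖gradient u (tau s • TT e s z) - e‖ ^ 2 := by
      refine integral_mono_of_nonneg (Filter.Eventually.of_forall fun z => sq_nonneg _) ?_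
        (Filter.Eventually.of_forall fun z => ?_)
      · have : Measurable (fun z => gradient u (tau s • TT e s z)) := hgm.comp hTc.measurable
        refine integrableOn_ball_of_bdd (M := (L + 1) ^ 2) (by fun_prop) 0 _ fun y hy => ?_
        rw [abs_of_nonneg (by positivity)]
        have hy' : ‖tau s • TT e s y‖ < 2 := by
          have := tau_norm he s y
          rw [mem_ball_zero_iff] at hy
          linarith
        have : ‖gradient u (tau s • TT e s y) - e‖ ≤ L + 1 := (norm_sub_le _ _).trans (by
          rw [he]; linarith [hL _ (mem_ball_zero_iff.2 hy')])
        gcongr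
      · change ‖gradient (wt u e c s) z‖ ^ 2 ≤ ‖gradient u (tau s • TT e s z) - e‖ ^ 2
        rw [gradient_wt hu.diff]
        have := tau_norm he s (gradient u (tau s • TT e s z) - e)
        gcongr
        linarith [norm_nonneg (gradient u (tau s • TT e s z) - e)]
    have h3 := hcac u e c hu hL he
    rw [mul_one] at h1
    calc _ ≤ κ * ∫ y in ball (0:E) (1/2), ‖gradient u y - e‖ ^ 2 := h2.trans h1
      _ ≤ κ * (C2 * I) := by gcongr; exact h3.trans (by gcongr)
      _ = _ := by ring
  obtain ⟨c1, a, hc1, ha, hdec⟩ := hst _ (hAH u e c hu hL he) _ _ hD1 hI1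
  set a' := (tau s)⁻¹ • TT e s⁻¹ a with ha'
  refine ⟨c + c1, e + a', ?_, ?_⟩
  · rw [add_sub_cancel_left]
    calc ‖a'‖ ^ 2 ≤ (B * ‖a‖) ^ 2 := by gcongr; exact tT_inv_norm he a
      _ = B ^ 2 * ‖a‖ ^ 2 := by ring
      _ ≤ B ^ 2 * (C1 * (κ * I)) := by gcongr
      _ = (B ^ 2 * (C1 * κ)) * I := by ring
      _ ≤ C * I := by
        have : 0 ≤ κ⁻¹ * C1 * (B ^ (n + 4) * κ + κ * C2 + (κ * C2) ^ 2) := by positivity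
        gcongr
        simp only [C]; linarith
  · intro ρ δ hρ hBρ hδ hδ4
    have h1 := hdec (B * ρ) δ (by positivity) hBρ hδ hδ4
    have hwc := (differentiable_wt hu.diff e c s).continuous
    have key : ∀ z, u (tau s • TT e s z) - (c + c1) - ⟪e + a', tau s • TT e s z⟫ = wt u e c s z - c1 - ⟪a, z⟫ := by
      intro z
      have : ⟪a', tau s • TT e s z⟫ = ⟪a, z⟫ := by
        rw [ha', inner_smul_left, TT_symm, ← inner_smul_right]
        simp only [conj_trivial, tT_inv he hs0 hτ]
      rw [inner_add_left, this, wt]; ring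
    have h2 := tT_ge he hs0 (f := fun x => (u x - (c + c1) - ⟪e + a', x⟫) ^ 2) (fun x => sq_nonneg _) (ρ := ρ)
      (integrableOn_ball_of_continuous (by fun_prop) _ _)
    simp only [key] at h2
    have h3 := h2.trans h1
    rw [← hn, ← hκ] at h3
    have h4 : ∫ x in ball (0:E) ρ, (u x - (c + c1) - ⟪e + a', x⟫) ^ 2 ≤
        κ⁻¹ * (C1 * ((B * ρ) ^ (n + 4) * (κ * I) + δ ^ 2 * (κ * C2 * I) + ((δ ^ n)⁻¹ * (κ * C2 * I)) ^ 2)) := by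
      rw [le_inv_mul_iff₀ hκ0]; exact h3
    refine h4.trans ?_
    have x1 : 0 ≤ ρ ^ (n + 4) * I := by positivity
    have x2 : 0 ≤ δ ^ 2 * I := by positivity
    have x3 : 0 ≤ ((δ ^ n)⁻¹ * I) ^ 2 := by positivity
    set X1 := ρ ^ (n + 4) * I
    set X2 := δ ^ 2 * I
    set X3 := ((δ ^ n)⁻¹ * I) ^ 2 with hX3
    have e1 : κ⁻¹ * (C1 * ((B * ρ) ^ (n + 4) * (κ * I) + δ ^ 2 * (κ * C2 * I) + ((δ ^ n)⁻¹ * (κ * C2 * I)) ^ 2)) =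
        κ⁻¹ * C1 * (B ^ (n + 4) * κ) * X1 + κ⁻¹ * C1 * (κ * C2) * X2 + κ⁻¹ * C1 * (κ * C2) ^ 2 * X3 := by
      simp only [X1, X2, hX3]; rw [mul_pow]; ring
    rw [e1]
    have q1 : 0 ≤ κ⁻¹ * C1 * (B ^ (n + 4) * κ) := by positivity
    have q2 : 0 ≤ κ⁻¹ * C1 * (κ * C2) := by positivity
    have q3 : 0 ≤ κ⁻¹ * C1 * (κ * C2) ^ 2 := by positivity
    have q4 : 0 ≤ B ^ 2 * (C1 * κ) := by positivity
    have eC : C = B ^ 2 * (C1 * κ) + κ⁻¹ * C1 * (B ^ (n + 4) * κ) + κ⁻¹ * C1 * (κ * C2) + κ⁻¹ * C1 * (κ * C2) ^ 2 := by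
      simp only [C]; ring
    have z1 : κ⁻¹ * C1 * (B ^ (n + 4) * κ) * X1 ≤ C * X1 := mul_le_mul_of_nonneg_right (by linarith) x1
    have z2 : κ⁻¹ * C1 * (κ * C2) * X2 ≤ C * X2 := mul_le_mul_of_nonneg_right (by linarith) x2
    have z3 : κ⁻¹ * C1 * (κ * C2) ^ 2 * X3 ≤ C * X3 := mul_le_mul_of_nonneg_right (by linarith) x3
    have : C * (X1 + X2 + X3) = C * X1 + C * X2 + C * X3 := by ring
    rw [this]
    linarith

end PartE3

/-! ## Part E4: iteration -/

section PartE4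

set_option linter.unusedSectionVars false

variable {E : Type*} [NormedAddCommGroup E] [InnerProductSpace ℝ E] [FiniteDimensional ℝ E]
  [CompleteSpace E] [MeasurableSpace E] [BorelSpace E]

lemma PH.smul {p : ℝ} {u : E → ℝ} (hu : PH p u) {m : ℝ} (hm : 0 < m) : PH p (fun x => m * u x) := by
  have := hu.rescale 0 one_pos hm 0
  simpa using this

lemma gradient_smul' {u : E → ℝ} (hu : Differentiable ℝ u) (m : ℝ) (x : E) :
    gradient (fun x => m * u x) x = m • gradient u x := by
  have := gradient_rescale hu 0 1 m 0 x
  simpa using this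

lemma caccioppoli' (p : ℝ) (hp : 1 < p) (L : ℝ) (hL0 : 0 < L) : ∃ C > 0, ∀ (u : E → ℝ) (e : E) (c : ℝ),
    PH p u → (∀ x ∈ ball (0:E) 2, ‖gradient u x‖ ≤ L) → 1/2 ≤ ‖e‖ →
    ∫ x in ball (0:E) (1/2), ‖gradient u x - e‖ ^ 2 ≤ C * ∫ x in ball (0:E) 1, (u x - c - ⟪e, x⟫) ^ 2 := by
  obtain ⟨C, hC, h⟩ := caccioppoli (E := E) p hp (2 * L) (by linarith)
  refine ⟨C, hC, fun u e c hu hL he => ?_⟩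
  have hm : 0 < ‖e‖ := by linarith
  have hmi := inv_pos.2 hm
  have hm2 : ‖e‖⁻¹ ≤ 2 := by
    rw [inv_le_comm₀ hm (by norm_num)]; linarith
  have h1 := h (fun x => ‖e‖⁻¹ * u x) (‖e‖⁻¹ • e) (‖e‖⁻¹ * c) (hu.smul hmi) (fun x hx => by
    rw [gradient_smul' hu.diff, norm_smul, Real.norm_eq_abs, abs_of_pos hmi]
    have := hL x hx
    gcongr) (by rw [norm_smul, norm_inv, norm_norm, inv_mul_cancel₀ hm.ne'])
  have e1 : ∀ x, ‖gradient (fun x => ‖e‖⁻¹ * u x) x - ‖e‖⁻¹ • e‖ ^ 2 = (‖e‖⁻¹) ^ 2 * ‖gradient u x - e‖ ^ 2 := by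
    intro x
    rw [gradient_smul' hu.diff, ← smul_sub, norm_smul, Real.norm_eq_abs, abs_of_pos hmi, mul_pow]
  have e2 : ∀ x, (‖e‖⁻¹ * u x - ‖e‖⁻¹ * c - ⟪‖e‖⁻¹ • e, x⟫) ^ 2 = (‖e‖⁻¹) ^ 2 * (u x - c - ⟪e, x⟫) ^ 2 := by
    intro x
    rw [inner_smul_left]; simp only [conj_trivial]; ring
  simp only [e1, e2, integral_const_mul] at h1
  have h2 : 0 < (‖e‖⁻¹) ^ 2 := by positivity
  rw [← mul_le_mul_iff_right₀ h2]
  linarith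

lemma one_step (p : ℝ) (hp : 1 < p) (L : ℝ) (hL0 : 0 < L) : ∃ t > 0, t ≤ 1/2 ∧ ∃ C > 0, ∃ ε₀ > 0,
    ∀ (u : E → ℝ) (e : E) (c ε : ℝ), PH p u → (∀ x ∈ ball (0:E) 2, ‖gradient u x‖ ≤ L) → 1/2 ≤ ‖e‖ → ‖e‖ ≤ 2 →
    0 ≤ ε → ε ≤ ε₀ → ∫ x in ball (0:E) 1, (u x - c - ⟪e, x⟫) ^ 2 ≤ ε ^ 2 →
    ∃ (c' : ℝ) (e' : E), ‖e' - e‖ ≤ C * ε ∧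
      ∫ x in ball (0:E) (t ^ 4), (u x - c' - ⟪e', x⟫) ^ 2 ≤ (t ^ 4) ^ (Module.finrank ℝ E + 2) * (t ^ 3 * ε) ^ 2 := by
  set n := Module.finrank ℝ E with hn
  obtain ⟨C, hC, B, hB, h⟩ := one_step_unit (E := E) p hp (2 * L) (by linarith)
  set t := min (1/2) (min (1 / (4 * B)) (1 / (1 + 48 * C))) with ht
  have ht0 : 0 < t := by positivity
  have ht1 : t ≤ 1/2 := min_le_left _ _
  have htB : B * t ≤ 1/4 := by
    have : t ≤ 1 / (4 * B) := (min_le_right _ _).trans (min_le_left _ _)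
    rw [le_div_iff₀ (by positivity)] at this; linarith
  have htC : 48 * C * t ≤ 1 := by
    have : t ≤ 1 / (1 + 48 * C) := (min_le_right _ _).trans (min_le_right _ _)
    rw [le_div_iff₀ (by positivity)] at this; nlinarith
  set η := (t ^ 4) ^ (n + 2) * t ^ 6 with hη
  have hη0 : 0 < η := by positivity
  set δ := min (1/4) (η / (48 * C)) with hδ
  have hδ0 : 0 < δ := by positivity
  have hδ4 : δ ≤ 1/4 := min_le_left _ _
  have hδη : 48 * C * δ ≤ η := by
    have : δ ≤ η / (48 * C) := min_le_right _ _
    rw [le_div_iff₀ (by positivity)] at this; linarith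
  set Q := ((δ ^ n)⁻¹) ^ 2 with hQ
  have hQ0 : 0 < Q := by positivity
  set ε₀ := min 1 (η / (192 * C * Q)) with hε₀
  have hε0 : 0 < ε₀ := by positivity
  have hε1 : ε₀ ≤ 1 := min_le_left _ _
  have hεη : 192 * C * Q * ε₀ ≤ η := by
    have : ε₀ ≤ η / (192 * C * Q) := min_le_right _ _
    rw [le_div_iff₀ (by positivity)] at this; linarith
  refine ⟨t, ht0, ht1, 4 * Real.sqrt C, by positivity, ε₀, hε0, ?_⟩
  intro u e c ε hu hL he he2 hεn hε hI
  have hm : 0 < ‖e‖ := by linarith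
  have hmi := inv_pos.2 hm
  have hm2 : ‖e‖⁻¹ ≤ 2 := by
    rw [inv_le_comm₀ hm (by norm_num)]; linarith
  have e2 : ∀ x, (‖e‖⁻¹ * u x - ‖e‖⁻¹ * c - ⟪‖e‖⁻¹ • e, x⟫) ^ 2 = (‖e‖⁻¹) ^ 2 * (u x - c - ⟪e, x⟫) ^ 2 := by
    intro x
    rw [inner_smul_left]; simp only [conj_trivial]; ring
  obtain ⟨c', e', he', hdec⟩ := h (fun x => ‖e‖⁻¹ * u x) (‖e‖⁻¹ • e) (‖e‖⁻¹ * c) (2 ^ 2 * ε ^ 2) (hu.smul hmi) (fun x hx => by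
    rw [gradient_smul' hu.diff, norm_smul, Real.norm_eq_abs, abs_of_pos hmi]
    have := hL x hx
    gcongr) (by rw [norm_smul, norm_inv, norm_norm, inv_mul_cancel₀ hm.ne']) (by
    simp only [e2, integral_const_mul]
    gcongr)
  refine ⟨‖e‖ * c', ‖e‖ • e', ?_, ?_⟩
  · have h1 : ‖e‖ • e' - e = ‖e‖ • (e' - ‖e‖⁻¹ • e) := by
      rw [smul_sub, smul_smul, mul_inv_cancel₀ hm.ne', one_smul]
    rw [h1, norm_smul, norm_norm]
    have h2 : ‖e' - ‖e‖⁻¹ • e‖ ≤ Real.sqrt C * (2 * ε) := by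
      refine le_of_sq_le_sq ?_ (by positivity)
      rw [mul_pow, Real.sq_sqrt hC.le]
      linarith
    calc _ ≤ 2 * (Real.sqrt C * (2 * ε)) := by gcongr
      _ = _ := by ring
  · have h1 := hdec (t ^ 4) δ (by positivity) (by
      have : t ^ 4 ≤ t := pow_le_of_le_one ht0.le (by linarith) (by norm_num)
      nlinarith) hδ0 hδ4
    have e3 : ∀ x, (u x - ‖e‖ * c' - ⟪‖e‖ • e', x⟫) ^ 2 = ‖e‖ ^ 2 * (‖e‖⁻¹ * u x - c' - ⟪e', x⟫) ^ 2 := by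
      intro x
      rw [inner_smul_left]; simp only [conj_trivial]; field_simp
    simp only [e3, integral_const_mul]
    have h3 : ‖e‖ ^ 2 ≤ 4 := by nlinarith
    have hεsq : ε ^ 2 ≤ ε₀ := by nlinarith
    have b1 : 48 * C * (t ^ 4) ^ (n + 4) ≤ η := by
      have : (t ^ 4) ^ (n + 4) = η * t * t := by rw [hη]; ring
      rw [this]
      calc 48 * C * (η * t * t) = η * t * (48 * C * t) := by ring
        _ ≤ η * 1 * 1 := by gcongr; linarith
        _ = η := by ring
    have b2 : 48 * C * δ ^ 2 ≤ η := by nlinarith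
    have b3 : 192 * C * Q * ε ^ 2 ≤ η := le_trans (by gcongr) hεη
    calc _ ≤ 4 * (C * ((t ^ 4) ^ (n + 4) * (2 ^ 2 * ε ^ 2) + δ ^ 2 * (2 ^ 2 * ε ^ 2) + ((δ ^ n)⁻¹ * (2 ^ 2 * ε ^ 2)) ^ 2)) := by
          refine mul_le_mul h3 h1 (integral_nonneg fun x => sq_nonneg _) (by norm_num)
      _ = (1/3) * (48 * C * (t ^ 4) ^ (n + 4)) * ε ^ 2 + (1/3) * (48 * C * δ ^ 2) * ε ^ 2 + (1/3) * (192 * C * Q * ε ^ 2) * ε ^ 2 := by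
          rw [hQ]; ring
      _ ≤ (1/3) * η * ε ^ 2 + (1/3) * η * ε ^ 2 + (1/3) * η * ε ^ 2 := by gcongr
      _ = _ := by rw [hη]; ring

end PartE4

/-! ## Part E5: decay -/

section PartE5

set_option linter.unusedSectionVars false

variable {E : Type*} [NormedAddCommGroup E] [InnerProductSpace ℝ E] [FiniteDimensional ℝ E]
  [CompleteSpace E] [MeasurableSpace E] [BorelSpace E]

lemma inner_sq_eq_zero {b : E} (h : ∫ x in ball (0:E) 1, ⟪b, x⟫ ^ 2 ≤ 0) : b = 0 := by
  by_contra hb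
  have hb0 := norm_pos_iff.2 hb
  have hc : Continuous (fun x : E => ⟪b, x⟫ ^ 2) := by fun_prop
  have h1 := (setIntegral_pos_iff_support_of_nonneg_ae (μ := (volume : Measure E)) (s := ball (0:E) 1)
    (f := fun x : E => ⟪b, x⟫ ^ 2) (Filter.Eventually.of_forall fun x => sq_nonneg _)
    (integrableOn_ball_of_continuous hc 0 1)).2 (by
      refine IsOpen.measure_pos _ (hc.isOpen_support.inter isOpen_ball) ⟨(1 / (2 * ‖b‖)) • b, ?_, ?_⟩
      · rw [Function.mem_support, inner_smul_right, real_inner_self_eq_norm_sq]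
        positivity
      · rw [mem_ball_zero_iff, norm_smul, Real.norm_eq_abs, abs_of_pos (by positivity)]
        field_simp; norm_num)
  linarith

lemma setIntegral_neg (f : E → ℝ) (r : ℝ) : ∫ x in ball (0:E) r, f (-x) = ∫ x in ball (0:E) r, f x := by
  rw [← integral_indicator measurableSet_ball, ← integral_indicator measurableSet_ball, ← integral_neg_eq_self]
  congr 1
  ext x
  by_cases hx : x ∈ ball (0:E) r
  · have : -x ∈ ball (0:E) r := by simpa using hx
    rw [Set.indicator_of_mem this, Set.indicator_of_mem hx, neg_neg]
  · have : -x ∉ ball (0:E) r := by simpa using hx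
    rw [Set.indicator_of_notMem this, Set.indicator_of_notMem hx]

lemma even_trick (b : E) (c : ℝ) : ∫ x in ball (0:E) 1, ⟪b, x⟫ ^ 2 ≤ ∫ x in ball (0:E) 1, (c + ⟪b, x⟫) ^ 2 := by
  have h1 := setIntegral_neg (fun x : E => (c + ⟪b, x⟫) ^ 2) 1
  have i1 := integrableOn_ball_of_continuous (E := E) (g := fun x : E => (c + ⟪b, x⟫) ^ 2) (by fun_prop) 0 1
  have i2 := integrableOn_ball_of_continuous (E := E) (g := fun x : E => (c + ⟪b, -x⟫) ^ 2) (by fun_prop) 0 1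
  have h2 := integral_add i1 i2
  have h3 : ∫ x in ball (0:E) 1, 2 * ⟪b, x⟫ ^ 2 ≤ ∫ x in ball (0:E) 1, ((c + ⟪b, x⟫) ^ 2 + (c + ⟪b, -x⟫) ^ 2) := by
    refine setIntegral_mono (integrableOn_ball_of_continuous (by fun_prop) 0 1) (i1.add i2) fun x => ?_
    simp only [inner_neg_right]
    nlinarith [sq_nonneg c]
  rw [integral_const_mul] at h3
  linarith

lemma identify {u : E → ℝ} (hu : Differentiable ℝ u) {θ : ℝ} (hθ : 0 < θ) (hθ1 : θ < 1) (c : ℕ → ℝ) (e : ℕ → E) (e' : E)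
    (he : Filter.Tendsto e Filter.atTop (nhds e')) (A : ℕ → ℝ) (hA : Filter.Tendsto A Filter.atTop (nhds 0))
    (hI : ∀ k, ∫ x in ball (0:E) 1, ((θ ^ k)⁻¹ * u (θ ^ k • x) - c k - ⟪e k, x⟫) ^ 2 ≤ A k) : gradient u 0 = e' := by
  set g := gradient u 0 with hg
  set V := (volume (ball (0:E) 1)).toReal with hV
  have hV0 : 0 ≤ V := ENNReal.toReal_nonneg
  have huc := hu.continuous
  have hθk : Filter.Tendsto (fun k => θ ^ k) Filter.atTop (nhds 0) := tendsto_pow_atTop_nhds_zero_of_lt_one hθ.le hθ1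
  -- differentiability
  have hd : ∀ η > 0, ∀ᶠ k in Filter.atTop, ∀ x ∈ ball (0:E) 1, |(θ ^ k)⁻¹ * u (θ ^ k • x) - (θ ^ k)⁻¹ * u 0 - ⟪g, x⟫| ≤ η := by
    intro η hη
    have h1 := (hu 0).hasGradientAt.hasFDerivAt
    rw [hasFDerivAt_iff_isLittleO_nhds_zero] at h1
    have h2 := h1.def hη
    obtain ⟨ρ, hρ, h3⟩ := Metric.eventually_nhds_iff.1 h2
    filter_upwards [hθk.eventually (gt_mem_nhds hρ)] with k hk x hx
    have hk0 : 0 < θ ^ k := by positivity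
    rw [mem_ball_zero_iff] at hx
    have h4 := @h3 (θ ^ k • x) (by
      rw [dist_zero_right, norm_smul, Real.norm_eq_abs, abs_of_pos hk0]; nlinarith [norm_nonneg x])
    simp only [zero_add, InnerProductSpace.toDual_apply_apply, inner_smul_right, norm_smul, Real.norm_eq_abs, abs_of_pos hk0] at h4
    have e1 : (θ ^ k)⁻¹ * u (θ ^ k • x) - (θ ^ k)⁻¹ * u 0 - ⟪g, x⟫ = (θ ^ k)⁻¹ * (u (θ ^ k • x) - u 0 - θ ^ k * ⟪g, x⟫) := by
      field_simp
    rw [e1, abs_mul, abs_of_pos (inv_pos.2 hk0), inv_mul_le_iff₀ hk0]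
    refine h4.trans ?_
    have : η * (θ ^ k * ‖x‖) = θ ^ k * (η * ‖x‖) := by ring
    rw [this]
    gcongr
    nlinarith
  have hmain : ∫ x in ball (0:E) 1, ⟪e' - g, x⟫ ^ 2 ≤ 0 := by
    refine le_of_forall_pos_le_add fun η hη => ?_
    have hη1 : 0 < η / (8 * (V + 1)) := by positivity
    have hη2 : 0 < Real.sqrt (η / (8 * (V + 1))) := Real.sqrt_pos.2 hη1
    obtain ⟨k, hk1, hk2, hk3⟩ := ((hd _ hη2).and ((hA.eventually (gt_mem_nhds (by positivity : 0 < η / 16))).and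
      ((tendsto_iff_norm_sub_tendsto_zero.1 he).eventually (gt_mem_nhds hη2)))).exists
    set σ := Real.sqrt (η / (8 * (V + 1))) with hσ
    have hσ2 : σ ^ 2 = η / (8 * (V + 1)) := Real.sq_sqrt hη1.le
    have hσV : σ ^ 2 * V ≤ η / 8 := by
      rw [hσ2, div_mul_eq_mul_div, div_le_div_iff₀ (by positivity) (by positivity)]; nlinarith
    calc ∫ x in ball (0:E) 1, ⟪e' - g, x⟫ ^ 2
        ≤ ∫ x in ball (0:E) 1, ((c k - (θ ^ k)⁻¹ * u 0) + ⟪e' - g, x⟫) ^ 2 := even_trick _ _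
      _ ≤ ∫ x in ball (0:E) 1, (3 * ((θ ^ k)⁻¹ * u (θ ^ k • x) - c k - ⟪e k, x⟫) ^ 2 + 6 * σ ^ 2) := by
          refine setIntegral_mono_on (integrableOn_ball_of_continuous (by fun_prop) 0 1)
            (integrableOn_ball_of_continuous (by fun_prop) 0 1) measurableSet_ball fun x hx => ?_
          have b1 := hk1 x hx
          have b2 : |⟪e k - e', x⟫| ≤ σ := by
            refine (abs_real_inner_le_norm _ _).trans ?_
            rw [mem_ball_zero_iff] at hx
            nlinarith [norm_nonneg x, norm_nonneg (e k - e')]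
          set X := (θ ^ k)⁻¹ * u (θ ^ k • x) - c k - ⟪e k, x⟫ with hX
          set Y := (θ ^ k)⁻¹ * u (θ ^ k • x) - (θ ^ k)⁻¹ * u 0 - ⟪g, x⟫ with hY
          have e1 : (c k - (θ ^ k)⁻¹ * u 0) + ⟪e' - g, x⟫ = -X + -⟪e k - e', x⟫ + Y := by
            rw [hX, hY, inner_sub_left, inner_sub_left]; ring
          rw [e1]
          have b3 : Y ^ 2 ≤ σ ^ 2 := by rw [← sq_abs Y]; gcongr
          have b4 : ⟪e k - e', x⟫ ^ 2 ≤ σ ^ 2 := by rw [← sq_abs ⟪e k - e', x⟫]; gcongr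
          have := three_sq (-X) (⟪e k - e', x⟫) Y
          linarith [neg_sq X]
      _ = 3 * (∫ x in ball (0:E) 1, ((θ ^ k)⁻¹ * u (θ ^ k • x) - c k - ⟪e k, x⟫) ^ 2) + V * (6 * σ ^ 2) := by
          rw [integral_add (integrableOn_ball_of_continuous (by fun_prop) 0 1)
            (integrableOn_ball_of_continuous (by fun_prop) 0 1), integral_const_mul, setIntegral_const]
          simp [hV, Measure.real]
      _ ≤ 0 + η := by nlinarith [hI k]
  have := inner_sq_eq_zero hmain
  exact (sub_eq_zero.1 this).symm

end PartE5

/-! ## Part E6: decay -/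

section PartE6

set_option linter.unusedSectionVars false

variable {E : Type*} [NormedAddCommGroup E] [InnerProductSpace ℝ E] [FiniteDimensional ℝ E]
  [CompleteSpace E] [MeasurableSpace E] [BorelSpace E]

lemma exists_seq_of_step {α : Type*} (P : ℕ → α → Prop) (Q : ℕ → α → α → Prop) (a0 : α) (h0 : P 0 a0)
    (hs : ∀ k a, P k a → ∃ b, P (k + 1) b ∧ Q k a b) :
    ∃ f : ℕ → α, f 0 = a0 ∧ (∀ k, P k (f k)) ∧ ∀ k, Q k (f k) (f (k + 1)) := by
  choose! g hg1 hg2 using hs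
  let f : ℕ → α := fun k => Nat.rec a0 (fun k a => g k a) k
  have hP : ∀ k, P k (f k) := by
    intro k
    induction k with
    | zero => exact h0
    | succ k ih => exact hg1 k _ ih
  exact ⟨f, rfl, hP, fun k => hg2 k _ (hP k)⟩

lemma rescale0_PH {p : ℝ} {u : E → ℝ} (hu : PH p u) {r : ℝ} (hr : 0 < r) : PH p (fun x => r⁻¹ * u (r • x)) := by
  have := hu.rescale 0 hr (inv_pos.2 hr) 0
  simpa using this

lemma rescale0_gradient {u : E → ℝ} (hu : Differentiable ℝ u) {r : ℝ} (hr : 0 < r) (x : E) :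
    gradient (fun x => r⁻¹ * u (r • x)) x = gradient u (r • x) := by
  have := gradient_rescale hu 0 r r⁻¹ 0 x
  rw [inv_mul_cancel₀ hr.ne', one_smul] at this
  simpa using this

lemma iterate (p : ℝ) (hp : 1 < p) (L : ℝ) (hL0 : 0 < L) : ∃ t > 0, t ≤ 1/2 ∧ ∃ C > 0, ∃ ε₁ > 0,
    ∀ (u : E → ℝ) (e : E) (c : ℝ), PH p u → (∀ x ∈ ball (0:E) 2, ‖gradient u x‖ ≤ L) → ‖e‖ = 1 →
    ∫ x in ball (0:E) 1, (u x - c - ⟪e, x⟫) ^ 2 ≤ ε₁ ^ 2 →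
    ∀ k : ℕ, ∫ x in ball (0:E) (1/2), ‖gradient u ((t ^ 4) ^ k • x) - gradient u 0‖ ^ 2 ≤ C * (t ^ 6) ^ k := by
  obtain ⟨t, ht0, ht1, C, hC, ε₀, hε₀, h⟩ := one_step (E := E) p hp L hL0
  obtain ⟨C2, hC2, hcac⟩ := caccioppoli' (E := E) p hp L hL0
  set V := (volume (ball (0:E) (1/2))).toReal with hV
  have hV0 : 0 ≤ V := ENNReal.toReal_nonneg
  set θ := t ^ 4 with hθ
  have hθ0 : 0 < θ := by positivity
  have hθ1 : θ < 1 := pow_lt_one₀ ht0.le (by linarith) (by norm_num)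
  set l := t ^ 3 with hl
  have hl0 : 0 < l := by positivity
  have hl1 : l ≤ 1/2 := (pow_le_of_le_one ht0.le (by linarith) (by norm_num)).trans ht1
  set ε := min ε₀ (1 / (4 * C)) with hε
  have hε0 : 0 < ε := by positivity
  have hεε : ε ≤ ε₀ := min_le_left _ _
  have hεC : C * ε ≤ 1/4 := by
    have : ε ≤ 1 / (4 * C) := min_le_right _ _
    rw [le_div_iff₀ (by positivity)] at this; linarith
  refine ⟨t, ht0, ht1, 2 * C2 * ε ^ 2 + V * (2 * (2 * C * ε) ^ 2), by positivity, ε, hε0, ?_⟩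
  intro u e c hu hL he hI
  have huc := hu.diff.continuous
  let P : ℕ → ℝ × E → Prop := fun k ce =>
    ∫ x in ball (0:E) 1, ((θ ^ k)⁻¹ * u (θ ^ k • x) - ce.1 - ⟪ce.2, x⟫) ^ 2 ≤ (l ^ k * ε) ^ 2 ∧
      ‖ce.2 - e‖ ≤ 2 * C * ε * (1 - l ^ k)
  let Q : ℕ → ℝ × E → ℝ × E → Prop := fun k a b => ‖b.2 - a.2‖ ≤ C * (l ^ k * ε)
  have hθk : ∀ k, 0 < θ ^ k := fun k => by positivity
  have hθk1 : ∀ k, θ ^ k ≤ 1 := fun k => pow_le_one₀ hθ0.le hθ1.le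
  have hlk1 : ∀ k, l ^ k ≤ 1 := fun k => pow_le_one₀ hl0.le (by linarith)
  have hgk : ∀ k, ∀ x ∈ ball (0:E) 2, ‖gradient (fun x => (θ ^ k)⁻¹ * u (θ ^ k • x)) x‖ ≤ L := by
    intro k x hx
    rw [rescale0_gradient hu.diff (hθk k)]
    refine hL _ ?_
    rw [mem_ball_zero_iff] at hx ⊢
    rw [norm_smul, Real.norm_eq_abs, abs_of_pos (hθk k)]
    nlinarith [norm_nonneg x, hθk1 k]
  have hnear : ∀ k (ce : ℝ × E), P k ce → 1/2 ≤ ‖ce.2‖ ∧ ‖ce.2‖ ≤ 2 := by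
    intro k ce hce
    have h1 : ‖ce.2 - e‖ ≤ 1/2 := by
      refine hce.2.trans ?_
      have : 0 ≤ l ^ k := by positivity
      nlinarith [mul_pos hC hε0]
    have h2 := norm_sub_norm_le ce.2 e
    have h3 := norm_sub_norm_le e ce.2
    rw [norm_sub_rev e] at h3
    rw [he] at h2 h3
    constructor <;> linarith
  obtain ⟨f, hf0, hfP, hfQ⟩ := exists_seq_of_step P Q (c, e) (by
      refine ⟨?_, by simp⟩
      simpa using hI) (by
    intro k ce hce
    obtain ⟨hn1, hn2⟩ := hnear k ce hce
    obtain ⟨c', e', h1, h2⟩ := h _ ce.2 ce.1 (l ^ k * ε) (rescale0_PH hu (hθk k)) (hgk k) hn1 hn2 (by positivity)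
      (le_trans (by nlinarith [hlk1 k]) hεε) hce.1
    refine ⟨(θ⁻¹ * c', e'), ⟨?_, ?_⟩, h1⟩
    · have e1 : ∀ x, ((θ ^ (k + 1))⁻¹ * u (θ ^ (k + 1) • x) - θ⁻¹ * c' - ⟪e', x⟫) ^ 2 =
          (θ⁻¹) ^ 2 * (fun y => ((θ ^ k)⁻¹ * u (θ ^ k • y) - c' - ⟪e', y⟫) ^ 2) (0 + θ • x) := by
        intro x
        simp only [zero_add, smul_smul, inner_smul_right, ← pow_succ]
        have := (hθk k).ne'
        generalize u (θ ^ (k + 1) • x) = X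
        rw [pow_succ]
        field_simp
        ring
      simp only [e1]
      rw [integral_const_mul]
      rw [setIntegral_ball_comp (fun y => ((θ ^ k)⁻¹ * u (θ ^ k • y) - c' - ⟪e', y⟫) ^ 2) (0:E) hθ0 1, mul_one]
      calc _ ≤ θ⁻¹ ^ 2 * ((θ ^ Module.finrank ℝ E)⁻¹ * (θ ^ (Module.finrank ℝ E + 2) * (l * (l ^ k * ε)) ^ 2)) := by gcongr
        _ = _ := by rw [pow_add, pow_succ l k]; field_simp
    · calc ‖e' - e‖ ≤ ‖e' - ce.2‖ + ‖ce.2 - e‖ := norm_sub_le_norm_sub_add_norm_sub _ _ _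
        _ ≤ C * (l ^ k * ε) + 2 * C * ε * (1 - l ^ k) := add_le_add h1 hce.2
        _ ≤ _ := by
          rw [pow_succ]
          have : 0 < l ^ k * (C * ε) := by positivity
          nlinarith)
  have hdist : ∀ k, dist ((f k).2) ((f (k + 1)).2) ≤ (C * ε) * l ^ k := by
    intro k
    rw [dist_comm, dist_eq_norm]
    refine (hfQ k).trans (le_of_eq (by ring))
  have hcau := cauchySeq_of_le_geometric l (C * ε) (by linarith) hdist
  obtain ⟨e', he'⟩ := cauchySeq_tendsto_of_complete hcau
  have hrate := dist_le_of_le_geometric_of_tendsto l (C * ε) (by linarith) hdist he'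
  have hgrad : gradient u 0 = e' := by
    refine identify hu.diff hθ0 hθ1 (fun k => (f k).1) (fun k => (f k).2) e' he' (fun k => (l ^ k * ε) ^ 2) ?_ (fun k => (hfP k).1)
    have h1 : Filter.Tendsto (fun k => (l ^ k * ε) ^ 2) Filter.atTop (nhds ((0 * ε) ^ 2)) :=
      ((tendsto_pow_atTop_nhds_zero_of_lt_one hl0.le (by linarith)).mul_const ε).pow 2
    simpa using h1
  intro k
  have h1 := hcac _ (f k).2 (f k).1 (rescale0_PH hu (hθk k)) (hgk k) (hnear k _ (hfP k)).1
  simp only [rescale0_gradient hu.diff (hθk k)] at h1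
  have h2 : ‖(f k).2 - e'‖ ≤ 2 * C * ε * l ^ k := by
    have := hrate k
    rw [dist_eq_norm, le_div_iff₀ (by linarith)] at this
    have : 0 ≤ ‖(f k).2 - e'‖ := norm_nonneg _
    nlinarith
  have hgm := measurable_gradient u
  have hgm' : Measurable (fun x => gradient u (θ ^ k • x)) := hgm.comp (by fun_prop)
  have hIntg : ∀ b : E, IntegrableOn (fun x => ‖gradient u (θ ^ k • x) - b‖ ^ 2) (ball (0:E) (1/2)) := by
    intro b
    refine integrableOn_ball_of_bdd (M := (L + ‖b‖) ^ 2) (by fun_prop) 0 _ fun y hy => ?_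
    rw [abs_of_nonneg (by positivity)]
    have h3 := hgk k y (ball_subset_ball (by norm_num) hy)
    rw [rescale0_gradient hu.diff (hθk k)] at h3
    have : ‖gradient u (θ ^ k • y) - b‖ ≤ L + ‖b‖ := (norm_sub_le _ _).trans (by linarith)
    gcongr
  rw [hgrad]
  calc ∫ x in ball (0:E) (1/2), ‖gradient u (θ ^ k • x) - e'‖ ^ 2
      ≤ ∫ x in ball (0:E) (1/2), (2 * ‖gradient u (θ ^ k • x) - (f k).2‖ ^ 2 + 2 * (2 * C * ε * l ^ k) ^ 2) := by
        refine setIntegral_mono (hIntg _) (((hIntg _).const_mul 2).add (integrableOn_const measure_ball_lt_top.ne)) fun x => ?_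
        have h3 : ‖gradient u (θ ^ k • x) - e'‖ ≤ ‖gradient u (θ ^ k • x) - (f k).2‖ + ‖(f k).2 - e'‖ :=
          norm_sub_le_norm_sub_add_norm_sub _ _ _
        have h4 : ‖gradient u (θ ^ k • x) - e'‖ ^ 2 ≤ (‖gradient u (θ ^ k • x) - (f k).2‖ + 2 * C * ε * l ^ k) ^ 2 := by
          gcongr; linarith
        refine h4.trans ?_
        change (‖gradient u (θ ^ k • x) - (f k).2‖ + 2 * C * ε * l ^ k) ^ 2 ≤ 2 * ‖gradient u (θ ^ k • x) - (f k).2‖ ^ 2 + 2 * (2 * C * ε * l ^ k) ^ 2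
        nlinarith [sq_nonneg (‖gradient u (θ ^ k • x) - (f k).2‖ - 2 * C * ε * l ^ k)]
    _ = 2 * (∫ x in ball (0:E) (1/2), ‖gradient u (θ ^ k • x) - (f k).2‖ ^ 2) + V * (2 * (2 * C * ε * l ^ k) ^ 2) := by
        rw [integral_add ((hIntg _).const_mul 2) (integrableOn_const measure_ball_lt_top.ne), integral_const_mul, setIntegral_const]
        simp [hV, Measure.real]
    _ ≤ 2 * (C2 * (l ^ k * ε) ^ 2) + V * (2 * (2 * C * ε * l ^ k) ^ 2) := by
        have := h1.trans (mul_le_mul_of_nonneg_left (hfP k).1 hC2.le)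
        gcongr
    _ = _ := by
        have : (t ^ 6) ^ k = (l ^ k) ^ 2 := by rw [hl]; ring
        rw [this]; ring

lemma decay (p : ℝ) (hp : 1 < p) (L : ℝ) (hL0 : 0 < L) : ∃ C > 0, ∃ ε₁ > 0,
    ∀ (u : E → ℝ) (e : E) (c : ℝ), PH p u → (∀ x ∈ ball (0:E) 2, ‖gradient u x‖ ≤ L) → ‖e‖ = 1 →
    ∫ x in ball (0:E) 1, (u x - c - ⟪e, x⟫) ^ 2 ≤ ε₁ ^ 2 →
    ∀ r : ℝ, 0 < r → r ≤ 1/2 → ∫ x in ball (0:E) r, ‖gradient u x - gradient u 0‖ ^ 2 ≤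
      C * r ^ (Module.finrank ℝ E + 1) * Real.sqrt r := by
  obtain ⟨t, ht0, ht1, C, hC, ε₁, hε₁, h⟩ := iterate (E := E) p hp L hL0
  set n := Module.finrank ℝ E with hn
  set θ := t ^ 4 with hθ
  have hθ0 : 0 < θ := by positivity
  have hθ1 : θ < 1 := pow_lt_one₀ ht0.le (by linarith) (by norm_num)
  refine ⟨C * (2 * θ⁻¹) ^ n * (4 * (t ^ 6)⁻¹), by positivity, ε₁, hε₁, ?_⟩
  intro u e c hu hL he hI r hr hr2
  obtain ⟨k, hk1, hk2⟩ := exists_nat_pow_near_of_lt_one (x := 2 * r) (by linarith) (by linarith) hθ0 hθ1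
  have hk0 : 0 < θ ^ k := by positivity
  have h1 := h u e c hu hL he hI k
  have h2 := setIntegral_ball_comp (fun x => ‖gradient u x - gradient u 0‖ ^ 2) (0:E) hk0 (1/2)
  simp only [zero_add] at h2
  rw [h2, ← hn, inv_mul_le_iff₀ (by positivity)] at h1
  have hgm := measurable_gradient u
  have h3 : ∫ x in ball (0:E) r, ‖gradient u x - gradient u 0‖ ^ 2 ≤
      ∫ x in ball (0:E) (θ ^ k * (1/2)), ‖gradient u x - gradient u 0‖ ^ 2 := by
    refine setIntegral_mono_set ?_ (Filter.Eventually.of_forall fun x => sq_nonneg _)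
      (Filter.Eventually.of_forall (ball_subset_ball (by linarith)))
    refine integrableOn_ball_of_bdd (M := (L + L) ^ 2) (by fun_prop) 0 _ fun y hy => ?_
    rw [abs_of_nonneg (by positivity)]
    have hle : θ ^ k ≤ 1 := pow_le_one₀ hθ0.le hθ1.le
    have : ‖gradient u y - gradient u 0‖ ≤ L + L := (norm_sub_le _ _).trans (add_le_add
      (hL y (ball_subset_ball (by linarith) hy)) (hL 0 (by simp)))
    gcongr
  refine h3.trans (h1.trans ?_)
  have h4 : θ ^ k ≤ 2 * θ⁻¹ * r := by
    rw [pow_succ] at hk1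
    have : θ ^ k ≤ (2 * r) / θ := by rw [le_div_iff₀ hθ0]; linarith
    calc _ ≤ _ := this
      _ = _ := by field_simp
  have h5 : (t ^ 6) ^ k ≤ 4 * (t ^ 6)⁻¹ * (r * Real.sqrt r) := by
    have h6 : (t ^ 2) ^ (k + 1) ≤ Real.sqrt (2 * r) := by
      apply Real.le_sqrt_of_sq_le
      have : ((t ^ 2) ^ (k + 1)) ^ 2 = θ ^ (k + 1) := by rw [hθ]; ring
      rw [this]; exact hk1.le
    have h7 : Real.sqrt (2 * r) ≤ 2 * Real.sqrt r := by
      rw [Real.sqrt_mul (by norm_num)]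
      have : Real.sqrt 2 ≤ 2 := by rw [Real.sqrt_le_left (by norm_num)]; norm_num
      gcongr
    have h8 : (t ^ 6) ^ (k + 1) ≤ (2 * r) * (2 * Real.sqrt r) := by
      have : (t ^ 6) ^ (k + 1) = θ ^ (k + 1) * (t ^ 2) ^ (k + 1) := by rw [hθ]; ring
      rw [this]
      exact mul_le_mul hk1.le (h6.trans h7) (by positivity) (by positivity)
    rw [pow_succ] at h8
    have : (t ^ 6) ^ k ≤ ((2 * r) * (2 * Real.sqrt r)) / t ^ 6 := by rw [le_div_iff₀ (by positivity)]; exact h8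
    calc _ ≤ _ := this
      _ = _ := by field_simp; norm_num
  have h9 : (θ ^ k) ^ n ≤ (2 * θ⁻¹ * r) ^ n := by gcongr
  calc (θ ^ k) ^ n * (C * (t ^ 6) ^ k) ≤ (2 * θ⁻¹ * r) ^ n * (C * (4 * (t ^ 6)⁻¹ * (r * Real.sqrt r))) := by gcongr
    _ = _ := by rw [mul_pow]; ring

end PartE6

section PartF
set_option linter.unusedSectionVars false
variable {E : Type*} [NormedAddCommGroup E] [InnerProductSpace ℝ E] [FiniteDimensional ℝ E] [CompleteSpace E]
  [MeasurableSpace E] [BorelSpace E]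

lemma integral_odd_zero (f : E → ℝ) (hf : ∀ z, f (-z) = - f z) : ∫ z, f z = 0 := by
  have h1 : ∫ z, f (-z) = ∫ z, f z := integral_neg_eq_self f volume
  simp only [hf, integral_neg] at h1
  linarith

lemma integral_qq_inner (e : E) (T : E →L[ℝ] E) : ∫ z : E, qq z ^ 3 * ⟪e, T z⟫ = 0 := by
  apply integral_odd_zero
  intro z
  rw [qq_neg, map_neg, inner_neg_right]; ring

set_option maxHeartbeats 1000000 in
lemma amvp_unit (p : ℝ) (hp : 1 < p) (s : ℝ) (hs : s ^ 2 = p - 1) (L : ℝ) (hL0 : 0 < L) : ∃ C > 0, ∃ ε₁ > 0,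
    ∀ (u : E → ℝ) (e : E), PH p u → (∀ x ∈ ball (0:E) 2, ‖gradient u x‖ ≤ L) → ‖e‖ = 1 → gradient u 0 = e →
    ∫ x in ball (0:E) 1, (u x - u 0 - ⟪e, x⟫) ^ 2 ≤ ε₁ ^ 2 →
    ∀ r : ℝ, 0 < r → r ≤ 1/2 → |∫ z : E, qq z ^ 3 * (u (r • (tau s • TT e s z)) - u 0)| ≤ C * r ^ 2 * Real.sqrt r := by
  obtain ⟨C, hC, ε₁, hε, hdec⟩ := decay (E := E) p hp L hL0
  obtain ⟨K, hK, hAH⟩ := AH_of_PH (E := E) p hp s hs L hL0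
  have hs0 : s ≠ 0 := by rintro rfl; norm_num at hs; linarith
  set N := Module.finrank ℝ E with hN
  set B := |s|⁻¹ * (tau s ^ N)⁻¹ with hB
  have hsp : 0 < |s| := abs_pos.mpr hs0
  have hτ := tau_pos s
  have hBp : 0 < B := by positivity
  set D := (tau s * (2 + |s|)) ^ 2 with hD
  have hDp : 0 < D := by positivity
  refine ⟨K * (D * (B * C)), by positivity, ε₁, hε, ?_⟩
  intro u e hu hL he hg hI r hr0 hr
  have hA := hAH u e (u 0) hu hL he
  set w := wt u e (u 0) s with hw
  have hdw := differentiable_wt hu.diff e (u 0) s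
  obtain ⟨Lw, hLw⟩ := hA.bdd
  have hkk : ∀ t, 0 < t → t ≤ 1/2 → |kk w 0 t| ≤ K * (D * (B * C)) * (t * Real.sqrt t) := by
    intro t ht0 ht
    refine (kk_bound hK.le hA 0 t ht0 (by simp; linarith)).trans ?_
    have hgm := measurable_gradient u
    have i1 : IntegrableOn (fun y => ‖gradient u y - e‖ ^ 2) (ball (0:E) (1/2 * t)) := by
      refine integrableOn_ball_of_bdd (M := (L + ‖e‖) ^ 2) (by fun_prop) 0 _ fun y hy => ?_
      rw [abs_of_nonneg (by positivity)]
      have h3 := hL y (ball_subset_ball (by linarith) hy)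
      have : ‖gradient u y - e‖ ≤ L + ‖e‖ := (norm_sub_le _ _).trans (by linarith)
      gcongr
    have i2 : IntegrableOn (fun z => D * ‖gradient u (tau s • TT e s z) - e‖ ^ 2) (ball (0:E) t) := by
      have hgm' : Measurable (fun z => gradient u (tau s • TT e s z)) := hgm.comp (by fun_prop)
      refine integrableOn_ball_of_bdd (M := D * (L + ‖e‖) ^ 2) (by fun_prop) 0 _ fun y hy => ?_
      rw [abs_of_nonneg (by positivity)]
      have h3 := hL (tau s • TT e s y) (by
        rw [mem_ball_zero_iff] at hy ⊢
        have := tau_norm he s y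
        linarith)
      have : ‖gradient u (tau s • TT e s y) - e‖ ≤ L + ‖e‖ := (norm_sub_le _ _).trans (by linarith)
      gcongr
    have hle : ∀ z, ‖gradient w z‖ ^ 2 ≤ D * ‖gradient u (tau s • TT e s z) - e‖ ^ 2 := by
      intro z
      rw [hw, gradient_wt hu.diff, norm_smul, Real.norm_eq_abs, abs_of_pos hτ, hD, ← mul_pow]
      have := TT_norm he s (gradient u (tau s • TT e s z) - e)
      rw [mul_assoc]
      gcongr
    have h1 : ∫ y in ball (0:E) t, ‖gradient w y‖ ^ 2 ≤ D * (B * (C * (1/2*t) ^ (N + 1) * Real.sqrt (1/2*t))) := by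
      calc ∫ y in ball (0:E) t, ‖gradient w y‖ ^ 2 ≤ ∫ z in ball (0:E) t, D * ‖gradient u (tau s • TT e s z) - e‖ ^ 2 :=
            integral_mono_of_nonneg (Filter.Eventually.of_forall fun z => by positivity) i2
              (Filter.Eventually.of_forall hle)
        _ = D * ∫ z in ball (0:E) t, ‖gradient u (tau s • TT e s z) - e‖ ^ 2 := integral_const_mul _ _
        _ ≤ D * (B * ∫ y in ball (0:E) (1/2 * t), ‖gradient u y - e‖ ^ 2) := by
            gcongr
            exact tT_le he hs0 (f := fun y => ‖gradient u y - e‖ ^ 2) (fun x => by positivity) i1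
        _ ≤ _ := by
            gcongr
            have := hdec u e (u 0) hu hL he hI (1/2*t) (by linarith) (by linarith)
            rwa [hg] at this
    have h2 : D * (B * (C * (1/2*t) ^ (N + 1) * Real.sqrt (1/2*t))) ≤ D * (B * (C * t ^ (N + 1) * Real.sqrt t)) := by
      have h3 : 1/2*t ≤ t := by linarith
      gcongr
    calc K * (t ^ N)⁻¹ * ∫ y in ball (0:E) t, ‖gradient w y‖ ^ 2 ≤ K * (t ^ N)⁻¹ * (D * (B * (C * t ^ (N + 1) * Real.sqrt t))) := by
          gcongr
          exact h1.trans h2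
      _ = _ := by rw [pow_succ]; field_simp
  have hMM0 : MM w 0 0 = 0 := by
    rw [MM_zero, hw]; simp [wt]
  have hder : ∀ t ∈ Set.Icc (0:ℝ) r, HasDerivAt (MM w 0) (kk w 0 t) t := by
    intro t ht
    refine hasDerivAt_MM hdw hLw 0 t ?_
    rw [norm_zero, zero_add, abs_of_nonneg ht.1]
    linarith [ht.2]
  have hmv : |MM w 0 r| ≤ K * (D * (B * C)) * (r * Real.sqrt r) * r := by
    obtain ⟨t, ht, hte⟩ := exists_hasDerivAt_eq_slope (MM w 0) (kk w 0) hr0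
      (fun t ht => (hder t ht).continuousAt.continuousWithinAt) (fun t ht => hder t ⟨ht.1.le, ht.2.le⟩)
    rw [hMM0, eq_div_iff (by linarith)] at hte
    have h1 := hkk t ht.1 (by linarith [ht.2])
    have : MM w 0 r = kk w 0 t * r := by linarith
    rw [this, abs_mul, abs_of_pos hr0]
    have h2 : t ≤ r := ht.2.le
    have h3 := ht.1.le
    have h4 : K * (D * (B * C)) * (t * Real.sqrt t) ≤ K * (D * (B * C)) * (r * Real.sqrt r) := by gcongr
    exact mul_le_mul_of_nonneg_right (h1.trans h4) hr0.le
  have heq : ∫ z : E, qq z ^ 3 * (u (r • (tau s • TT e s z)) - u 0) = MM w 0 r := by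
    have huc := hu.diff.continuous
    have hlin := integral_qq_inner (r • tau s • e) (TT e s)
    have : MM w 0 r = ∫ z : E, (qq z ^ 3 * (u (r • (tau s • TT e s z)) - u 0) - qq z ^ 3 * ⟪r • tau s • e, TT e s z⟫) := by
      rw [MM]
      congr 1; ext z
      rw [hw, wt]
      simp only [zero_add, map_smul, inner_smul_left, inner_smul_right, smul_comm (tau s) r]
      simp; ring
    rw [this, integral_sub, hlin, sub_zero]
    · exact integrable_qq_mul (by fun_prop) 2
    · exact integrable_qq_mul (by fun_prop) 2
  rw [heq]
  refine hmv.trans (le_of_eq (by ring))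

set_option maxHeartbeats 1000000 in
lemma amvp (p : ℝ) (hp : 1 < p) (s : ℝ) (hs : s ^ 2 = p - 1) {u : E → ℝ} (hu : PH p u) {x₀ : E} {ρ L : ℝ} (hρ : 0 < ρ)
    (hL : ∀ x ∈ ball x₀ ρ, ‖gradient u x‖ ≤ L) {m : ℝ} (hm : 0 < m) {e : E} (he : ‖e‖ = 1) (hg : gradient u x₀ = m • e)
    {ε : ℝ} (hε : 0 < ε) :
    ∀ᶠ r in nhdsWithin (0:ℝ) (Set.Ioi 0), |∫ z : E, qq z ^ 3 * (u (x₀ + r • TT e s z) - u x₀)| ≤ ε * r ^ 2 := by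
  have hL0 : 0 < L := by
    have := hL x₀ (mem_ball_self hρ)
    rw [hg, norm_smul, he, mul_one, Real.norm_eq_abs, abs_of_pos hm] at this
    linarith
  obtain ⟨C, hC, ε₁, hε₁, hmain⟩ := amvp_unit (E := E) p hp s hs (L / m) (by positivity)
  set V := (volume (ball (0:E) 1)).toReal with hV
  obtain ⟨η, hη, hηV⟩ : ∃ η > 0, η ^ 2 * V ≤ ε₁ ^ 2 := by
    have hV0 : 0 ≤ V := ENNReal.toReal_nonneg
    refine ⟨ε₁ / (1 + V), by positivity, ?_⟩
    rw [div_pow, div_mul_eq_mul_div, div_le_iff₀ (by positivity)]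
    have : V ≤ (1 + V) ^ 2 := by nlinarith
    gcongr
  have hd : HasFDerivAt u (innerSL ℝ (m • e)) x₀ := by
    have := (hu.diff x₀).hasGradientAt.hasFDerivAt
    rw [hg] at this
    exact this
  have hd2 := hd.isLittleO.def (c := m * η) (by positivity)
  rw [Metric.eventually_nhds_iff] at hd2
  obtain ⟨δ, hδ, hd3⟩ := hd2
  set R := min (ρ/4) (δ/2) with hR
  have hR0 : 0 < R := by positivity
  have hRρ : R ≤ ρ/4 := min_le_left _ _
  have hRδ : R ≤ δ/2 := min_le_right _ _
  set U : E → ℝ := fun x => (m * R)⁻¹ * (u (x₀ + R • x) - u x₀) with hU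
  have hUP : PH p U := hu.rescale x₀ hR0 (by positivity) _
  have hUg : ∀ x, gradient U x = m⁻¹ • gradient u (x₀ + R • x) := by
    intro x
    rw [hU, gradient_rescale hu.diff]
    congr 1
    field_simp
  have hU0 : U 0 = 0 := by simp [hU]
  have hfl : ∀ x ∈ ball (0:E) 1, |U x - U 0 - ⟪e, x⟫| ≤ η := by
    intro x hx
    rw [mem_ball_zero_iff] at hx
    have h1 := hd3 (y := x₀ + R • x) (by
      rw [dist_eq_norm, add_sub_cancel_left, norm_smul, Real.norm_eq_abs, abs_of_pos hR0]
      nlinarith [norm_nonneg x])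
    rw [add_sub_cancel_left, innerSL_apply_apply, norm_smul, Real.norm_eq_abs, Real.norm_eq_abs, abs_of_pos hR0, inner_smul_left, inner_smul_right] at h1
    have h2 : U x - U 0 - ⟪e, x⟫ = (m * R)⁻¹ * (u (x₀ + R • x) - u x₀ - m * (R * ⟪e, x⟫)) := by
      rw [hU0, hU]; field_simp; ring
    rw [h2, abs_mul, abs_of_pos (by positivity : 0 < (m*R)⁻¹), inv_mul_le_iff₀ (by positivity)]
    refine h1.trans ?_
    have : R * ‖x‖ ≤ R * 1 := by gcongr
    calc m * η * (R * ‖x‖) ≤ m * η * (R * 1) := by gcongr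
      _ = _ := by ring
  have hI : ∫ x in ball (0:E) 1, (U x - U 0 - ⟪e, x⟫) ^ 2 ≤ ε₁ ^ 2 := by
    refine le_trans ?_ hηV
    have huc := hUP.diff.continuous
    calc ∫ x in ball (0:E) 1, (U x - U 0 - ⟪e, x⟫) ^ 2 ≤ ∫ x in ball (0:E) 1, η ^ 2 := by
          refine setIntegral_mono_on (integrableOn_ball_of_continuous (by fun_prop) _ _) (integrableOn_const measure_ball_lt_top.ne) measurableSet_ball ?_
          intro x hx
          rw [← sq_abs]
          have := hfl x hx
          gcongr
      _ = _ := by rw [setIntegral_const]; simp [hV, Measure.real, mul_comm]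
  have hmm := hmain U e hUP (by
    intro x hx
    rw [hUg, norm_smul, Real.norm_eq_abs, abs_of_pos (by positivity), div_eq_inv_mul]
    gcongr
    apply hL
    rw [mem_ball_zero_iff] at hx
    rw [mem_ball, dist_eq_norm, add_sub_cancel_left, norm_smul, Real.norm_eq_abs, abs_of_pos hR0]
    nlinarith [norm_nonneg x]) he (by
    rw [hUg, smul_zero, add_zero, hg, smul_smul, inv_mul_cancel₀ hm.ne', one_smul]) hI
  have hτ := tau_pos s
  -- r = R * t * tau
  set κ := R * tau s with hκ
  have hκ0 : 0 < κ := by positivity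
  have hsm : ∀ᶠ r in nhdsWithin (0:ℝ) (Set.Ioi 0), (m * R * C * (κ⁻¹)^2) * Real.sqrt (r / κ) ≤ ε := by
    have hcont : Continuous (fun r : ℝ => (m * R * C * (κ⁻¹)^2) * Real.sqrt (r / κ)) := by fun_prop
    have := (hcont.tendsto 0).mono_left (nhdsWithin_le_nhds (s := Set.Ioi 0))
    simp only [zero_div, Real.sqrt_zero, mul_zero] at this
    filter_upwards [this.eventually (gt_mem_nhds hε)] with r hr using le_of_lt hr
  have hsm2 : ∀ᶠ r in nhdsWithin (0:ℝ) (Set.Ioi 0), r < κ/2 :=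
    nhdsWithin_le_nhds (gt_mem_nhds (by positivity))
  filter_upwards [hsm, hsm2, self_mem_nhdsWithin] with r h1 h2 h3
  have h3' : 0 < r := h3
  have h4 := hmm (r / κ) (by positivity) (by rw [div_le_iff₀ hκ0]; linarith)
  have h5 : ∀ z : E, qq z ^ 3 * (u (x₀ + r • TT e s z) - u x₀) = (m * R) * (qq z ^ 3 * (U ((r / κ) • (tau s • TT e s z)) - U 0)) := by
    intro z
    rw [hU0, hU]
    simp only [smul_smul]
    have : R * (r / κ * tau s) = r := by rw [hκ]; field_simp
    rw [← mul_assoc, this]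
    field_simp
    simp
  simp only [h5]
  rw [integral_const_mul, abs_mul, abs_of_pos (by positivity : 0 < m * R)]
  calc m * R * _ ≤ m * R * (C * (r/κ) ^ 2 * Real.sqrt (r/κ)) := by gcongr
    _ = ((m * R * C * (κ⁻¹)^2) * Real.sqrt (r / κ)) * r ^ 2 := by rw [div_pow]; field_simp
    _ ≤ _ := by gcongr

end PartF

section PartG
set_option linter.unusedSectionVars false
variable {E : Type*} [NormedAddCommGroup E] [InnerProductSpace ℝ E] [FiniteDimensional ℝ E] [CompleteSpace E]
  [MeasurableSpace E] [BorelSpace E]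

set_option maxHeartbeats 1000000 in
lemma two_point (p : ℝ) (hp : 1 < p) (s₁ s₂ : ℝ) (hs₁ : s₁ ^ 2 = p - 1) (hs₂ : s₂ ^ 2 = p - 1) {u : E → ℝ} (hu : PH p u)
    {x y : E} {ρ L : ℝ} (hρ : 0 < ρ)
    (hLx : ∀ q ∈ ball x ρ, ‖gradient u q‖ ≤ L) (hLy : ∀ q ∈ ball y ρ, ‖gradient u q‖ ≤ L)
    {m₁ m₂ : ℝ} (hm₁ : 0 < m₁) (hm₂ : 0 < m₂) {ν₁ ν₂ : E} (hν₁ : ‖ν₁‖ = 1) (hν₂ : ‖ν₂‖ = 1)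
    (hg₁ : gradient u x = m₁ • ν₁) (hg₂ : gradient u y = m₂ • ν₂) (Φ : E → E → ℝ)
    (hmax : ∀ᶠ q in nhds (x, y), u q.1 - u q.2 - Φ q.1 q.2 ≤ u x - u y - Φ x y)
    (ℓ : E → ℝ) (hℓc : Continuous ℓ) (hℓ : ∀ z, ℓ (-z) = - ℓ z) (Q : E → ℝ) (hQ : Continuous Q) (Ce : ℝ)
    (hbd : ∀ᶠ r in nhdsWithin (0:ℝ) (Set.Ioi 0), ∀ z : E, ‖z‖ ≤ 1 →
      Φ (x + r • TT ν₁ s₁ z) (y + r • TT ν₂ s₂ z) - Φ x y ≤ r * ℓ z + r ^ 2 * Q z + Ce * r ^ 3) :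
    0 ≤ ∫ z : E, qq z ^ 3 * Q z := by
  by_contra hneg
  push Not at hneg
  set I := ∫ z : E, qq z ^ 3 * Q z with hI
  set J := ∫ z : E, qq z ^ 3 with hJ
  have hJp : 0 < J := integral_qq_pos
  have hε : 0 < -I / 4 := by linarith
  have h1 := amvp p hp s₁ hs₁ hu hρ hLx hm₁ hν₁ hg₁ hε
  have h2 := amvp p hp s₂ hs₂ hu hρ hLy hm₂ hν₂ hg₂ hε
  have h3 : ∀ᶠ r in nhdsWithin (0:ℝ) (Set.Ioi 0), Ce * r * J < -I / 4 := by
    have hcont : Continuous (fun r : ℝ => Ce * r * J) := by fun_prop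
    have := (hcont.tendsto 0).mono_left (nhdsWithin_le_nhds (s := Set.Ioi 0))
    simp only [mul_zero, zero_mul] at this
    exact this.eventually (gt_mem_nhds hε)
  rw [Metric.eventually_nhds_iff] at hmax
  obtain ⟨δ, hδ, hmax⟩ := hmax
  have h4 : ∀ᶠ r in nhdsWithin (0:ℝ) (Set.Ioi 0), r < δ / (3 + |s₁| + |s₂|) :=
    nhdsWithin_le_nhds (gt_mem_nhds (by positivity))
  obtain ⟨r, h1, h2, h3, h4, h5, hr⟩ := (h1.and (h2.and (h3.and (h4.and (hbd.and self_mem_nhdsWithin))))).exists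
  have hr0 : 0 < r := hr
  have huc := hu.diff.continuous
  rw [lt_div_iff₀ (by positivity)] at h4
  have hball : ∀ (ν : E) (s : ℝ) (w z : E), ‖ν‖ = 1 → |s| ≤ |s₁| + |s₂| → ‖z‖ ≤ 1 → dist (w + r • TT ν s z) w < δ := by
    intro ν s w z hν hs hz
    rw [dist_eq_norm, add_sub_cancel_left, norm_smul, Real.norm_eq_abs, abs_of_pos hr0]
    have h6 := TT_norm hν s z
    have h7 : (2 + |s|) * ‖z‖ ≤ (3 + |s₁| + |s₂|) * 1 := by
      have := abs_nonneg s
      have := abs_nonneg s₁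
      have := abs_nonneg s₂
      exact mul_le_mul (by linarith) hz (norm_nonneg _) (by positivity)
    calc r * ‖TT ν s z‖ ≤ r * ((3 + |s₁| + |s₂|) * 1) := by gcongr; linarith
      _ < δ := by linarith
  have i1 : Integrable (fun z : E => qq z ^ 3 * (u (x + r • TT ν₁ s₁ z) - u x)) := integrable_qq_mul (by fun_prop) 2
  have i2 : Integrable (fun z : E => qq z ^ 3 * (u (y + r • TT ν₂ s₂ z) - u y)) := integrable_qq_mul (by fun_prop) 2
  have i3 : Integrable (fun z : E => qq z ^ 3 * (r * ℓ z)) := integrable_qq_mul (by fun_prop) 2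
  have i4 : Integrable (fun z : E => qq z ^ 3 * (r ^ 2 * Q z)) := integrable_qq_mul (by fun_prop) 2
  have i5 : Integrable (fun z : E => qq z ^ 3 * (Ce * r ^ 3)) := (integrable_qq 2).mul_const _
  have hle : (∫ z : E, qq z ^ 3 * (u (x + r • TT ν₁ s₁ z) - u x)) - (∫ z : E, qq z ^ 3 * (u (y + r • TT ν₂ s₂ z) - u y))
      ≤ ∫ z : E, (qq z ^ 3 * (r * ℓ z) + qq z ^ 3 * (r ^ 2 * Q z) + qq z ^ 3 * (Ce * r ^ 3)) := by
    rw [← integral_sub i1 i2]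
    refine integral_mono (i1.sub i2) ((i3.add i4).add i5) fun z => ?_
    by_cases hz : ‖z‖ ≤ 1
    · have h6 := h5 z hz
      have h7 := hmax (y := (x + r • TT ν₁ s₁ z, y + r • TT ν₂ s₂ z)) (by
        rw [Prod.dist_eq]
        refine max_lt (hball _ _ _ _ hν₁ ?_ hz) (hball _ _ _ _ hν₂ ?_ hz)
        · linarith [abs_nonneg s₂]
        · linarith [abs_nonneg s₁])
      simp only at h7
      have h8 : 0 ≤ qq z ^ 3 := pow_nonneg (qq_nonneg z) _
      have h9 := mul_le_mul_of_nonneg_left (show (u (x + r • TT ν₁ s₁ z) - u x) - (u (y + r • TT ν₂ s₂ z) - u y) ≤ r * ℓ z + r ^ 2 * Q z + Ce * r ^ 3 by linarith) h8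
      simp only [Pi.sub_apply, Pi.add_apply]
      linarith
    · simp [qq_eq_zero (le_of_not_ge hz)]
  have e3 : ∫ z : E, qq z ^ 3 * (r * ℓ z) = 0 := by
    apply integral_odd_zero
    intro z; rw [qq_neg, hℓ]; ring
  have e4 : ∫ z : E, qq z ^ 3 * (r ^ 2 * Q z) = r ^ 2 * I := by
    rw [hI, ← integral_const_mul]; congr 1; ext z; ring
  have e5 : ∫ z : E, qq z ^ 3 * (Ce * r ^ 3) = J * (Ce * r ^ 3) := integral_mul_const _ _
  have e6 := integral_add (i3.add i4) i5
  simp only [Pi.add_apply] at e6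
  rw [e6, integral_add i3 i4, e3, e4, e5] at hle
  have h6 := abs_le.mp h1
  have h7 := abs_le.mp h2
  have h8 : r ^ 2 * (Ce * r * J) ≤ r ^ 2 * (-I / 4) := by gcongr
  have h9 : 0 < r ^ 2 * (-I) := by have := sq_pos_of_pos hr0; nlinarith
  nlinarith

end PartG

section PartH
set_option linter.unusedSectionVars false
variable {E : Type*} [NormedAddCommGroup E] [InnerProductSpace ℝ E] [FiniteDimensional ℝ E] [CompleteSpace E]
  [MeasurableSpace E] [BorelSpace E]

lemma m2_eq {n n' : E} (h : ‖n‖ = ‖n'‖) : ∫ z : E, qq z ^ 3 * ⟪n, z⟫ ^ 2 = ∫ z : E, qq z ^ 3 * ⟪n', z⟫ ^ 2 := by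
  set R := (Submodule.span ℝ {n - n'})ᗮ.reflection with hR
  have hRn : R n = n' := Submodule.reflection_sub h
  have := R.measurePreserving.integral_comp R.toHomeomorph.measurableEmbedding (fun z => qq z ^ 3 * ⟪n', z⟫ ^ 2)
  rw [← this]
  congr 1; ext z
  rw [← hRn, LinearIsometryEquiv.inner_map_map]
  simp only [qq, LinearIsometryEquiv.norm_map]

lemma m2_pos {n : E} (h : n ≠ 0) : 0 < ∫ z : E, qq z ^ 3 * ⟪n, z⟫ ^ 2 := by
  have hc : Continuous (fun z : E => qq z ^ 3 * ⟪n, z⟫ ^ 2) := by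
    have := continuous_qq (E := E)
    fun_prop
  have hn : 0 < ‖n‖ := norm_pos_iff.mpr h
  refine hc.integral_pos_of_hasCompactSupport_nonneg_nonzero (x := (2 * ‖n‖)⁻¹ • n) ?_ ?_ ?_
  · exact (hasCompactSupport_qq_pow 2).mul_right
  · intro z
    have := qq_nonneg z
    positivity
  · have h1 : ‖(2 * ‖n‖)⁻¹ • n‖ = 1/2 := by
      rw [norm_smul, Real.norm_eq_abs, abs_of_pos (by positivity)]; field_simp
    simp only [qq, h1, inner_smul_right, real_inner_self_eq_norm_sq]
    have : max (0:ℝ) (1 - (1/2)^2) = 3/4 := by norm_num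
    rw [this]
    positivity

lemma exists_m2 : ∃ m > 0, ∀ n : E, m * ‖n‖ ^ 2 ≤ ∫ z : E, qq z ^ 3 * ⟪n, z⟫ ^ 2 := by
  by_cases hE : ∃ n : E, n ≠ 0
  · obtain ⟨n, hn⟩ := hE
    have hn' : 0 < ‖n‖ := norm_pos_iff.mpr hn
    refine ⟨(∫ z : E, qq z ^ 3 * ⟪n, z⟫ ^ 2) / ‖n‖ ^ 2, div_pos (m2_pos hn) (by positivity), fun n' => ?_⟩
    rw [← m2_eq (n := (‖n'‖ / ‖n‖) • n) (n' := n')]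
    · apply le_of_eq
      rw [div_mul_eq_mul_div, ← integral_mul_const, ← integral_div]
      congr 1; ext z
      rw [inner_smul_left]; simp; field_simp
    · rw [norm_smul]; simp; field_simp
  · push Not at hE
    exact ⟨1, one_pos, fun n => by simp [hE n]⟩

lemma m2_le {n : E} : ∫ z : E, qq z ^ 3 * ⟪n, z⟫ ^ 2 ≤ ‖n‖ ^ 2 * ∫ z : E, qq z ^ 3 := by
  rw [← integral_const_mul]
  refine integral_mono (integrable_qq_mul (by fun_prop) 2) ((integrable_qq 2).const_mul _) fun z => ?_
  simp only
  by_cases hz : ‖z‖ ≤ 1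
  · have h1 := abs_real_inner_le_norm n z
    have h2 : |⟪n, z⟫| ≤ ‖n‖ := by nlinarith [norm_nonneg n]
    have h3 : ⟪n, z⟫ ^ 2 ≤ ‖n‖ ^ 2 := by rw [← sq_abs]; gcongr
    have := pow_nonneg (qq_nonneg z) 3
    nlinarith
  · simp [qq_eq_zero (le_of_not_ge hz)]

lemma gradient_of_max {u f : E → ℝ} {x G : E} (hu : Differentiable ℝ u) (hf : HasFDerivAt f (innerSL ℝ G) x)
    (h : ∀ᶠ y in nhds x, u y - f y ≤ u x - f x) : gradient u x = G := by
  have h1 : IsLocalMax (fun y => u y - f y) x := h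
  have h2 : HasFDerivAt (fun y => u y - f y) (innerSL ℝ (gradient u x) - innerSL ℝ G) x :=
    (hu x).hasGradientAt.hasFDerivAt.sub hf
  have h3 := h1.hasFDerivAt_eq_zero h2
  have h4 : innerSL ℝ (gradient u x - G) (gradient u x - G) = 0 := by
    have h5 : innerSL ℝ (gradient u x - G) = 0 := by rw [map_sub, h3]
    rw [h5]; rfl
  rw [innerSL_apply_apply, inner_self_eq_zero] at h4
  exact sub_eq_zero.mp h4

lemma hasFDerivAt_normsq (γ : ℝ) (a x : E) : HasFDerivAt (fun x => γ * ‖x - a‖ ^ 2) (innerSL ℝ ((2 * γ) • (x - a))) x := by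
  have h1 : HasFDerivAt (fun x => x - a) (ContinuousLinearMap.id ℝ E) x := (hasFDerivAt_id x).sub_const a
  have h2 := (h1.norm_sq).const_mul γ
  refine h2.congr_fderiv ?_
  ext y
  simp
  ring

lemma perp_sq {n : E} (hn : ‖n‖ = 1) (ζ : E) : ‖ζ - ⟪n, ζ⟫ • n‖ ^ 2 = ‖ζ‖ ^ 2 - ⟪n, ζ⟫ ^ 2 := by
  rw [norm_sub_sq_real, norm_smul, hn, inner_smul_right, real_inner_comm, mul_one, Real.norm_eq_abs, sq_abs]; ring

lemma perp_le {n ν : E} (hn : ‖n‖ = 1) (hν : ‖ν‖ = 1) : ‖ν - ⟪n, ν⟫ • n‖ ^ 2 ≤ ‖ν - n‖ ^ 2 := by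
  rw [perp_sq hn, norm_sub_sq_real, hn, hν, real_inner_comm]
  nlinarith [sq_nonneg (⟪ν, n⟫ - 1)]

lemma norm_add_bound {n ζ : E} (hn : ‖n‖ = 1) {t r : ℝ} (ht : 0 < t) (hr : |r * ⟪n, ζ⟫| ≤ t / 2) :
    ‖t • n + r • ζ‖ ^ 2 = (t + r * ⟪n, ζ⟫) ^ 2 + r ^ 2 * ‖ζ - ⟪n, ζ⟫ • n‖ ^ 2 ∧
    ‖t • n + r • ζ‖ ≤ t + r * ⟪n, ζ⟫ + r ^ 2 * (‖ζ - ⟪n, ζ⟫ • n‖ ^ 2 / t) := by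
  have h1 : ‖t • n + r • ζ‖ ^ 2 = (t + r * ⟪n, ζ⟫) ^ 2 + r ^ 2 * ‖ζ - ⟪n, ζ⟫ • n‖ ^ 2 := by
    rw [perp_sq hn, norm_add_sq_real, norm_smul, norm_smul, hn, inner_smul_left, inner_smul_right, mul_pow, mul_pow,
      Real.norm_eq_abs, Real.norm_eq_abs, sq_abs, sq_abs]
    simp; ring
  refine ⟨h1, ?_⟩
  have ha := (abs_le.mp hr).1
  set a := t + r * ⟪n, ζ⟫ with hadef
  have ha2 : t / 2 ≤ a := by rw [hadef]; linarith
  set P := r ^ 2 * ‖ζ - ⟪n, ζ⟫ • n‖ ^ 2 with hP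
  have hP0 : 0 ≤ P := by positivity
  have e : r ^ 2 * (‖ζ - ⟪n, ζ⟫ • n‖ ^ 2 / t) = P / t := by rw [hP]; ring
  rw [e]
  have hPt : 0 ≤ P / t := by positivity
  refine abs_le_of_sq_le_sq' ?_ (by linarith) |>.2
  rw [h1]
  have : P = (P / t) * t := by field_simp
  nlinarith

/-- reflection-type coupling difference -/
lemma coupling_diff (n ν : E) (s : ℝ) (z : E) :
    TT ν s z - TT n (-s) z = ((s - 1) * ⟪ν, z⟫) • ν + ((s + 1) * ⟪n, z⟫) • n := by
  rw [TT_apply, TT_apply]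
  have : (-s - 1) * ⟪n, z⟫ = - ((s + 1) * ⟪n, z⟫) := by ring
  rw [this, neg_smul]
  abel

lemma coupling_perp {n ν : E} (hn : ‖n‖ = 1) (hν : ‖ν‖ = 1) (s : ℝ) {z : E} (hz : ‖z‖ ≤ 1) :
    ‖(TT ν s z - TT n (-s) z) - ⟪n, TT ν s z - TT n (-s) z⟫ • n‖ ^ 2 ≤ (s - 1) ^ 2 * ‖ν - n‖ ^ 2 := by
  have h1 : (TT ν s z - TT n (-s) z) - ⟪n, TT ν s z - TT n (-s) z⟫ • n = ((s - 1) * ⟪ν, z⟫) • (ν - ⟪n, ν⟫ • n) := by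
    rw [coupling_diff, inner_add_right, inner_smul_right, inner_smul_right, real_inner_self_eq_norm_sq, hn]
    module
  rw [h1, norm_smul, mul_pow, Real.norm_eq_abs, sq_abs, mul_pow]
  have h2 := perp_le hn hν
  have h3 : ⟪ν, z⟫ ^ 2 ≤ 1 := by
    have := abs_real_inner_le_norm ν z
    rw [hν, one_mul] at this
    rw [← sq_abs]
    exact pow_le_one₀ (abs_nonneg _) (this.trans hz)
  calc (s-1)^2 * ⟪ν, z⟫^2 * ‖ν - ⟪n, ν⟫ • n‖ ^ 2 ≤ (s-1)^2 * 1 * ‖ν - n‖ ^ 2 := by gcongr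
    _ = _ := by ring

lemma coupling_inner {n ν : E} (hn : ‖n‖ = 1) (hν : ‖ν‖ = 1) (s : ℝ) {z : E} (hz : ‖z‖ ≤ 1) :
    2 * s ^ 2 * ⟪n, z⟫ ^ 2 - (s - 1) ^ 2 * ‖ν - n‖ ^ 2 ≤ ⟪n, TT ν s z - TT n (-s) z⟫ ^ 2 := by
  have h1 : ⟪n, TT ν s z - TT n (-s) z⟫ = 2 * s * ⟪n, z⟫ + (s - 1) * (- ⟪n - ⟪ν, n⟫ • ν, z⟫) := by
    rw [coupling_diff, inner_add_right, inner_smul_right, inner_smul_right, real_inner_self_eq_norm_sq, hn,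
      inner_sub_left, inner_smul_left, real_inner_comm ν n]
    simp
    ring
  rw [h1]
  set b := - ⟪n - ⟪ν, n⟫ • ν, z⟫ with hb
  have h2 : b ^ 2 ≤ ‖ν - n‖ ^ 2 := by
    have h3 := perp_le hν hn
    rw [norm_sub_rev n ν] at h3
    refine le_trans ?_ h3
    rw [hb, neg_sq, ← sq_abs]
    have := abs_real_inner_le_norm (n - ⟪ν, n⟫ • ν) z
    have : |⟪n - ⟪ν, n⟫ • ν, z⟫| ≤ ‖n - ⟪ν, n⟫ • ν‖ := by nlinarith [norm_nonneg (n - ⟪ν, n⟫ • ν)]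
    gcongr
  nlinarith [sq_nonneg (2 * s * ⟪n, z⟫ + 2 * (s - 1) * b), mul_le_mul_of_nonneg_left h2 (sq_nonneg (s-1))]

lemma IL_quad {n ν x : E} (hn : ‖n‖ = 1) (hν : ‖ν‖ = 1) {s t r α A κ : ℝ} {z : E} (hz : ‖z‖ ≤ 1) (ht : 0 < t)
    (hr : 0 < r) (hα0 : 0 ≤ α) (hα : α ≤ 1) (hA : 0 ≤ A) (hκ : 0 ≤ κ) (hrs : r * (2 * (2 + |s|)) ≤ t / 2) :
    (α * ‖(x + r • TT ν s z) - (x - t • n + r • TT n (-s) z)‖ - A * ‖(x + r • TT ν s z) - (x - t • n + r • TT n (-s) z)‖ ^ 2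
      + κ * ‖x + r • TT ν s z‖ ^ 2) - (α * ‖x - (x - t • n)‖ - A * ‖x - (x - t • n)‖ ^ 2 + κ * ‖x‖ ^ 2) ≤
    r * ((α - 2 * A * t) * ⟪n, TT ν s z - TT n (-s) z⟫ + 2 * κ * ⟪x, TT ν s z⟫) +
    r ^ 2 * (((s - 1) ^ 2 * ‖ν - n‖ ^ 2 / t + κ * (2 + |s|) ^ 2) - A * ⟪n, TT ν s z - TT n (-s) z⟫ ^ 2) := by
  have e1 : (x + r • TT ν s z) - (x - t • n + r • TT n (-s) z) = t • n + r • (TT ν s z - TT n (-s) z) := by module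
  have e2 : x - (x - t • n) = t • n := by module
  rw [e1, e2]
  have hT1 := TT_norm hν s z
  have hT2 := TT_norm hn (-s) z
  rw [abs_neg] at hT2
  have hp := coupling_perp hn hν s hz
  set ζ := TT ν s z - TT n (-s) z with hζ
  have hS : 0 ≤ 2 + |s| := by positivity
  have hT1' : ‖TT ν s z‖ ≤ 2 + |s| := by nlinarith
  have hT2' : ‖TT n (-s) z‖ ≤ 2 + |s| := by nlinarith
  have hζn : |⟪n, ζ⟫| ≤ 2 * (2 + |s|) := by
    have h1 := abs_real_inner_le_norm n ζ
    have h2 := norm_sub_le (TT ν s z) (TT n (-s) z)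
    rw [← hζ] at h2
    rw [hn, one_mul] at h1
    linarith
  obtain ⟨h1, h2⟩ := norm_add_bound hn (ζ := ζ) (r := r) ht (by
    rw [abs_mul, abs_of_pos hr]
    refine le_trans ?_ hrs
    gcongr)
  rw [h1, norm_smul t n, hn, Real.norm_eq_abs, abs_of_pos ht, mul_one]
  have h3 : ‖x + r • TT ν s z‖ ^ 2 = ‖x‖ ^ 2 + 2 * r * ⟪x, TT ν s z⟫ + r ^ 2 * ‖TT ν s z‖ ^ 2 := by
    rw [norm_add_sq_real, inner_smul_right, norm_smul, mul_pow, Real.norm_eq_abs, sq_abs]; ring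
  rw [h3]
  have h4 : ‖TT ν s z‖ ^ 2 ≤ (2 + |s|) ^ 2 := by gcongr
  have hr2 : 0 < r ^ 2 := by positivity
  have h5 : κ * (r ^ 2 * ‖TT ν s z‖ ^ 2) ≤ κ * (r ^ 2 * (2 + |s|) ^ 2) := by gcongr
  set P := ‖ζ - ⟪n, ζ⟫ • n‖ ^ 2 with hP
  have hP0 : 0 ≤ P := by positivity
  have h6 : α * ‖t • n + r • ζ‖ ≤ α * (t + r * ⟪n, ζ⟫) + r ^ 2 * ((s - 1) ^ 2 * ‖ν - n‖ ^ 2 / t) := by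
    calc α * ‖t • n + r • ζ‖ ≤ α * (t + r * ⟪n, ζ⟫ + r ^ 2 * (P / t)) := by gcongr
      _ = α * (t + r * ⟪n, ζ⟫) + α * (r ^ 2 * (P / t)) := by ring
      _ ≤ α * (t + r * ⟪n, ζ⟫) + 1 * (r ^ 2 * (P / t)) := by gcongr
      _ ≤ α * (t + r * ⟪n, ζ⟫) + 1 * (r ^ 2 * ((s - 1) ^ 2 * ‖ν - n‖ ^ 2 / t)) := by gcongr
      _ = _ := by ring
  have h7 : 0 ≤ A * (r ^ 2 * P) := by positivity
  nlinarith

end PartH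

section PartH2
set_option linter.unusedSectionVars false
variable {E : Type*} [NormedAddCommGroup E] [InnerProductSpace ℝ E] [FiniteDimensional ℝ E] [CompleteSpace E]
  [MeasurableSpace E] [BorelSpace E]

lemma lip_ball {u : E → ℝ} (hu : Differentiable ℝ u) {L R : ℝ} {c : E} (hL : ∀ x ∈ ball c R, ‖gradient u x‖ ≤ L)
    {x y : E} (hx : x ∈ ball c R) (hy : y ∈ ball c R) : |u x - u y| ≤ L * ‖x - y‖ := by
  have := (convex_ball c R).norm_image_sub_le_of_norm_fderiv_le (𝕜 := ℝ) (f := u) (fun z _ => hu z)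
    (fun z hz => by rw [← norm_gradient]; exact hL z hz) hy hx
  simpa [Real.norm_eq_abs] using this

/-- If the gradient at a point is bigger than `α`, find a close point seeing the slope. -/
lemma exists_steep {u : E → ℝ} (hu : Differentiable ℝ u) {x : E} {α : ℝ} (hα : 0 ≤ α) (h : α < ‖gradient u x‖) {δ : ℝ} (hδ : 0 < δ) :
    ∃ y, 0 < ‖x - y‖ ∧ ‖x - y‖ ≤ δ ∧ α * ‖x - y‖ < u x - u y := by
  set G := gradient u x with hG
  have hm : 0 < ‖G‖ := lt_of_le_of_lt hα h
  have hd : HasFDerivAt u (innerSL ℝ G) x := (hu x).hasGradientAt.hasFDerivAt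
  have hd2 := hd.isLittleO.def (c := (‖G‖ - α) / 2) (by linarith)
  rw [Metric.eventually_nhds_iff] at hd2
  obtain ⟨ε, hε, hd3⟩ := hd2
  set t := min δ (ε / 2) with ht
  have ht0 : 0 < t := by positivity
  have htδ : t ≤ δ := min_le_left _ _
  have htε : t ≤ ε / 2 := min_le_right _ _
  set v := (t / ‖G‖) • G with hv
  have hvn : ‖v‖ = t := by
    rw [hv, norm_smul, Real.norm_eq_abs, abs_of_pos (by positivity)]; field_simp
  have e1 : x - (x - v) = v := by abel
  refine ⟨x - v, by rw [e1, hvn]; exact ht0, by rw [e1, hvn]; exact htδ, ?_⟩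
  rw [e1, hvn]
  have h1 := hd3 (y := x - v) (by rw [dist_eq_norm]; simp [hvn]; linarith)
  have e2 : x - v - x = -v := by abel
  rw [e2, norm_neg, hvn, map_neg, innerSL_apply_apply, Real.norm_eq_abs] at h1
  have h2 : ⟪G, v⟫ = t * ‖G‖ := by
    rw [hv, inner_smul_right, real_inner_self_eq_norm_sq]; field_simp
  rw [h2] at h1
  have h3 := (abs_le.mp h1).2
  nlinarith

lemma unit_diff {a b : E} (ha : a ≠ 0) {g : ℝ} (hg : 0 < g) (hb : ‖b‖ = 1) :
    ‖‖a‖⁻¹ • a - b‖ ≤ 2 * ‖a - g • b‖ / g := by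
  have hA : 0 < ‖a‖ := norm_pos_iff.mpr ha
  rw [le_div_iff₀ hg]
  have h1 : g • (‖a‖⁻¹ • a - b) = (a - g • b) + ((g - ‖a‖) * ‖a‖⁻¹) • a := by
    have : a = (‖a‖ * ‖a‖⁻¹) • a := by rw [mul_inv_cancel₀ hA.ne', one_smul]
    nth_rewrite 3 [this]
    module
  have h2 : ‖g • (‖a‖⁻¹ • a - b)‖ = ‖‖a‖⁻¹ • a - b‖ * g := by
    rw [norm_smul, Real.norm_eq_abs, abs_of_pos hg, mul_comm]
  rw [← h2, h1]
  refine (norm_add_le _ _).trans ?_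
  have h3 : ‖((g - ‖a‖) * ‖a‖⁻¹) • a‖ = |g - ‖a‖| := by
    rw [norm_smul, Real.norm_eq_abs, abs_mul, abs_of_pos (inv_pos.mpr hA)]; field_simp
  have h4 : |g - ‖a‖| ≤ ‖a - g • b‖ := by
    have := abs_norm_sub_norm_le a (g • b)
    rw [norm_smul, hb, mul_one, Real.norm_eq_abs, abs_of_pos hg, abs_sub_comm] at this
    exact this
  rw [h3]; linarith

lemma exists_max_two {Ψ : E → E → ℝ} (hΨ : Continuous (fun q : E × E => Ψ q.1 q.2)) {D : Set (E × E)} (hD : IsCompact D)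
    {x₀ y₀ : E} (h0 : (x₀, y₀) ∈ D) : ∃ x y, (x, y) ∈ D ∧ ∀ q ∈ D, Ψ q.1 q.2 ≤ Ψ x y := by
  obtain ⟨q, hq, hmax⟩ := hD.exists_isMaxOn ⟨_, h0⟩ hΨ.continuousOn
  exact ⟨q.1, q.2, hq, fun q' hq' => hmax hq'⟩

lemma compact_D (a b : E) (R h : ℝ) : IsCompact {q : E × E | ‖q.1 - a‖ ≤ R ∧ ‖q.1 - q.2 - b‖ ≤ h} := by
  refine Metric.isCompact_of_isClosed_isBounded ?_ ?_
  · have h1 : IsClosed {q : E × E | ‖q.1 - a‖ ≤ R} := isClosed_le (by fun_prop) (by fun_prop)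
    have h2 : IsClosed {q : E × E | ‖q.1 - q.2 - b‖ ≤ h} := isClosed_le (by fun_prop) (by fun_prop)
    exact h1.inter h2
  · refine (Metric.isBounded_closedBall (x := (0 : E × E)) (r := |R| + |h| + ‖a‖ + ‖b‖)).subset ?_
    rintro ⟨x, y⟩ ⟨h1, h2⟩
    simp only at h1 h2
    rw [mem_closedBall_zero_iff, Prod.norm_def]
    have h3 := norm_sub_norm_le x a
    have h4 := norm_sub_le x a
    have h5 : ‖y‖ ≤ ‖x‖ + ‖x - y - b‖ + ‖b‖ := by
      have e : y = x - (x - y - b) - b := by abel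
      calc ‖y‖ = ‖x - (x - y - b) - b‖ := by rw [← e]
        _ ≤ ‖x - (x - y - b)‖ + ‖b‖ := norm_sub_le _ _
        _ ≤ _ := by gcongr; exact norm_sub_le _ _
    have := le_abs_self R
    have := le_abs_self h
    have := abs_nonneg h
    have := norm_nonneg b
    refine max_le (by simp only; linarith) (by simp only; linarith)

lemma open_D (a b : E) (R h : ℝ) {x y : E} (h1 : ‖x - a‖ < R) (h2 : ‖x - y - b‖ < h) :
    ∀ᶠ q : E × E in nhds (x, y), ‖q.1 - a‖ < R ∧ ‖q.1 - q.2 - b‖ < h := by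
  have h3 : IsOpen {q : E × E | ‖q.1 - a‖ < R} := isOpen_lt (by fun_prop) (by fun_prop)
  have h4 : IsOpen {q : E × E | ‖q.1 - q.2 - b‖ < h} := isOpen_lt (by fun_prop) (by fun_prop)
  exact (h3.inter h4).mem_nhds ⟨h1, h2⟩

set_option maxHeartbeats 2000000 in
lemma IL (p : ℝ) (hp : 1 < p) (L : ℝ) (hL1 : 1 ≤ L) : ∃ c₀ > 0, ∀ (u : E → ℝ) (α A h κ : ℝ), PH p u →
    (∀ x ∈ ball (0:E) 2, ‖gradient u x‖ ≤ L) → 1/2 ≤ α → α ≤ 1 → 0 < A → 0 < h → h ≤ 1/2 → A * h ≤ 1/8 →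
    0 < κ → κ ≤ c₀ * A → κ ≤ c₀ →
    (∀ x y : E, ‖x‖ ≤ 1 → ‖x - y‖ = h → u x - u y ≤ α * h - A * h ^ 2) →
    (∀ x y : E, ‖x‖ = 1 → ‖x - y‖ ≤ h → u x - u y - (α * ‖x - y‖ - A * ‖x - y‖ ^ 2) ≤ κ) →
    ‖gradient u 0‖ ≤ α := by
  obtain ⟨m, hm, hm2⟩ := exists_m2 (E := E)
  set J := ∫ z : E, qq z ^ 3 with hJ
  have hJp : 0 < J := integral_qq_pos
  set s := Real.sqrt (p - 1) with hs
  have hs0 : 0 < s := Real.sqrt_pos.mpr (by linarith)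
  have hs2 : s ^ 2 = p - 1 := Real.sq_sqrt (by linarith)
  set C₁ := 256 * (s - 1) ^ 2 * L + (2 + |s|) ^ 2 + 256 * (s - 1) ^ 2 with hC₁
  have hC₁p : 0 < C₁ := by positivity
  set c₀ := min (1/16) (s ^ 2 * m / (C₁ * J)) with hc₀
  have hc₀p : 0 < c₀ := by positivity
  have hc₁ : c₀ ≤ 1/16 := min_le_left _ _
  have hc₂ : c₀ * (C₁ * J) ≤ s ^ 2 * m := by
    rw [← le_div_iff₀ (by positivity)]; exact min_le_right _ _
  refine ⟨c₀, hc₀p, ?_⟩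
  intro u α A h κ hu hL hα hα1 hA hh hh2 hAh hκ hκA hκc H1 H2
  by_contra hcon
  push Not at hcon
  have huc := hu.diff.continuous
  obtain ⟨y₀, hy1, hy2, hy3⟩ := exists_steep hu.diff (by linarith) hcon hh
  rw [zero_sub, norm_neg] at hy1 hy2 hy3
  set D : Set (E × E) := {q | ‖q.1‖ ≤ 1 ∧ ‖q.1 - q.2‖ ≤ h} with hD
  have hDc : IsCompact D := by
    have := compact_D (0:E) 0 1 h
    simpa only [sub_zero] using this
  obtain ⟨x, y, hxy, hmax⟩ := exists_max_two (Ψ := fun x y => u x - u y - (α * ‖x - y‖ - A * ‖x - y‖ ^ 2 + κ * ‖x‖ ^ 2))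
    (by fun_prop) hDc (x₀ := 0) (y₀ := y₀) (by simp [hD]; exact hy2)
  obtain ⟨hx1, hxyh⟩ := hxy
  simp only at hx1 hxyh hmax
  have hpos : 0 < u x - u y - (α * ‖x - y‖ - A * ‖x - y‖ ^ 2 + κ * ‖x‖ ^ 2) := by
    have h1 := hmax (0, y₀) (by simp [hD]; exact hy2)
    simp only [zero_sub, norm_neg, norm_zero] at h1
    have : 0 < A * ‖y₀‖ ^ 2 := by positivity
    linarith
  set t := ‖x - y‖ with ht
  have hκx : 0 ≤ κ * ‖x‖ ^ 2 := by positivity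
  have ht0 : 0 < t := by
    rcases (norm_nonneg (x - y)).lt_or_eq with h1 | h1
    · exact h1
    · rw [← ht] at h1
      have h2 : x = y := by rw [eq_comm, ht, norm_eq_zero, sub_eq_zero] at h1; exact h1
      rw [← h1, h2] at hpos
      have : 0 ≤ κ * ‖y‖ ^ 2 := by positivity
      simp at hpos
      linarith
  have hth : t < h := by
    refine lt_of_le_of_ne hxyh fun h1 => ?_
    have := H1 x y hx1 h1
    rw [h1] at hpos
    linarith
  have hx1' : ‖x‖ < 1 := by
    refine lt_of_le_of_ne hx1 fun h1 => ?_
    have := H2 x y h1 hxyh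
    rw [h1] at hpos
    linarith
  -- local max
  have hloc : ∀ᶠ q in nhds (x, y), u q.1 - u q.2 - (α * ‖q.1 - q.2‖ - A * ‖q.1 - q.2‖ ^ 2 + κ * ‖q.1‖ ^ 2)
      ≤ u x - u y - (α * ‖x - y‖ - A * ‖x - y‖ ^ 2 + κ * ‖x‖ ^ 2) := by
    have h1 : ∀ᶠ q : E × E in nhds (x, y), ‖q.1‖ < 1 ∧ ‖q.1 - q.2‖ < h := by
      have := open_D (0:E) 0 1 h (x := x) (y := y) (by simpa using hx1') (by rw [sub_zero]; exact hth)
      simpa only [sub_zero] using this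
    filter_upwards [h1] with q hq
    exact hmax q ⟨hq.1.le, hq.2.le⟩
  set n := t⁻¹ • (x - y) with hn
  have hn1 : ‖n‖ = 1 := by
    rw [hn, norm_smul, Real.norm_eq_abs, abs_of_pos (by positivity), ← ht]; field_simp
  have hxyn : x - y = t • n := by rw [hn, smul_smul, mul_inv_cancel₀ ht0.ne', one_smul]
  set γ := α / (2 * t) - A with hγ
  have hAM : ∀ τ : ℝ, α * τ - A * τ ^ 2 ≤ α * t / 2 + γ * τ ^ 2 := by
    intro τ
    have : α * t / 2 + γ * τ ^ 2 - (α * τ - A * τ ^ 2) = α / (2 * t) * (t - τ) ^ 2 := by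
      rw [hγ]; field_simp; ring
    have h2 : 0 ≤ α / (2 * t) * (t - τ) ^ 2 := by positivity
    linarith
  have hAMt : α * t - A * t ^ 2 = α * t / 2 + γ * t ^ 2 := by
    rw [hγ]; field_simp; ring
  set g := α - 2 * A * t with hg
  have hAt : A * t ≤ A * h := mul_le_mul_of_nonneg_left hth.le hA.le
  have hg14 : 1/4 ≤ g := by rw [hg]; linarith
  have hgγ : 2 * γ * t = g := by rw [hγ, hg]; field_simp
  have hgx : gradient u x = g • n + (2 * κ) • x := by
    refine gradient_of_max hu.diff (f := fun w => γ * ‖w - y‖ ^ 2 + κ * ‖w - 0‖ ^ 2) ?_ ?_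
    · have := (hasFDerivAt_normsq γ y x).add (hasFDerivAt_normsq κ 0 x)
      rw [← map_add, hxyn, sub_zero, smul_smul, hgγ] at this
      exact this
    · have h1 : Filter.Tendsto (fun w : E => (w, y)) (nhds x) (nhds (x, y)) := (Continuous.prodMk_left y).tendsto x
      filter_upwards [h1.eventually hloc] with w hw
      simp only [sub_zero] at hw ⊢
      have h2 := hAM ‖w - y‖
      rw [← ht] at hw ⊢
      linarith
  have hgy : gradient u y = g • n := by
    have h3 : gradient (fun w => -1 * (u (0 + (1:ℝ) • w) - 0)) y = (2 * γ) • (y - x) := by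
      refine gradient_of_max (by have := hu.diff; fun_prop) (f := fun w => γ * ‖w - x‖ ^ 2) (hasFDerivAt_normsq γ x y) ?_
      have h1 : Filter.Tendsto (fun w : E => (x, w)) (nhds y) (nhds (x, y)) := (Continuous.prodMk_right x).tendsto y
      filter_upwards [h1.eventually hloc] with w hw
      simp only [zero_add, one_smul, sub_zero] at hw ⊢
      have h2 := hAM ‖x - w‖
      rw [norm_sub_rev w x, norm_sub_rev y x]
      rw [← ht] at hw ⊢
      linarith
    rw [gradient_rescale hu.diff] at h3
    simp only [zero_add, one_smul, mul_one, neg_smul] at h3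
    rw [← neg_sub x y, hxyn, smul_neg, neg_inj, smul_smul, hgγ] at h3
    exact h3
  have hgxn : ‖gradient u x - g • n‖ ≤ 2 * κ * ‖x‖ := by
    rw [hgx, add_sub_cancel_left, norm_smul, Real.norm_eq_abs, abs_of_pos (by positivity)]
  have hgne : gradient u x ≠ 0 := by
    intro h1
    rw [h1, zero_sub, norm_neg, norm_smul, hn1, Real.norm_eq_abs, abs_of_pos (by linarith)] at hgxn
    have hk : 2 * κ * ‖x‖ ≤ 2 * κ * 1 := by gcongr
    linarith
  set ν := ‖gradient u x‖⁻¹ • gradient u x with hν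
  have hmpos : 0 < ‖gradient u x‖ := norm_pos_iff.mpr hgne
  have hν1 : ‖ν‖ = 1 := by
    rw [hν, norm_smul, Real.norm_eq_abs, abs_of_pos (by positivity)]; field_simp
  have hβ : ‖ν - n‖ ≤ 16 * κ * ‖x‖ := by
    have h1 := unit_diff hgne (by linarith : 0 < g) hn1
    rw [← hν, le_div_iff₀ (by linarith)] at h1
    have hk : ‖ν - n‖ * (1/4) ≤ ‖ν - n‖ * g := by gcongr
    linarith
  have hynorm : ‖y‖ < 3/2 := by
    have := norm_sub_norm_le y x
    rw [norm_sub_rev] at this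
    linarith
  have hκt : κ * ‖x‖ ^ 2 ≤ L * t := by
    have h1 := lip_ball hu.diff hL (x := x) (y := y) (by simp; linarith) (by simp; linarith)
    rw [← ht] at h1
    have h2 := le_abs_self (u x - u y)
    have h3 : 0 ≤ t * (α - A * t) := mul_nonneg ht0.le (by linarith)
    linarith
  have hβt : ‖ν - n‖ ^ 2 / t ≤ 256 * κ * L := by
    rw [div_le_iff₀ ht0]
    calc ‖ν - n‖ ^ 2 ≤ (16 * κ * ‖x‖) ^ 2 := by gcongr
      _ = 256 * κ * (κ * ‖x‖ ^ 2) := by ring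
      _ ≤ 256 * κ * (L * t) := by gcongr
      _ = _ := by ring
  have hβκ : ‖ν - n‖ ^ 2 ≤ 256 * κ := by
    calc ‖ν - n‖ ^ 2 ≤ (16 * κ * ‖x‖) ^ 2 := by gcongr
      _ ≤ (16 * κ * 1) ^ 2 := by gcongr
      _ = 256 * κ * κ := by ring
      _ ≤ 256 * κ * 1 := by gcongr; linarith
      _ = _ := by ring
  have hyx : y = x - t • n := by rw [← hxyn]; abel
  have key := two_point p hp s (-s) hs2 (by rw [neg_sq, hs2]) hu (x := x) (y := y) (ρ := 1/2) (L := L) (by norm_num)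
    (fun q hq => hL q (by
      rw [mem_ball, dist_eq_norm] at hq
      rw [mem_ball_zero_iff]
      have := norm_sub_norm_le q x
      linarith))
    (fun q hq => hL q (by
      rw [mem_ball, dist_eq_norm] at hq
      rw [mem_ball_zero_iff]
      have := norm_sub_norm_le q y
      linarith)) hmpos (by linarith : 0 < g) hν1 hn1
      (by rw [hν, smul_smul, mul_inv_cancel₀ hmpos.ne', one_smul]) hgy
      (fun x y => α * ‖x - y‖ - A * ‖x - y‖ ^ 2 + κ * ‖x‖ ^ 2) hloc
      (fun z => (α - 2 * A * t) * ⟪n, TT ν s z - TT n (-s) z⟫ + 2 * κ * ⟪x, TT ν s z⟫) (by fun_prop)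
      (fun z => by
        have e1 : TT ν s (-z) - TT n (-s) (-z) = -(TT ν s z - TT n (-s) z) := by rw [map_neg, map_neg]; abel
        rw [e1, map_neg, inner_neg_right, inner_neg_right]; ring)
      (fun z => (((s - 1) ^ 2 * ‖ν - n‖ ^ 2 / t + κ * (2 + |s|) ^ 2) - A * ⟪n, TT ν s z - TT n (-s) z⟫ ^ 2))
      (by fun_prop) 0 (by
        have h4 : ∀ᶠ r in nhdsWithin (0:ℝ) (Set.Ioi 0), r < (t / 2) / (2 * (2 + |s|)) :=
          nhdsWithin_le_nhds (gt_mem_nhds (by positivity))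
        filter_upwards [h4, self_mem_nhdsWithin] with r hr1 hr0 z hz
        rw [lt_div_iff₀ (by positivity)] at hr1
        have := IL_quad (x := x) hn1 hν1 (s := s) hz ht0 hr0 (by linarith : 0 ≤ α) hα1 hA.le hκ.le hr1.le
        rw [← hyx] at this
        linarith)
  -- the integral is negative
  have hB : (s - 1) ^ 2 * ‖ν - n‖ ^ 2 / t + κ * (2 + |s|) ^ 2 ≤ κ * (256 * (s - 1) ^ 2 * L + (2 + |s|) ^ 2) := by
    have : (s - 1) ^ 2 * (‖ν - n‖ ^ 2 / t) ≤ (s - 1) ^ 2 * (256 * κ * L) := by gcongr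
    rw [mul_div_assoc]
    linarith
  have i1 : Integrable (fun z : E => qq z ^ 3 * (((s - 1) ^ 2 * ‖ν - n‖ ^ 2 / t + κ * (2 + |s|) ^ 2) - A * ⟪n, TT ν s z - TT n (-s) z⟫ ^ 2)) :=
    integrable_qq_mul (by fun_prop) 2
  have i2 : Integrable (fun z : E => qq z ^ 3 * ⟪n, z⟫ ^ 2) := integrable_qq_mul (by fun_prop) 2
  set B := κ * (256 * (s - 1) ^ 2 * L + (2 + |s|) ^ 2) + A * ((s - 1) ^ 2 * (256 * κ)) with hBdef
  have hle : ∫ z : E, qq z ^ 3 * (((s - 1) ^ 2 * ‖ν - n‖ ^ 2 / t + κ * (2 + |s|) ^ 2) - A * ⟪n, TT ν s z - TT n (-s) z⟫ ^ 2)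
      ≤ ∫ z : E, (B * qq z ^ 3 - (A * (2 * s ^ 2)) * (qq z ^ 3 * ⟪n, z⟫ ^ 2)) := by
    refine integral_mono i1 (((integrable_qq 2).const_mul _).sub (i2.const_mul _)) fun z => ?_
    simp only
    by_cases hz : ‖z‖ ≤ 1
    · have h1 := coupling_inner hn1 hν1 s hz
      have h2 : 0 ≤ qq z ^ 3 := pow_nonneg (qq_nonneg z) _
      have h3 : (s - 1) ^ 2 * ‖ν - n‖ ^ 2 ≤ (s - 1) ^ 2 * (256 * κ) := by gcongr
      have h4 : A * (2 * s ^ 2 * ⟪n, z⟫ ^ 2 - (s - 1) ^ 2 * (256 * κ)) ≤ A * ⟪n, TT ν s z - TT n (-s) z⟫ ^ 2 := by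
        gcongr
        linarith
      have h5 : ((s - 1) ^ 2 * ‖ν - n‖ ^ 2 / t + κ * (2 + |s|) ^ 2) - A * ⟪n, TT ν s z - TT n (-s) z⟫ ^ 2 ≤
        B - A * (2 * s ^ 2 * ⟪n, z⟫ ^ 2) := by rw [hBdef]; linarith
      have := mul_le_mul_of_nonneg_left h5 h2
      linarith
    · simp [qq_eq_zero (le_of_not_ge hz)]
  rw [integral_sub ((integrable_qq 2).const_mul _) (i2.const_mul _), integral_const_mul, integral_const_mul] at hle
  have h1 := hm2 n
  rw [hn1] at h1
  have h2 : B * J ≤ A * (s ^ 2 * m) := by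
    have h3 : B ≤ (c₀ * A) * C₁ := by
      rw [hBdef, hC₁]
      have h4 : κ * (256 * (s - 1) ^ 2 * L + (2 + |s|) ^ 2) ≤ (c₀ * A) * (256 * (s - 1) ^ 2 * L + (2 + |s|) ^ 2) := by gcongr
      have h5 : A * ((s - 1) ^ 2 * (256 * κ)) ≤ A * ((s - 1) ^ 2 * (256 * c₀)) := by gcongr
      linarith
    calc B * J ≤ ((c₀ * A) * C₁) * J := by gcongr
      _ = A * (c₀ * (C₁ * J)) := by ring
      _ ≤ _ := by gcongr
  have h3 : A * (2 * s ^ 2) * (m * 1 ^ 2) ≤ A * (2 * s ^ 2) * ∫ z : E, qq z ^ 3 * ⟪n, z⟫ ^ 2 := by gcongr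
  have h4 : 0 < A * (s ^ 2 * m) := by positivity
  linarith

end PartH2

section PartI
set_option linter.unusedSectionVars false
variable {E : Type*} [NormedAddCommGroup E] [InnerProductSpace ℝ E] [FiniteDimensional ℝ E] [CompleteSpace E]
  [MeasurableSpace E] [BorelSpace E]

lemma small_osc (p : ℝ) (hp : 1 < p) : ∃ ω > 0, ∀ u : E → ℝ, PH p u → (∀ x ∈ ball (0:E) 2, ‖gradient u x‖ ≤ 4) →
    (∀ x ∈ ball (0:E) 2, ∀ y ∈ ball (0:E) 2, u x - u y ≤ ω) → ‖gradient u 0‖ ≤ 1/2 := by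
  obtain ⟨c₀, hc, hIL⟩ := IL (E := E) p hp 4 (by norm_num)
  refine ⟨min (c₀ / 4) (3/16), by positivity, fun u hu hL hosc => ?_⟩
  have hω1 : min (c₀ / 4) (3/16 : ℝ) ≤ c₀ / 4 := min_le_left _ _
  have hω2 : min (c₀ / 4) (3/16 : ℝ) ≤ 3/16 := min_le_right _ _
  have hmem : ∀ x y : E, ‖x‖ ≤ 1 → ‖x - y‖ ≤ 1/2 → u x - u y ≤ min (c₀ / 4) (3/16) := by
    intro x y hx hxy
    refine hosc x (by rw [mem_ball_zero_iff]; linarith) y ?_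
    rw [mem_ball_zero_iff]
    have := norm_sub_norm_le y x
    rw [norm_sub_rev] at this
    linarith
  refine hIL u (1/2) (1/4) (1/2) (c₀ / 4) hu hL (by norm_num) (by norm_num) (by norm_num) (by norm_num) (by norm_num)
    (by norm_num) (by positivity) (by linarith) (by linarith) ?_ ?_
  · intro x y hx hxy
    have := hmem x y hx hxy.le
    norm_num at this ⊢
    linarith
  · intro x y hx hxy
    have := hmem x y hx.le hxy
    have h2 : 0 ≤ ‖x - y‖ := norm_nonneg _
    nlinarith

lemma exists_near_max {S : Set E} {f : E → ℝ} {B : ℝ} (hB : ∀ x ∈ S, f x ≤ B) {x₀ : E} (hx₀ : x₀ ∈ S) (h0 : 0 < f x₀) :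
    ∃ x₁ ∈ S, f x₀ ≤ 2 * f x₁ ∧ 0 < f x₁ ∧ ∀ x ∈ S, f x ≤ 2 * f x₁ := by
  have hbdd : BddAbove (f '' S) := ⟨B, by rintro _ ⟨x, hx, rfl⟩; exact hB x hx⟩
  have h1 : f x₀ ≤ sSup (f '' S) := le_csSup hbdd ⟨x₀, hx₀, rfl⟩
  have hlt : sSup (f '' S) / 2 < sSup (f '' S) := by linarith
  obtain ⟨_, ⟨x₁, hx₁, rfl⟩, h2⟩ := exists_lt_of_lt_csSup (s := f '' S) ⟨_, x₀, hx₀, rfl⟩ hlt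
  refine ⟨x₁, hx₁, by linarith, by linarith, fun x hx => ?_⟩
  have := le_csSup hbdd ⟨x, hx, rfl⟩
  linarith

lemma apriori (p : ℝ) (hp : 1 < p) : ∃ C > 0, ∀ (u : E → ℝ) (x₀ : E) (R M Λ : ℝ), PH p u → 0 < R →
    (∀ x ∈ ball x₀ R, ‖gradient u x‖ ≤ Λ) → (∀ x ∈ ball x₀ R, |u x - u x₀| ≤ M) → ‖gradient u x₀‖ ≤ C * M / R := by
  obtain ⟨ω, hω, hosc⟩ := small_osc (E := E) p hp
  refine ⟨16 / ω, by positivity, fun u x₀ R M Λ hu hR hΛ hM => ?_⟩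
  by_contra hcon
  push Not at hcon
  have hM0 : 0 ≤ M := (abs_nonneg _).trans (hM x₀ (mem_ball_self hR))
  rw [div_lt_iff₀ hR] at hcon
  set f : E → ℝ := fun x => (R - ‖x - x₀‖) * ‖gradient u x‖ with hf
  have hΛ0 : 0 ≤ Λ := (norm_nonneg _).trans (hΛ x₀ (mem_ball_self hR))
  have hfx₀ : f x₀ = ‖gradient u x₀‖ * R := by simp [hf, mul_comm]
  have hf0 : 0 < f x₀ := by rw [hfx₀]; refine lt_of_le_of_lt ?_ hcon; positivity
  obtain ⟨x₁, hx₁, h1, h2, h3⟩ := exists_near_max (S := ball x₀ R) (f := f) (B := R * Λ) (by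
    intro x hx
    have h1 : R - ‖x - x₀‖ ≤ R := by linarith [norm_nonneg (x - x₀)]
    exact mul_le_mul h1 (hΛ x hx) (norm_nonneg _) hR.le) (mem_ball_self hR) hf0
  set σ := R - ‖x₁ - x₀‖ with hσ
  have hσ0 : 0 < σ := by rw [mem_ball, dist_eq_norm] at hx₁; linarith
  set G := ‖gradient u x₁‖ with hG
  have hfx1 : f x₁ = σ * G := rfl
  have hG0 : 0 < G := by rw [hfx1] at h2; exact pos_of_mul_pos_right h2 hσ0.le
  have hin : ∀ x ∈ ball (0:E) 2, x₁ + (σ/4) • x ∈ ball x₀ R ∧ σ/2 ≤ R - ‖x₁ + (σ/4) • x - x₀‖ := by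
    intro x hx
    rw [mem_ball_zero_iff] at hx
    have h4 : ‖x₁ + (σ/4) • x - x₀‖ ≤ ‖x₁ - x₀‖ + σ/4 * ‖x‖ := by
      have e : x₁ + (σ/4) • x - x₀ = (x₁ - x₀) + (σ/4) • x := by abel
      rw [e]
      refine (norm_add_le _ _).trans (le_of_eq ?_)
      rw [norm_smul, Real.norm_eq_abs, abs_of_pos (by positivity)]
    have h5 : σ/4 * ‖x‖ ≤ σ/4 * 2 := by gcongr
    refine ⟨?_, by linarith⟩
    rw [mem_ball, dist_eq_norm]; linarith
  have hfin := hosc (fun x => (G * (σ/4))⁻¹ * (u (x₁ + (σ/4) • x) - u x₁)) (hu.rescale x₁ (by positivity) (by positivity) _) (by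
    intro x hx
    obtain ⟨h4, h5⟩ := hin x hx
    have e : (G * (σ/4))⁻¹ * (σ/4) = G⁻¹ := by field_simp
    rw [gradient_rescale hu.diff, e, norm_smul, Real.norm_eq_abs, abs_of_pos (by positivity), inv_mul_le_iff₀ hG0]
    have h6 := h3 _ h4
    rw [hfx1] at h6
    simp only [hf] at h6
    have h7 : σ/2 * ‖gradient u (x₁ + (σ/4) • x)‖ ≤ 2 * (σ * G) := (mul_le_mul_of_nonneg_right h5 (norm_nonneg _)).trans h6
    nlinarith) (by
    intro x hx y hy
    have h4 := abs_le.mp (hM _ (hin x hx).1)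
    have h5 := abs_le.mp (hM _ (hin y hy).1)
    rw [← mul_sub, inv_mul_le_iff₀ (by positivity)]
    have h6 : 16 / ω * M < 2 * (σ * G) := by rw [← hfx1]; linarith
    rw [div_mul_eq_mul_div, div_lt_iff₀ hω] at h6
    nlinarith)
  have e : (G * (σ/4))⁻¹ * (σ/4) = G⁻¹ := by field_simp
  rw [gradient_rescale hu.diff, e, smul_zero, add_zero, norm_smul, Real.norm_eq_abs, abs_of_pos (by positivity), ← hG,
    inv_mul_cancel₀ hG0.ne'] at hfin
  norm_num at hfin

lemma bdd_of_compact {u : E → ℝ} {S : Set E} (hS : IsCompact S)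
    (h : ∀ x ∈ S, ∃ ρ > 0, ∃ L, ∀ y ∈ ball x ρ, ‖gradient u y‖ ≤ L) : ∃ L, ∀ y ∈ S, ‖gradient u y‖ ≤ L := by
  refine hS.induction_on (p := fun s => ∃ L, ∀ y ∈ s, ‖gradient u y‖ ≤ L) ⟨0, by simp⟩ ?_ ?_ ?_
  · rintro s t hst ⟨L, hL⟩
    exact ⟨L, fun y hy => hL y (hst hy)⟩
  · rintro s t ⟨L, hL⟩ ⟨L', hL'⟩
    refine ⟨max L L', ?_⟩
    rintro y (hy | hy)
    · exact (hL y hy).trans (le_max_left _ _)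
    · exact (hL' y hy).trans (le_max_right _ _)
  · intro x hx
    obtain ⟨ρ, hρ, L, hL⟩ := h x hx
    exact ⟨ball x ρ, mem_nhdsWithin_of_mem_nhds (ball_mem_nhds x hρ), L, hL⟩

lemma gradient_le_of_lip {u : E → ℝ} (hu : Differentiable ℝ u) {x : E} {m η : ℝ} (hm : 0 ≤ m) (hη : 0 < η)
    (h : ∀ v : E, ‖v‖ ≤ η → |u (x + v) - u x| ≤ m * ‖v‖) : ‖gradient u x‖ ≤ m := by
  by_contra hcon
  push Not at hcon
  obtain ⟨y, h1, h2, h3⟩ := exists_steep hu hm hcon hη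
  have h4 := h (y - x) (by rw [norm_sub_rev]; exact h2)
  rw [add_sub_cancel, norm_sub_rev, abs_sub_comm] at h4
  have := le_abs_self (u x - u y)
  linarith

set_option maxHeartbeats 1000000 in
lemma locBdd {p : ℝ} (hp : 1 < p) {u : E → ℝ} (hu : PH p u) (x : E) : ∃ ρ > 0, ∃ L, ∀ y ∈ ball x ρ, ‖gradient u y‖ ≤ L := by
  obtain ⟨C, hC, hap⟩ := apriori (E := E) p hp
  set K : Set E := {x | ¬ ∃ ρ > 0, ∃ L, ∀ y ∈ ball x ρ, ‖gradient u y‖ ≤ L} with hK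
  have hKc : IsClosed K := by
    rw [← isOpen_compl_iff, Metric.isOpen_iff]
    intro x hx
    simp only [hK, Set.mem_compl_iff, Set.mem_setOf_eq, not_not] at hx
    obtain ⟨ρ, hρ, L, hL⟩ := hx
    refine ⟨ρ, hρ, fun y hy => ?_⟩
    simp only [hK, Set.mem_compl_iff, Set.mem_setOf_eq, not_not]
    obtain ⟨ε, hε, hsub⟩ := Metric.isOpen_iff.mp isOpen_ball y hy
    exact ⟨ε, hε, L, fun z hz => hL z (hsub hz)⟩
  by_contra hx
  have hxK : x ∈ K := hx
  have huc := hu.diff.continuous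
  haveI : CompleteSpace K := hKc.completeSpace_coe
  haveI : Nonempty K := ⟨⟨x, hxK⟩⟩
  set f : ℕ → Set K := fun m => {x | ∀ v : E, ‖v‖ ≤ 1 / ((m:ℝ) + 1) → |u (x + v) - u x| ≤ m * ‖v‖} with hf
  obtain ⟨m, hm⟩ := nonempty_interior_of_iUnion_of_closed (f := f) (by
      intro m
      simp only [hf, Set.setOf_forall]
      refine isClosed_iInter fun v => isClosed_iInter fun hv => ?_
      exact isClosed_le (by fun_prop) (by fun_prop)) (by
      rw [Set.eq_univ_iff_forall]
      rintro ⟨y, hy⟩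
      have hd : HasFDerivAt u (innerSL ℝ (gradient u y)) y := (hu.diff y).hasGradientAt.hasFDerivAt
      have hd2 := hd.isLittleO.def (c := 1) one_pos
      rw [Metric.eventually_nhds_iff] at hd2
      obtain ⟨ε, hε, hd3⟩ := hd2
      obtain ⟨m, hm⟩ := exists_nat_gt (max (1/ε) (‖gradient u y‖ + 1))
      have hm1 := (le_max_left _ _).trans_lt hm
      have hm2 := (le_max_right _ _).trans_lt hm
      rw [Set.mem_iUnion]
      refine ⟨m, fun v hv => ?_⟩
      simp only
      have hvε : ‖v‖ < ε := by
        refine lt_of_le_of_lt hv ?_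
        rw [div_lt_iff₀ (by positivity)]
        rw [div_lt_iff₀ hε] at hm1
        nlinarith
      have h1 := hd3 (y := y + v) (by rw [dist_eq_norm, add_sub_cancel_left]; exact hvε)
      rw [add_sub_cancel_left, one_mul, innerSL_apply_apply, Real.norm_eq_abs] at h1
      have h2 := abs_real_inner_le_norm (gradient u y) v
      have h3 : |u (y + v) - u y| ≤ |u (y + v) - u y - ⟪gradient u y, v⟫| + |⟪gradient u y, v⟫| := by
        have := abs_add_le (u (y + v) - u y - ⟪gradient u y, v⟫) ⟪gradient u y, v⟫
        rwa [sub_add_cancel] at this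
      nlinarith [norm_nonneg v])
  obtain ⟨⟨x₀, hx₀⟩, hIntg⟩ := hm
  rw [mem_interior_iff_mem_nhds, Metric.mem_nhds_iff] at hIntg
  obtain ⟨ε, hε, hball⟩ := hIntg
  set η : ℝ := 1 / ((m:ℝ) + 1) with hη
  have hη0 : 0 < η := by positivity
  have hlip : ∀ y ∈ K, ‖y - x₀‖ < ε → ∀ v : E, ‖v‖ ≤ η → |u (y + v) - u y| ≤ m * ‖v‖ := by
    intro y hy hyε
    have : (⟨y, hy⟩ : K) ∈ f m := hball (by
      rw [mem_ball, Subtype.dist_eq, dist_eq_norm]; exact hyε)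
    exact this
  set r := min ε η / 4 with hr
  have hr0 : 0 < r := by positivity
  have hrε : r ≤ ε / 4 := by rw [hr]; gcongr; exact min_le_left _ _
  have hrη : r ≤ η / 4 := by rw [hr]; gcongr; exact min_le_right _ _
  refine hx₀ ⟨r, hr0, m + 5 * C * m, fun y hy => ?_⟩
  rw [mem_ball, dist_eq_norm] at hy
  have hm0 : (0:ℝ) ≤ m := Nat.cast_nonneg m
  by_cases hyK : y ∈ K
  · have := gradient_le_of_lip hu.diff hm0 hη0 (hlip y hyK (by linarith))
    have : 0 ≤ 5 * C * m := by positivity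
    linarith
  · obtain ⟨k, hk, hkd⟩ := hKc.exists_infDist_eq_dist ⟨x₀, hx₀⟩ y
    set d := Metric.infDist y K with hd
    have hd0 : 0 < d := by
      rw [hd, ← hKc.notMem_iff_infDist_pos ⟨x₀, hx₀⟩]; exact hyK
    have hdr : d < r := by
      refine lt_of_le_of_lt (Metric.infDist_le_dist_of_mem hx₀) ?_
      rw [dist_eq_norm]; exact hy
    rw [dist_eq_norm] at hkd
    have hkx : ‖k - x₀‖ < ε := by
      have h1 : ‖k - x₀‖ ≤ ‖k - y‖ + ‖y - x₀‖ := norm_sub_le_norm_sub_add_norm_sub _ _ _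
      rw [norm_sub_rev k y] at h1
      linarith
    have hkl := hlip k hk hkx
    have hbd : ∃ Λ, ∀ z ∈ closedBall y (d/2), ‖gradient u z‖ ≤ Λ := by
      refine bdd_of_compact (isCompact_closedBall y (d/2)) fun z hz => ?_
      have hzK : z ∉ K := by
        intro hzK
        have h1 := Metric.infDist_le_dist_of_mem (x := y) hzK
        rw [mem_closedBall, dist_comm] at hz
        linarith
      simpa only [hK, Set.mem_setOf_eq, not_not] using hzK
    obtain ⟨Λ, hΛ⟩ := hbd
    have h1 := hap u y (d/2) (5/2 * m * d) Λ hu (by positivity) (fun z hz => hΛ z (ball_subset_closedBall hz)) (by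
      intro z hz
      rw [mem_ball, dist_eq_norm] at hz
      have hzk : ‖z - k‖ ≤ 3/2 * d := by
        have h1 : ‖z - k‖ ≤ ‖z - y‖ + ‖y - k‖ := norm_sub_le_norm_sub_add_norm_sub _ _ _
        linarith
      have h2 := hkl (z - k) (by linarith)
      have h3 := hkl (y - k) (by linarith)
      rw [add_sub_cancel] at h2 h3
      have h4 : |u z - u y| ≤ |u z - u k| + |u y - u k| := by
        have := abs_sub (u z - u k) (u y - u k)
        rwa [sub_sub_sub_cancel_right] at this
      have h5 : m * ‖z - k‖ ≤ m * (3/2 * d) := by gcongr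
      have h6 : m * ‖y - k‖ = m * d := by rw [hkd]
      linarith)
    have e : C * (5/2 * m * d) / (d/2) = 5 * C * m := by field_simp
    rw [e] at h1
    linarith

lemma bdd_ball {p : ℝ} (hp : 1 < p) {u : E → ℝ} (hu : PH p u) (x : E) (R : ℝ) : ∃ L, ∀ y ∈ ball x R, ‖gradient u y‖ ≤ L := by
  obtain ⟨L, hL⟩ := bdd_of_compact (isCompact_closedBall x R) (fun z _ => locBdd hp hu z)
  exact ⟨L, fun y hy => hL y (ball_subset_closedBall hy)⟩

lemma global_bdd {p : ℝ} (hp : 1 < p) {u : E → ℝ} (hu : PH p u) {C : ℝ} (hg : ∀ x, |u x| ≤ C * (1 + ‖x‖)) :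
    ∃ L, ∀ y, ‖gradient u y‖ ≤ L := by
  obtain ⟨C', hC', hap⟩ := apriori (E := E) p hp
  have hC0 : 0 ≤ C := by
    have := (abs_nonneg _).trans (hg 0)
    simpa using this
  refine ⟨C' * (4 * C), fun y => ?_⟩
  obtain ⟨Λ, hΛ⟩ := bdd_ball hp hu y (1 + ‖y‖)
  have hpos : 0 < 1 + ‖y‖ := by positivity
  have h1 := hap u y (1 + ‖y‖) (4 * C * (1 + ‖y‖)) Λ hu hpos hΛ (by
    intro x hx
    rw [mem_ball, dist_eq_norm] at hx
    have h1 := hg x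
    have h2 := hg y
    have h3 := norm_sub_norm_le x y
    have h4 := abs_sub (u x) (u y)
    have h5 : C * (1 + ‖x‖) ≤ C * (3 * (1 + ‖y‖)) := by
      gcongr
      have := norm_nonneg y
      linarith
    linarith)
  have e : C' * (4 * C * (1 + ‖y‖)) / (1 + ‖y‖) = C' * (4 * C) := by field_simp
  rwa [e] at h1

end PartI

section PartK1
set_option linter.unusedSectionVars false
variable {E : Type*} [NormedAddCommGroup E] [InnerProductSpace ℝ E] [FiniteDimensional ℝ E] [CompleteSpace E]
  [MeasurableSpace E] [BorelSpace E]

lemma lip_global {u : E → ℝ} (hu : Differentiable ℝ u) {L : ℝ} (hL : ∀ x, ‖gradient u x‖ ≤ L) (x y : E) :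
    u x - u y ≤ L * ‖x - y‖ := by
  have := convex_univ.norm_image_sub_le_of_norm_fderiv_le (𝕜 := ℝ) (f := u) (fun z _ => hu z)
    (fun z _ => by rw [← norm_gradient]; exact hL z) (Set.mem_univ y) (Set.mem_univ x)
  exact (le_abs_self _).trans this

lemma almost_slope (p : ℝ) (hp : 1 < p) : ∃ h > 0, h ≤ 1/2 ∧ ∀ (u : E → ℝ) (δ : ℝ), PH p u → (∀ x, ‖gradient u x‖ ≤ 1) →
    0 < δ → δ ≤ 1/16 → δ ≤ h / 2 → 1 - 2 * δ < ‖gradient u 0‖ →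
    ∃ x y : E, ‖x‖ ≤ 1 ∧ ‖x - y‖ = h ∧ (1 - 4 * δ) * h ≤ u x - u y := by
  obtain ⟨c₀, hc, hIL⟩ := IL (E := E) p hp 1 le_rfl
  obtain ⟨h, hh0, hh1, hh2⟩ : ∃ h > 0, h ≤ 1/2 ∧ 2 * h ^ 2 ≤ c₀ := by
    refine ⟨min (1/2) c₀, by positivity, min_le_left _ _, ?_⟩
    have h1 : min (1/2) c₀ ≤ 1/2 := min_le_left _ _
    have h2 : min (1/2) c₀ ≤ c₀ := min_le_right _ _
    have h3 : 0 < min (1/2) c₀ := by positivity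
    nlinarith
  refine ⟨h, hh0, hh1, fun u δ hu hL hδ hδ1 hδ2 hg => ?_⟩
  by_contra hcon
  push Not at hcon
  have hA : 0 < 2 * δ / h := by positivity
  have hAh : 2 * δ / h * h = 2 * δ := by field_simp
  have hAhh : 2 * δ / h * h ^ 2 = 2 * δ * h := by field_simp
  have := hIL u (1 - 2 * δ) (2 * δ / h) h (4 * δ * h) hu (fun x _ => hL x) (by linarith) (by linarith) hA hh0 hh1
    (by rw [hAh]; linarith) (by positivity) (by
      calc 4 * δ * h = (2 * h ^ 2) * (2 * δ / h) := by field_simp; ring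
        _ ≤ _ := by gcongr) (by nlinarith) (by
      intro x y hx hxy
      have := hcon x y hx hxy
      rw [hAhh]; linarith) (by
      intro x y hx hxy
      have h1 := lip_global hu.diff hL x y
      have h2 : 2 * δ / h * ‖x - y‖ ^ 2 ≤ 2 * δ / h * h ^ 2 := by gcongr
      rw [hAhh] at h2
      nlinarith)
  linarith

lemma exp_lower {X : ℝ} (hX : |X| ≤ 1) : X + X ^ 2 / 2 - |X| ^ 3 ≤ Real.exp X - 1 := by
  have h1 := Real.exp_bound hX (n := 3) (by norm_num)
  have h2 := (abs_le.mp h1).1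
  simp [Finset.sum_range_succ, Nat.factorial] at h2
  have h3 : 0 ≤ |X| ^ 3 := by positivity
  nlinarith

lemma hasFDerivAt_bump (N : ℝ) (a x : E) : HasFDerivAt (fun x => Real.exp (-N * ‖x - a‖ ^ 2))
    (innerSL ℝ ((-2 * N * Real.exp (-N * ‖x - a‖ ^ 2)) • (x - a))) x := by
  have h1 := (hasFDerivAt_normsq (-N) a x).exp
  refine h1.congr_fderiv ?_
  rw [← map_smul, smul_smul]
  congr 2
  ring

/-- second-order lower bound of the barrier along a line -/
lemma bump_lower {N S r : ℝ} {w v : E} (hN : 0 < N) (hS : 1 ≤ S) (hr0 : 0 < r) (hw : ‖w‖ ≤ 4) (hv : ‖v‖ ≤ S)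
    (hr1 : r ≤ 1) (hr : r * (9 * N * S ^ 2) ≤ 1) :
    Real.exp (-N * ‖w‖ ^ 2) * (r * (-2 * N * ⟪w, v⟫) + r ^ 2 * (2 * N ^ 2 * ⟪w, v⟫ ^ 2 - N * ‖v‖ ^ 2))
      - (8 * N ^ 2 * S ^ 3 + (9 * N * S ^ 2) ^ 3) * r ^ 3 ≤
    Real.exp (-N * ‖w + r • v‖ ^ 2) - Real.exp (-N * ‖w‖ ^ 2) := by
  set X := - N * (2 * r * ⟪w, v⟫ + r ^ 2 * ‖v‖ ^ 2) with hX
  set q := ⟪w, v⟫ with hq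
  have hexp : Real.exp (-N * ‖w + r • v‖ ^ 2) = Real.exp (-N * ‖w‖ ^ 2) * Real.exp X := by
    rw [← Real.exp_add]; congr 1
    rw [hX, hq, norm_add_sq_real, inner_smul_right, norm_smul, mul_pow, Real.norm_eq_abs, sq_abs]; ring
  have hqb : |q| ≤ 4 * S := by
    have := abs_real_inner_le_norm w v
    have h2 : ‖w‖ * ‖v‖ ≤ 4 * S := by gcongr
    linarith
  have hvb : ‖v‖ ^ 2 ≤ S ^ 2 := by gcongr
  have hXb : |X| ≤ r * (9 * N * S ^ 2) := by
    rw [hX, abs_mul, abs_neg, abs_of_pos hN]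
    have h1 : |2 * r * q + r ^ 2 * ‖v‖ ^ 2| ≤ 2 * r * (4 * S) + r ^ 2 * S ^ 2 := by
      refine (abs_add_le _ _).trans ?_
      rw [abs_mul, abs_of_pos (by positivity : 0 < 2 * r), abs_of_nonneg (by positivity : 0 ≤ r ^ 2 * ‖v‖ ^ 2)]
      gcongr
    have h2 : 2 * r * (4 * S) + r ^ 2 * S ^ 2 ≤ r * (9 * S ^ 2) := by nlinarith [mul_pos hr0 (by linarith : 0 < S), mul_nonneg hr0.le (mul_nonneg (by linarith : 0 ≤ S) (by linarith : 0 ≤ S - 1)), mul_nonneg (mul_nonneg hr0.le (by linarith : 0 ≤ 1 - r)) (sq_nonneg S)]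
    calc N * |2 * r * q + r ^ 2 * ‖v‖ ^ 2| ≤ N * (r * (9 * S ^ 2)) := by gcongr; linarith
      _ = _ := by ring
  have h1 := exp_lower (hXb.trans hr)
  have h2 : |X| ^ 3 ≤ (9 * N * S ^ 2) ^ 3 * r ^ 3 := by
    calc |X| ^ 3 ≤ (r * (9 * N * S ^ 2)) ^ 3 := by gcongr
      _ = _ := by ring
  have h3 : 2 * N ^ 2 * r ^ 2 * q ^ 2 - 8 * N ^ 2 * S ^ 3 * r ^ 3 ≤ X ^ 2 / 2 := by
    have e : X ^ 2 / 2 = 2 * N ^ 2 * r ^ 2 * q ^ 2 + 2 * N ^ 2 * r ^ 3 * (q * ‖v‖ ^ 2) + N ^ 2 * r ^ 4 * (‖v‖ ^ 2) ^ 2 / 2 := by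
      rw [hX]; ring
    have h4 : - (4 * S * S ^ 2) ≤ q * ‖v‖ ^ 2 := by
      have h5 : |q * ‖v‖ ^ 2| ≤ 4 * S * S ^ 2 := by
        rw [abs_mul, abs_of_nonneg (by positivity : 0 ≤ ‖v‖ ^ 2)]
        gcongr
      exact (abs_le.mp h5).1
    have h5 : 2 * N ^ 2 * r ^ 3 * (-(4 * S * S ^ 2)) ≤ 2 * N ^ 2 * r ^ 3 * (q * ‖v‖ ^ 2) := by gcongr
    have h6 : 0 ≤ N ^ 2 * r ^ 4 * (‖v‖ ^ 2) ^ 2 / 2 := by positivity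
    rw [e]
    nlinarith
  have hE0 : 0 < Real.exp (-N * ‖w‖ ^ 2) := Real.exp_pos _
  have hE1 : Real.exp (-N * ‖w‖ ^ 2) ≤ 1 := Real.exp_le_one_iff.mpr (by
    have : 0 ≤ N * ‖w‖ ^ 2 := by positivity
    linarith)
  set D := (8 * N ^ 2 * S ^ 3 + (9 * N * S ^ 2) ^ 3) * r ^ 3 with hD
  have hD0 : 0 ≤ D := by positivity
  have h7 : r * (-2 * N * q) + r ^ 2 * (2 * N ^ 2 * q ^ 2 - N * ‖v‖ ^ 2) - D ≤ Real.exp X - 1 := by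
    have : X = r * (-2 * N * q) - r ^ 2 * (N * ‖v‖ ^ 2) := by rw [hX]; ring
    rw [hD]
    nlinarith
  have h8 := mul_le_mul_of_nonneg_left h7 hE0.le
  have h9 : Real.exp (-N * ‖w‖ ^ 2) * D ≤ 1 * D := by gcongr
  rw [hexp]
  nlinarith

lemma TT_lower {e : E} (he : ‖e‖ = 1) {s : ℝ} (hs : s ≠ 0) (w : E) : (2 + |s⁻¹|)⁻¹ * ‖w‖ ≤ ‖TT e s w‖ := by
  have h1 := TT_norm he s⁻¹ (TT e s w)
  rw [TT_inv he hs] at h1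
  rw [inv_mul_le_iff₀ (by positivity)]
  exact h1

lemma sync_diff {ν₁ ν₂ : E} (h1 : ‖ν₁‖ = 1) (h2 : ‖ν₂‖ = 1) (s : ℝ) {z : E} (hz : ‖z‖ ≤ 1) :
    ‖TT ν₁ s z - TT ν₂ s z‖ ≤ 2 * |s - 1| * ‖ν₁ - ν₂‖ := by
  have e : TT ν₁ s z - TT ν₂ s z = (s - 1) • (⟪ν₁, z⟫ • (ν₁ - ν₂) + ⟪ν₁ - ν₂, z⟫ • ν₂) := by
    rw [TT_apply, TT_apply, inner_sub_left]; module
  rw [e, norm_smul, Real.norm_eq_abs]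
  have h3 : ‖⟪ν₁, z⟫ • (ν₁ - ν₂) + ⟪ν₁ - ν₂, z⟫ • ν₂‖ ≤ 2 * ‖ν₁ - ν₂‖ := by
    refine (norm_add_le _ _).trans ?_
    rw [norm_smul, norm_smul, h2, mul_one, Real.norm_eq_abs, Real.norm_eq_abs]
    have h4 := abs_real_inner_le_norm ν₁ z
    have h5 := abs_real_inner_le_norm (ν₁ - ν₂) z
    rw [h1, one_mul] at h4
    have h6 : |⟪ν₁, z⟫| * ‖ν₁ - ν₂‖ ≤ 1 * ‖ν₁ - ν₂‖ := by gcongr; linarith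
    have h7 : ‖ν₁ - ν₂‖ * ‖z‖ ≤ ‖ν₁ - ν₂‖ * 1 := by gcongr
    linarith
  calc |s-1| * _ ≤ |s - 1| * (2 * ‖ν₁ - ν₂‖) := by gcongr
    _ = _ := by ring

lemma norm_amgm {e ζ : E} (he : ‖e‖ = 1) {h : ℝ} (hh : 0 < h) : ‖h • e + ζ‖ ≤ h + ⟪e, ζ⟫ + ‖ζ‖ ^ 2 / (2 * h) := by
  have h1 : ‖h • e + ζ‖ ^ 2 = h ^ 2 + 2 * h * ⟪e, ζ⟫ + ‖ζ‖ ^ 2 := by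
    rw [norm_add_sq_real, norm_smul, he, inner_smul_left, mul_one, Real.norm_eq_abs, sq_abs]; simp; ring
  have h2 : h + ⟪e, ζ⟫ + ‖ζ‖ ^ 2 / (2 * h) = (h ^ 2 + ‖h • e + ζ‖ ^ 2) / (2 * h) := by
    rw [h1]; field_simp; ring
  rw [h2, le_div_iff₀ (by positivity)]
  nlinarith [sq_nonneg (h - ‖h • e + ζ‖)]

end PartK1

section PartK2
set_option linter.unusedSectionVars false
variable {E : Type*} [NormedAddCommGroup E] [InnerProductSpace ℝ E] [FiniteDimensional ℝ E] [CompleteSpace E]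
  [MeasurableSpace E] [BorelSpace E]

lemma barrier_quad {e x y z0 a b : E} {h K κ N S r : ℝ} (hκ : 0 < κ) (hN : 0 < N) (hS : 1 ≤ S) (hr0 : 0 < r)
    (hw : ‖x - z0‖ ≤ 4) (hv : ‖a‖ ≤ S) (hr1 : r ≤ 1) (hr : r * (9 * N * S ^ 2) ≤ 1) :
    (⟪e, (x + r • a) - (y + r • b)⟫ + K * ‖(x + r • a) - (y + r • b) - h • e‖ ^ 2 - κ * Real.exp (-N * ‖x + r • a - z0‖ ^ 2))
      - (⟪e, x - y⟫ + K * ‖x - y - h • e‖ ^ 2 - κ * Real.exp (-N * ‖x - z0‖ ^ 2)) ≤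
    r * (⟪e + (2 * K) • (x - y - h • e), a - b⟫ + κ * Real.exp (-N * ‖x - z0‖ ^ 2) * (2 * N * ⟪x - z0, a⟫)) +
    r ^ 2 * (K * ‖a - b‖ ^ 2 + κ * Real.exp (-N * ‖x - z0‖ ^ 2) * (N * ‖a‖ ^ 2 - 2 * N ^ 2 * ⟪x - z0, a⟫ ^ 2)) +
    (κ * (8 * N ^ 2 * S ^ 3 + (9 * N * S ^ 2) ^ 3)) * r ^ 3 := by
  have h1 := bump_lower hN hS hr0 hw hv hr1 hr
  have e1 : x + r • a - z0 = x - z0 + r • a := by abel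
  have e2 : (x + r • a) - (y + r • b) = (x - y) + r • (a - b) := by rw [smul_sub]; abel
  have e3 : (x - y) + r • (a - b) - h • e = (x - y - h • e) + r • (a - b) := by abel
  rw [e1, e2, e3, norm_add_sq_real (x - y - h • e), inner_add_right, inner_add_left, inner_smul_right, inner_smul_right,
    real_inner_smul_left, norm_smul, mul_pow, Real.norm_eq_abs, sq_abs]
  have h2 := mul_le_mul_of_nonneg_left h1 hκ.le
  nlinarith

set_option maxHeartbeats 2000000 in
lemma barrier_core (p : ℝ) (hp : 1 < p) {s m J : ℝ} (hs0 : 0 < s) (hs2 : s ^ 2 = p - 1)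
    (hm : 0 < m) (hm2 : ∀ n : E, m * ‖n‖ ^ 2 ≤ ∫ z : E, qq z ^ 3 * ⟪n, z⟫ ^ 2) (hJ : J = ∫ z : E, qq z ^ 3)
    {U : E → ℝ} (hU : PH p U) (hL : ∀ x, ‖gradient U x‖ ≤ 1) {e z0 x y : E} (he : ‖e‖ = 1) {h K κ N ρ : ℝ}
    (hK : 0 < K) (hκ : 0 < κ) (hN : 0 < N) (hρ : 0 < ρ)
    (hNJ : J * (2 + s) ^ 2 ≤ N * (m * ((2 + |s⁻¹|)⁻¹ * ρ) ^ 2))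
    (hκJ : κ * (4096 * J * K * (s - 1) ^ 2) < m * ((2 + |s⁻¹|)⁻¹ * ρ) ^ 2)
    (hκN : 8 * N * κ ≤ 1 / 4) (hζ : 2 * K * ‖x - y - h • e‖ ≤ 1 / 4) (hx1 : ρ ≤ ‖x - z0‖) (hx2 : ‖x - z0‖ ≤ 4)
    (hloc : ∀ᶠ q : E × E in nhds (x, y),
      U q.1 - U q.2 - (⟪e, q.1 - q.2⟫ + K * ‖q.1 - q.2 - h • e‖ ^ 2 - κ * Real.exp (-N * ‖q.1 - z0‖ ^ 2))
      ≤ U x - U y - (⟪e, x - y⟫ + K * ‖x - y - h • e‖ ^ 2 - κ * Real.exp (-N * ‖x - z0‖ ^ 2))) : False := by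
  have hJp : 0 < J := by rw [hJ]; exact integral_qq_pos
  set Ê := Real.exp (-N * ‖x - z0‖ ^ 2) with hÊ
  have hE0 : 0 < Ê := Real.exp_pos _
  have hE1 : Ê ≤ 1 := Real.exp_le_one_iff.mpr (by
    have : 0 ≤ N * ‖x - z0‖ ^ 2 := by positivity
    linarith)
  set ζ := x - y - h • e with hζd
  set w := x - z0 with hw
  have hgx : gradient U x = e + (2 * K) • ζ + (2 * κ * N * Ê) • w := by
    refine gradient_of_max hU.diff (f := fun q => (innerSL ℝ e) q + K * ‖q - (y + h • e)‖ ^ 2 +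
      (-κ) * Real.exp (-N * ‖q - z0‖ ^ 2)) ?_ ?_
    · have h1 := (((innerSL ℝ e).hasFDerivAt (x := x)).add (hasFDerivAt_normsq K (y + h • e) x)).add
        ((hasFDerivAt_bump N z0 x).const_mul (-κ))
      rw [← map_smul, ← map_add, ← map_add, ← hÊ, smul_smul, ← sub_sub x y] at h1
      have hc : -κ * (-2 * N * Ê) = 2 * κ * N * Ê := by ring
      rw [hc] at h1
      exact h1
    · have h1 : Filter.Tendsto (fun w : E => (w, y)) (nhds x) (nhds (x, y)) := (Continuous.prodMk_left y).tendsto x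
      filter_upwards [h1.eventually hloc] with q hq
      simp only [innerSL_apply_apply, ← sub_sub, inner_sub_right] at hq ⊢
      rw [← hζd, ← hw, ← hÊ]
      linarith
  have hgy : gradient U y = e + (2 * K) • ζ := by
    have h3 : gradient (fun w => -1 * (U (0 + (1:ℝ) • w) - 0)) y = -e + (2 * K) • (y - (x - h • e)) := by
      refine gradient_of_max (by have := hU.diff; fun_prop) (f := fun q => (innerSL ℝ (-e)) q + K * ‖q - (x - h • e)‖ ^ 2) ?_ ?_
      · have h1 := ((innerSL ℝ (-e)).hasFDerivAt (x := y)).add (hasFDerivAt_normsq K (x - h • e) y)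
        rw [← map_add] at h1
        exact h1
      · have h1 : Filter.Tendsto (fun w : E => (x, w)) (nhds y) (nhds (x, y)) := (Continuous.prodMk_right x).tendsto y
        filter_upwards [h1.eventually hloc] with q hq
        have e1 : ∀ q : E, ‖q - (x - h • e)‖ = ‖x - q - h • e‖ := fun q => by rw [norm_sub_rev]; congr 1; abel
        simp only [innerSL_apply_apply, inner_sub_right, inner_neg_left, zero_add, one_smul, sub_zero, e1] at hq ⊢
        rw [← hζd]
        linarith
    rw [gradient_rescale hU.diff] at h3
    simp only [zero_add, one_smul, mul_one, neg_smul] at h3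
    have e2 : y - (x - h • e) = - ζ := by rw [hζd]; abel
    rw [e2, smul_neg, ← neg_add, neg_inj] at h3
    exact h3
  have hby : 3 / 4 ≤ ‖gradient U y‖ := by
    have h1 : ‖(2 * K) • ζ‖ ≤ 1/4 := by rw [norm_smul, Real.norm_eq_abs, abs_of_pos (by positivity)]; exact hζ
    have h2 : ‖e‖ ≤ ‖e + (2 * K) • ζ‖ + ‖(2 * K) • ζ‖ := by
      have := norm_sub_le (e + (2 * K) • ζ) ((2 * K) • ζ)
      rwa [add_sub_cancel_right] at this
    rw [hgy]; linarith
  have hdiff : ‖gradient U x - gradient U y‖ ≤ 8 * κ * N * Ê := by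
    rw [hgx, hgy, add_sub_cancel_left, norm_smul, Real.norm_eq_abs, abs_of_pos (by positivity)]
    calc 2 * κ * N * Ê * ‖w‖ ≤ 2 * κ * N * Ê * 4 := by gcongr
      _ = _ := by ring
  have hdiff2 : 8 * κ * N * Ê ≤ 1/4 := by
    calc 8 * κ * N * Ê ≤ 8 * κ * N * 1 := by gcongr
      _ ≤ _ := by linarith
  have hbx : 1 / 2 ≤ ‖gradient U x‖ := by
    have := norm_sub_norm_le (gradient U y) (gradient U x)
    rw [norm_sub_rev] at this
    linarith
  set m₁ := ‖gradient U x‖ with hm₁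
  set m₂ := ‖gradient U y‖ with hm₂
  have hm₁p : 0 < m₁ := by linarith
  have hm₂p : 0 < m₂ := by linarith
  set ν₁ := m₁⁻¹ • gradient U x with hν₁
  set ν₂ := m₂⁻¹ • gradient U y with hν₂
  have hn1 : ‖ν₁‖ = 1 := by
    rw [hν₁, norm_smul, Real.norm_eq_abs, abs_of_pos (by positivity), ← hm₁]; field_simp
  have hn2 : ‖ν₂‖ = 1 := by
    rw [hν₂, norm_smul, Real.norm_eq_abs, abs_of_pos (by positivity), ← hm₂]; field_simp
  have hg1 : gradient U x = m₁ • ν₁ := by rw [hν₁, smul_smul, mul_inv_cancel₀ hm₁p.ne', one_smul]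
  have hg2 : gradient U y = m₂ • ν₂ := by rw [hν₂, smul_smul, mul_inv_cancel₀ hm₂p.ne', one_smul]
  have hβ : ‖ν₁ - ν₂‖ ≤ 32 * κ * N * Ê := by
    have h1 := unit_diff (norm_pos_iff.mp hm₁p) hm₂p hn2
    rw [← hm₁, ← hν₁, ← hg2] at h1
    refine h1.trans ?_
    rw [div_le_iff₀ hm₂p]
    have : 32 * κ * N * Ê * (3/4) ≤ 32 * κ * N * Ê * m₂ := by gcongr
    have h3 : 0 < κ * N * Ê := by positivity
    linarith
  have hS : (1:ℝ) ≤ 2 + |s| := by linarith [abs_nonneg s]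
  have key := two_point p hp s s hs2 hs2 hU (x := x) (y := y) one_pos (L := 1) (fun q _ => hL q) (fun q _ => hL q) hm₁p hm₂p hn1 hn2
    hg1 hg2 (fun x y => ⟪e, x - y⟫ + K * ‖x - y - h • e‖ ^ 2 - κ * Real.exp (-N * ‖x - z0‖ ^ 2)) hloc
    (fun z => ⟪e + (2 * K) • ζ, TT ν₁ s z - TT ν₂ s z⟫ + κ * Ê * (2 * N * ⟪w, TT ν₁ s z⟫)) (by fun_prop)
    (fun z => by
        have e1 : TT ν₁ s (-z) - TT ν₂ s (-z) = -(TT ν₁ s z - TT ν₂ s z) := by rw [map_neg, map_neg]; abel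
        rw [e1, map_neg, inner_neg_right, inner_neg_right]; ring)
    (fun z => K * ‖TT ν₁ s z - TT ν₂ s z‖ ^ 2 + κ * Ê * (N * ‖TT ν₁ s z‖ ^ 2 - 2 * N ^ 2 * ⟪w, TT ν₁ s z⟫ ^ 2)) (by fun_prop)
    (κ * (8 * N ^ 2 * (2 + |s|) ^ 3 + (9 * N * (2 + |s|) ^ 2) ^ 3)) (by
        have h4 : ∀ᶠ r in nhdsWithin (0:ℝ) (Set.Ioi 0), r < 1 / (9 * N * (2 + |s|) ^ 2) :=
          nhdsWithin_le_nhds (gt_mem_nhds (by positivity))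
        have h5 : ∀ᶠ r in nhdsWithin (0:ℝ) (Set.Ioi 0), r < 1 :=
          nhdsWithin_le_nhds (gt_mem_nhds (by positivity))
        filter_upwards [h4, h5, self_mem_nhdsWithin] with r hr1 hr2 hr0 z hz
        rw [lt_div_iff₀ (by positivity)] at hr1
        exact barrier_quad hκ hN hS hr0 hx2
          ((TT_norm hn1 s z).trans (mul_le_of_le_one_right (by positivity) hz)) hr2.le hr1.le)
  have i1 : Integrable (fun z : E => qq z ^ 3 * (K * ‖TT ν₁ s z - TT ν₂ s z‖ ^ 2 +
      κ * Ê * (N * ‖TT ν₁ s z‖ ^ 2 - 2 * N ^ 2 * ⟪w, TT ν₁ s z⟫ ^ 2))) := integrable_qq_mul (by fun_prop) 2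
  have i2 : Integrable (fun z : E => qq z ^ 3 * ⟪TT ν₁ s w, z⟫ ^ 2) := integrable_qq_mul (by fun_prop) 2
  set B := K * (2 * |s - 1| * (32 * κ * N * Ê)) ^ 2 + κ * Ê * (N * (2 + s) ^ 2) with hB
  have hle : ∫ z : E, qq z ^ 3 * (K * ‖TT ν₁ s z - TT ν₂ s z‖ ^ 2 +
      κ * Ê * (N * ‖TT ν₁ s z‖ ^ 2 - 2 * N ^ 2 * ⟪w, TT ν₁ s z⟫ ^ 2))
      ≤ ∫ z : E, (B * qq z ^ 3 - (κ * Ê * (2 * N ^ 2)) * (qq z ^ 3 * ⟪TT ν₁ s w, z⟫ ^ 2)) := by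
    refine integral_mono i1 (((integrable_qq 2).const_mul _).sub (i2.const_mul _)) fun z => ?_
    simp only
    by_cases hz : ‖z‖ ≤ 1
    · have h2 : 0 ≤ qq z ^ 3 := pow_nonneg (qq_nonneg z) _
      have h3 : ‖TT ν₁ s z - TT ν₂ s z‖ ≤ 2 * |s - 1| * (32 * κ * N * Ê) :=
        (sync_diff hn1 hn2 s hz).trans (by gcongr)
      have h4 : ‖TT ν₁ s z‖ ≤ 2 + s := by
        have := (TT_norm hn1 s z).trans (mul_le_of_le_one_right (by positivity) hz)
        rwa [abs_of_pos hs0] at this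
      have h5 : K * ‖TT ν₁ s z - TT ν₂ s z‖ ^ 2 ≤ K * (2 * |s - 1| * (32 * κ * N * Ê)) ^ 2 := by gcongr
      have h6 : κ * Ê * (N * ‖TT ν₁ s z‖ ^ 2) ≤ κ * Ê * (N * (2 + s) ^ 2) := by gcongr
      rw [← TT_symm]
      have h7 : K * ‖TT ν₁ s z - TT ν₂ s z‖ ^ 2 + κ * Ê * (N * ‖TT ν₁ s z‖ ^ 2 - 2 * N ^ 2 * ⟪TT ν₁ s w, z⟫ ^ 2)
        ≤ B - κ * Ê * (2 * N ^ 2) * ⟪TT ν₁ s w, z⟫ ^ 2 := by rw [hB]; linarith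
      have := mul_le_mul_of_nonneg_left h7 h2
      linarith
    · simp [qq_eq_zero (le_of_not_ge hz)]
  rw [integral_sub ((integrable_qq 2).const_mul _) (i2.const_mul _), integral_const_mul, integral_const_mul, ← hJ] at hle
  set M := m * ((2 + |s⁻¹|)⁻¹ * ρ) ^ 2 with hM
  have h1 : M ≤ ∫ z : E, qq z ^ 3 * ⟪TT ν₁ s w, z⟫ ^ 2 := by
    refine le_trans ?_ (hm2 _)
    have := TT_lower hn1 hs0.ne' w
    have h2 : (2 + |s⁻¹|)⁻¹ * ρ ≤ ‖TT ν₁ s w‖ := le_trans (by gcongr) this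
    rw [hM]
    gcongr
  have hN2 : 0 < κ * Ê * N ^ 2 := by positivity
  have h3 : (κ * Ê * (2 * N ^ 2)) * M ≤ (κ * Ê * (2 * N ^ 2)) * ∫ z : E, qq z ^ 3 * ⟪TT ν₁ s w, z⟫ ^ 2 := by gcongr
  have h4 : B * J = (κ * Ê * N ^ 2) * (Ê * (κ * (4096 * J * K * (s - 1) ^ 2))) + (κ * Ê * N) * (J * (2 + s) ^ 2) := by
    rw [hB, mul_pow, mul_pow 2 |s-1|, sq_abs]; ring
  have h5 : (κ * Ê * N) * (J * (2 + s) ^ 2) ≤ (κ * Ê * N) * (N * M) := by gcongr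
  have h6 : Ê * (κ * (4096 * J * K * (s - 1) ^ 2)) ≤ 1 * (κ * (4096 * J * K * (s - 1) ^ 2)) := by gcongr
  have h7 : (κ * Ê * N ^ 2) * (Ê * (κ * (4096 * J * K * (s - 1) ^ 2))) < (κ * Ê * N ^ 2) * M :=
    mul_lt_mul_of_pos_left (by linarith) hN2
  linarith

end PartK2

section PartK3
set_option linter.unusedSectionVars false
variable {E : Type*} [NormedAddCommGroup E] [InnerProductSpace ℝ E] [FiniteDimensional ℝ E] [CompleteSpace E]
  [MeasurableSpace E] [BorelSpace E]

set_option maxHeartbeats 2000000 in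
lemma barrier (p : ℝ) (hp : 1 < p) {h μ : ℝ} (hh : 0 < h) (hh1 : h ≤ 1) (hμ : 0 < μ) :
    ∃ δ₀ > 0, ∀ (U : E → ℝ) (e z0 xb : E), PH p U → (∀ x, ‖gradient U x‖ ≤ 1) → ‖e‖ = 1 → ‖xb - z0‖ ≤ 3 →
      h - δ₀ ≤ U xb - U (xb - h • e) → h - μ ≤ U z0 - U (z0 - h • e) := by
  obtain ⟨m, hm, hm2⟩ := exists_m2 (E := E)
  set J := ∫ z : E, qq z ^ 3 with hJ
  have hJp : 0 < J := integral_qq_pos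
  set s := Real.sqrt (p - 1) with hs
  have hs0 : 0 < s := Real.sqrt_pos.mpr (by linarith)
  have hs2 : s ^ 2 = p - 1 := Real.sq_sqrt (by linarith)
  set ρ := min μ 1 / 8 with hρd
  have hρ : 0 < ρ := by positivity
  have hρμ : 8 * ρ ≤ μ := by have := min_le_left μ 1; rw [hρd]; linarith
  have hρ1 : 8 * ρ ≤ 1 := by have := min_le_right μ 1; rw [hρd]; linarith
  set M := m * ((2 + |s⁻¹|)⁻¹ * ρ) ^ 2 with hM
  have hMp : 0 < M := by positivity
  set K := 2 / h with hKd
  have hK : 0 < K := by positivity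
  set N := J * (2 + s) ^ 2 / M with hNd
  have hN : 0 < N := by positivity
  have hNJ : J * (2 + s) ^ 2 ≤ N * M := by rw [hNd, div_mul_cancel₀ _ hMp.ne']
  set C₁ := 4096 * J * K * (s - 1) ^ 2 with hC₁
  have hC₁p : 0 ≤ C₁ := by positivity
  set κ := min (min (h / 256) (1 / (32 * N))) (min (ρ ^ 2) (M / (2 * (C₁ + 1)))) with hκd
  have hκ : 0 < κ := by positivity
  have hκ1 : κ ≤ h / 256 := (min_le_left _ _).trans (min_le_left _ _)
  have hκ2 : κ ≤ 1 / (32 * N) := (min_le_left _ _).trans (min_le_right _ _)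
  have hκ3 : κ ≤ ρ ^ 2 := (min_le_right _ _).trans (min_le_left _ _)
  have hκ4 : κ ≤ M / (2 * (C₁ + 1)) := (min_le_right _ _).trans (min_le_right _ _)
  rw [le_div_iff₀ (by positivity)] at hκ2 hκ4
  have hκJ : κ * C₁ < M := by
    have : 0 ≤ κ * C₁ := by positivity
    nlinarith
  have hexp : Real.exp (-N * 4 ^ 2) < Real.exp (-N * 3 ^ 2) := Real.exp_lt_exp.mpr (by nlinarith)
  have hE40 : 0 < Real.exp (-N * 4 ^ 2) := Real.exp_pos _
  obtain ⟨E3, hE3⟩ : ∃ E3, E3 = Real.exp (-N * 3 ^ 2) := ⟨_, rfl⟩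
  obtain ⟨E4, hE4⟩ : ∃ E4, E4 = Real.exp (-N * 4 ^ 2) := ⟨_, rfl⟩
  rw [← hE3, ← hE4] at hexp
  rw [← hE4] at hE40
  refine ⟨κ * (E3 - E4) / 2, by
    have : 0 < κ * (E3 - E4) := mul_pos hκ (by linarith)
    linarith, ?_⟩
  intro U e z0 xb hU hL he hxb hsl
  have huc := hU.diff.continuous
  have hse : 0 < κ * (E3 - E4) := mul_pos hκ (by linarith)
  obtain ⟨x, y, hxy, hmax⟩ := exists_max_two
    (Ψ := fun x y => U x - U y - (⟪e, x - y⟫ + K * ‖x - y - h • e‖ ^ 2 - κ * Real.exp (-N * ‖x - z0‖ ^ 2)))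
    (by fun_prop) (compact_D z0 (h • e) 4 (h / 2)) (x₀ := xb) (y₀ := xb - h • e)
    (by
      refine ⟨?_, ?_⟩
      · simp only; linarith
      · simp only [sub_sub_cancel, sub_self, norm_zero]; linarith)
  obtain ⟨hx4, hyh⟩ := hxy
  simp only at hx4 hyh hmax
  have hee : ⟪e, h • e⟫ = h := by rw [inner_smul_right, real_inner_self_eq_norm_sq, he]; ring
  have hpos : κ * E4 < U x - U y - (⟪e, x - y⟫ + K * ‖x - y - h • e‖ ^ 2 - κ * Real.exp (-N * ‖x - z0‖ ^ 2)) := by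
    have h1 := hmax (xb, xb - h • e) (by
      refine ⟨?_, ?_⟩
      · simp only; linarith
      · simp only [sub_sub_cancel, sub_self, norm_zero]; linarith)
    simp only [sub_sub_cancel, sub_self, norm_zero, hee] at h1
    have h2 : E3 ≤ Real.exp (-N * ‖xb - z0‖ ^ 2) := by
      rw [hE3]
      refine Real.exp_le_exp.mpr ?_
      have : N * ‖xb - z0‖ ^ 2 ≤ N * 3 ^ 2 := by gcongr
      linarith
    have h3 := mul_le_mul_of_nonneg_left h2 hκ.le
    have h4 : K * (0:ℝ) ^ 2 = 0 := by ring
    rw [h4] at h1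
    linarith
  set ζ := x - y - h • e with hζ
  have hxyζ : x - y = h • e + ζ := by rw [hζ]; abel
  have hinn : ⟪e, x - y⟫ = h + ⟪e, ζ⟫ := by rw [hxyζ, inner_add_right, hee]
  have hΨ0 : U x - U y - (⟪e, x - y⟫ + K * ‖ζ‖ ^ 2) ≤ - (‖ζ‖ ^ 2 / h) := by
    have h1 := lip_global hU.diff hL x y
    rw [hxyζ] at h1
    have h2 := norm_amgm (ζ := ζ) he hh
    rw [hinn]
    have h3 : K * ‖ζ‖ ^ 2 = 2 * (‖ζ‖ ^ 2 / h) := by rw [hKd]; ring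
    have h4 : ‖ζ‖ ^ 2 / (2 * h) = (‖ζ‖ ^ 2 / h) / 2 := by field_simp
    have h5 : 0 ≤ ‖ζ‖ ^ 2 / h := by positivity
    rw [h3]
    rw [h4] at h2
    linarith
  have hE1 : Real.exp (-N * ‖x - z0‖ ^ 2) ≤ 1 := Real.exp_le_one_iff.mpr (by
    have : 0 ≤ N * ‖x - z0‖ ^ 2 := by positivity
    linarith)
  have hκE : κ * Real.exp (-N * ‖x - z0‖ ^ 2) ≤ κ * 1 := by gcongr
  have hκE0 : 0 < κ * E4 := mul_pos hκ hE40
  have hζ2 : ‖ζ‖ ^ 2 ≤ κ * h := by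
    rw [← div_le_iff₀ hh]; linarith
  have hζh : ‖ζ‖ ≤ h / 16 := by
    refine abs_le_of_sq_le_sq' ?_ (by positivity) |>.2
    calc ‖ζ‖ ^ 2 ≤ κ * h := hζ2
      _ ≤ (h / 256) * h := by gcongr
      _ = (h / 16) ^ 2 := by ring
  have hζρ : ‖ζ‖ ≤ ρ := by
    refine abs_le_of_sq_le_sq' ?_ (by positivity) |>.2
    calc ‖ζ‖ ^ 2 ≤ κ * h := hζ2
      _ ≤ ρ ^ 2 * 1 := by gcongr
      _ = ρ ^ 2 := by ring
  have hx4' : ‖x - z0‖ < 4 := by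
    refine lt_of_le_of_ne hx4 fun h1 => ?_
    rw [h1, ← hE4] at hpos
    have h5 : 0 ≤ ‖ζ‖ ^ 2 / h := by positivity
    linarith
  have hloc : ∀ᶠ q : E × E in nhds (x, y),
      U q.1 - U q.2 - (⟪e, q.1 - q.2⟫ + K * ‖q.1 - q.2 - h • e‖ ^ 2 - κ * Real.exp (-N * ‖q.1 - z0‖ ^ 2))
      ≤ U x - U y - (⟪e, x - y⟫ + K * ‖x - y - h • e‖ ^ 2 - κ * Real.exp (-N * ‖x - z0‖ ^ 2)) := by
    filter_upwards [open_D z0 (h • e) 4 (h / 2) (x := x) (y := y) hx4' (by rw [← hζ]; linarith)] with q hq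
    exact hmax q ⟨hq.1.le, hq.2.le⟩
  rcases le_or_gt ρ ‖x - z0‖ with hc | hc
  · exact (barrier_core p hp hs0 hs2 hm hm2 hJ hU hL he hK hκ hN hρ hNJ hκJ (by linarith) (by
      rw [← hζ, hKd]
      calc 2 * (2 / h) * ‖ζ‖ ≤ 2 * (2 / h) * (h / 16) := by gcongr
        _ = 1 / 4 := by field_simp; norm_num) hc hx4 hloc).elim
  · have h1 := lip_global hU.diff hL x z0
    have h2 := lip_global hU.diff hL (z0 - h • e) y
    have h3 : ‖z0 - h • e - y‖ ≤ ‖x - z0‖ + ‖ζ‖ := by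
      have e1 : z0 - h • e - y = ζ - (x - z0) := by rw [hζ]; abel
      rw [e1, add_comm]
      exact norm_sub_le _ _
    have h4 := abs_real_inner_le_norm e ζ
    rw [he, one_mul] at h4
    have h5 := (abs_le.mp h4).1
    have h6 : 0 ≤ K * ‖ζ‖ ^ 2 := by positivity
    have h7 : ρ ^ 2 ≤ ρ := by
      rw [sq]
      exact mul_le_of_le_one_right hρ.le (by linarith)
    linarith

end PartK3

section PartK4
set_option linter.unusedSectionVars false
variable {E : Type*} [NormedAddCommGroup E] [InnerProductSpace ℝ E] [FiniteDimensional ℝ E] [CompleteSpace E]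
  [MeasurableSpace E] [BorelSpace E]

set_option maxHeartbeats 1000000 in
lemma flat (p : ℝ) (hp : 1 < p) {ε : ℝ} (hε : 0 < ε) : ∃ δ > 0, ∃ r > 0, ∀ (u : E → ℝ) (x1 : E), PH p u →
    (∀ x, ‖gradient u x‖ ≤ 1) → 1 - 2 * δ < ‖gradient u x1‖ → ∀ R : ℝ, 1 ≤ R → ‖x1‖ ≤ R →
    ∃ (e : E) (c : ℝ), ‖e‖ = 1 ∧ ∀ x ∈ ball (0:E) 1, |(r * R)⁻¹ * u ((r * R) • x) - c - ⟪e, x⟫| ≤ ε := by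
  obtain ⟨h, hh, hh2, hslope⟩ := almost_slope (E := E) p hp
  set r := ε * h / 2 with hr
  have hr0 : 0 < r := by positivity
  set μ := r * ε / 2 with hμ
  have hμ0 : 0 < μ := by positivity
  obtain ⟨δ₀, hδ₀, hbar⟩ := barrier (E := E) p hp hh (by linarith) hμ0
  set δ := min (min (1/16) (h / 2)) (δ₀ / (4 * h)) with hδ
  have hδ0 : 0 < δ := by positivity
  have hδ1 : δ ≤ 1/16 := (min_le_left _ _).trans (min_le_left _ _)
  have hδ2 : δ ≤ h / 2 := (min_le_left _ _).trans (min_le_right _ _)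
  have hδ3 : δ ≤ δ₀ / (4 * h) := min_le_right _ _
  rw [le_div_iff₀ (by positivity)] at hδ3
  refine ⟨δ, hδ0, r, hr0, ?_⟩
  intro u x1 hu hL hx1 R hR hxR
  have hR0 : 0 < R := by linarith
  obtain ⟨U, hUd⟩ : ∃ U : E → ℝ, U = fun x => R⁻¹ * u (R • x) := ⟨_, rfl⟩
  have hU : PH p U := by rw [hUd]; exact rescale0_PH hu hR0
  have hUL : ∀ x, ‖gradient U x‖ ≤ 1 := fun x => by
    rw [hUd, rescale0_gradient hu.diff hR0]; exact hL _
  have hG : PH p (fun x => R⁻¹ * (u (x1 + R • x) - 0)) := hu.rescale x1 hR0 (by positivity) 0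
  obtain ⟨x, y, hx, hxy, hxyu⟩ := hslope (fun x => R⁻¹ * (u (x1 + R • x) - 0)) δ hG (fun x => by
    rw [gradient_rescale hu.diff, inv_mul_cancel₀ hR0.ne', one_smul]; exact hL _) hδ0 hδ1 hδ2 (by
    rw [gradient_rescale hu.diff, inv_mul_cancel₀ hR0.ne', one_smul, smul_zero, add_zero]; exact hx1)
  have hGU : ∀ x, R⁻¹ * (u (x1 + R • x) - 0) = U (R⁻¹ • x1 + x) := fun x => by
    rw [hUd]; simp only; rw [smul_add, smul_smul, mul_inv_cancel₀ hR0.ne', one_smul, sub_zero]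
  rw [hGU, hGU] at hxyu
  set e := h⁻¹ • (x - y) with he
  have he1 : ‖e‖ = 1 := by rw [he, norm_smul, hxy, Real.norm_eq_abs, abs_of_pos (by positivity)]; field_simp
  have hhe : h • e = x - y := by rw [he, smul_smul, mul_inv_cancel₀ hh.ne', one_smul]
  have hx3 : ‖R⁻¹ • x1 + x - (h / 2) • e‖ ≤ 3 := by
    have h1 : ‖R⁻¹ • x1‖ ≤ 1 := by
      rw [norm_smul, Real.norm_eq_abs, abs_of_pos (by positivity), inv_mul_le_iff₀ hR0]; linarith
    have h2 : ‖(h / 2) • e‖ = h / 2 := by rw [norm_smul, he1, Real.norm_eq_abs, abs_of_pos (by positivity)]; ring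
    have h3 := norm_sub_le (R⁻¹ • x1 + x) ((h / 2) • e)
    have h4 := norm_add_le (R⁻¹ • x1) x
    linarith
  have hB := hbar U e ((h / 2) • e) (R⁻¹ • x1 + x) hU hUL he1 hx3 (by
    have e1 : R⁻¹ • x1 + x - h • e = R⁻¹ • x1 + y := by rw [hhe]; abel
    rw [e1]
    linarith)
  have e2 : (h / 2) • e - h • e = -((h / 2) • e) := by module
  rw [e2] at hB
  set c := U (-((h / 2) • e)) + h / 2 with hc
  have hflat : ∀ q : E, |U q - c - ⟪e, q⟫| ≤ μ + ‖q‖ ^ 2 / h := by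
    intro q
    have h1 := lip_global hU.diff hUL q (-((h / 2) • e))
    have h2 := norm_amgm (ζ := q) he1 (by positivity : 0 < h / 2)
    have h3 := lip_global hU.diff hUL ((h / 2) • e) q
    have h4 := norm_amgm (ζ := -q) he1 (by positivity : 0 < h / 2)
    have e3 : q - -((h / 2) • e) = (h / 2) • e + q := by abel
    have e4 : 2 * (h / 2) = h := by ring
    rw [e3] at h1
    rw [← sub_eq_add_neg, norm_neg, inner_neg_right] at h4
    rw [e4] at h2 h4
    rw [abs_le]
    constructor <;> linarith
  refine ⟨e, r⁻¹ * c, he1, fun q hq => ?_⟩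
  have h1 := hflat (r • q)
  have e5 : (r * R)⁻¹ * u ((r * R) • q) = r⁻¹ * U (r • q) := by
    rw [hUd]; simp only; rw [smul_smul, mul_comm R r, mul_inv]; ring
  have e6 : (r * R)⁻¹ * u ((r * R) • q) - r⁻¹ * c - ⟪e, q⟫ = r⁻¹ * (U (r • q) - c - ⟪e, r • q⟫) := by
    rw [e5, inner_smul_right]; field_simp
  rw [e6, abs_mul, abs_of_pos (by positivity : 0 < r⁻¹), inv_mul_le_iff₀ hr0]
  refine h1.trans ?_
  rw [norm_smul, Real.norm_eq_abs, abs_of_pos hr0]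
  rw [mem_ball_zero_iff] at hq
  have h2 : (r * ‖q‖) ^ 2 ≤ (r * 1) ^ 2 := by gcongr
  have h3 : (r * ‖q‖) ^ 2 / h ≤ (r * 1) ^ 2 / h := by gcongr
  have h4 : (r * 1) ^ 2 / h = r * (ε / 2) := by
    have : r / h = ε / 2 := by rw [hr]; field_simp
    rw [← this]; ring
  rw [hμ]
  linarith

lemma eq_of_int {g : E → ℝ} (hc : Continuous g) {r : ℝ} (hr : 0 < r) (h : ∫ x in ball (0:E) r, g x ^ 2 ≤ 0) : g 0 = 0 := by
  by_contra hb
  have h1 := (setIntegral_pos_iff_support_of_nonneg_ae (μ := (volume : Measure E)) (s := ball (0:E) r)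
    (f := fun x : E => g x ^ 2) (Filter.Eventually.of_forall fun x => sq_nonneg _)
    (integrableOn_ball_of_continuous (by fun_prop) 0 r)).2 (by
      refine IsOpen.measure_pos _ (Continuous.isOpen_support (by fun_prop) |>.inter isOpen_ball) ⟨0, ?_, ?_⟩
      · rw [Function.mem_support]
        positivity
      · rw [mem_ball_zero_iff, norm_zero]; exact hr)
  linarith

set_option maxHeartbeats 1000000 in
lemma liouville (p : ℝ) (hp : 1 < p) {u : E → ℝ} (hu : PH p u) (hL : ∀ x, ‖gradient u x‖ ≤ 1)
    (hsup : ∀ δ > 0, ∃ x, 1 - δ < ‖gradient u x‖) : ∃ a : E, ∀ x, u x = u 0 + ⟪a, x⟫ := by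
  obtain ⟨C, hC, ε₁, hε₁, hdec⟩ := decay (E := E) p hp 1 one_pos
  set V := (volume (ball (0:E) 1)).toReal with hV
  have hV0 : 0 ≤ V := ENNReal.toReal_nonneg
  set ε := ε₁ / (V + 1) with hε
  have hε0 : 0 < ε := by positivity
  have hεV : ε ^ 2 * V ≤ ε₁ ^ 2 := by
    rw [hε, div_pow, div_mul_eq_mul_div, div_le_iff₀ (by positivity)]
    have : V ≤ (V + 1) ^ 2 := by nlinarith
    gcongr
  obtain ⟨δ, hδ, r, hr, hflat⟩ := flat (E := E) p hp hε0
  obtain ⟨x1, hx1⟩ := hsup (2 * δ) (by positivity)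
  set a := gradient u 0 with ha
  set n := Module.finrank ℝ E with hn
  have huc := hu.diff.continuous
  -- decay at all large scales
  have hdecay : ∀ R : ℝ, 1 ≤ R → ‖x1‖ ≤ R → ∀ ρ : ℝ, 0 < ρ → ρ ≤ 1/2 →
      ∫ x in ball (0:E) ρ, ‖gradient u ((r * R) • x) - a‖ ^ 2 ≤ C * ρ ^ (n + 1) * Real.sqrt ρ := by
    intro R hR hxR ρ hρ hρ2
    have hl : 0 < r * R := by positivity
    obtain ⟨e, c, he, hf⟩ := hflat u x1 hu hL hx1 R hR hxR
    have h1 := hdec (fun x => (r * R)⁻¹ * u ((r * R) • x)) e c (rescale0_PH hu hl) (fun x _ => by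
      rw [rescale0_gradient hu.diff hl]; exact hL _) he (by
      have h2 : ∫ x in ball (0:E) 1, ((r * R)⁻¹ * u ((r * R) • x) - c - ⟪e, x⟫) ^ 2 ≤ ∫ x in ball (0:E) 1, ε ^ 2 := by
        refine setIntegral_mono_on (integrableOn_ball_of_continuous (by fun_prop) 0 1)
          (integrableOn_ball_of_continuous (by fun_prop) 0 1) measurableSet_ball fun x hx => ?_
        rw [← sq_abs]
        have := hf x hx
        gcongr
      rw [setIntegral_const, smul_eq_mul, measureReal_def, ← hV] at h2
      exact h2.trans (by linarith)) ρ hρ hρ2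
    simp only [rescale0_gradient hu.diff hl, smul_zero] at h1
    exact h1
  have hzero : ∀ S : ℝ, 0 < S → ∫ x in ball (0:E) S, ‖gradient u x - a‖ ^ 2 ≤ 0 := by
    intro S hS
    set I := ∫ x in ball (0:E) S, ‖gradient u x - a‖ ^ 2 with hI
    have hbound : ∀ ρ : ℝ, 0 < ρ → ρ ≤ 1/2 → (r * (‖x1‖ + 1)) * ρ ≤ S → I ≤ C * S ^ n * ρ := by
      intro ρ hρ hρ2 hρS
      set l := S / ρ with hl
      have hl0 : 0 < l := by positivity
      have hlr : r * (l / r) = l := by field_simp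
      have hR : ‖x1‖ + 1 ≤ l / r := by
        rw [le_div_iff₀ hr, hl, le_div_iff₀ hρ]; linarith
      have h1 := hdecay (l / r) (by linarith [norm_nonneg x1]) (by linarith) ρ hρ hρ2
      rw [hlr] at h1
      have h2 := setIntegral_ball_comp (fun y : E => ‖gradient u y - a‖ ^ 2) 0 hl0 ρ
      have e1 : l * ρ = S := by rw [hl]; field_simp
      simp only [zero_add] at h2
      rw [h2, e1, ← hI, inv_mul_le_iff₀ (by positivity)] at h1
      have h3 : Real.sqrt ρ ≤ 1 := Real.sqrt_le_one.mpr (by linarith)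
      calc I ≤ l ^ n * (C * ρ ^ (n + 1) * Real.sqrt ρ) := h1
        _ ≤ l ^ n * (C * ρ ^ (n + 1) * 1) := by gcongr
        _ = C * (l * ρ) ^ n * ρ := by ring
        _ = _ := by rw [e1]
    by_contra hcon
    push Not at hcon
    set ρ := min (min (1/2) (S / (r * (‖x1‖ + 1)))) (I / (2 * (C * S ^ n))) with hρ
    have hρ0 : 0 < ρ := by positivity
    have h1 := hbound ρ hρ0 ((min_le_left _ _).trans (min_le_left _ _)) (by
      have : ρ ≤ S / (r * (‖x1‖ + 1)) := (min_le_left _ _).trans (min_le_right _ _)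
      rw [le_div_iff₀ (by positivity)] at this
      linarith)
    have h2 : ρ ≤ I / (2 * (C * S ^ n)) := min_le_right _ _
    rw [le_div_iff₀ (by positivity)] at h2
    linarith
  refine ⟨a, fun x => ?_⟩
  set S := 2 * ‖x‖ + 1 with hS
  have hS0 : 0 < S := by positivity
  have hPd : Differentiable ℝ (fun y => S⁻¹ * u (S • y)) := (rescale0_PH hu hS0).diff
  have hgW : ∀ y, gradient (fun y => S⁻¹ * u (S • y) - 0 - ⟪a, y⟫) y = gradient u (S • y) - a := fun y => by
    rw [gradient_sub_affine' hPd, rescale0_gradient hu.diff hS0]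
  have h1 := diff_quot (w := fun y => S⁻¹ * u (S • y) - 0 - ⟪a, y⟫) (L := 1 + ‖a‖) (r := 1/2)
    ((hPd.sub_const 0).sub (innerSL ℝ a).differentiable) (fun y _ => by
      rw [hgW]
      exact (norm_sub_le _ _).trans (by gcongr; exact hL _)) (S⁻¹ • x) (by
      rw [norm_smul, Real.norm_eq_abs, abs_of_pos (by positivity)]
      have : S⁻¹ * ‖x‖ ≤ 1/2 := by rw [inv_mul_le_iff₀ hS0]; linarith
      linarith)
  simp only [hgW] at h1
  have h2 := setIntegral_ball_comp (fun y : E => ‖gradient u y - a‖ ^ 2) 0 hS0 1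
  simp only [zero_add, mul_one] at h2
  have h3 : (S ^ n)⁻¹ * ∫ x in ball (0:E) S, ‖gradient u x - a‖ ^ 2 ≤ 0 :=
    mul_nonpos_of_nonneg_of_nonpos (by positivity) (hzero S hS0)
  have h4 : ‖S⁻¹ • x‖ ^ 2 * ∫ x in ball (0:E) 1, ‖gradient u (S • x) - a‖ ^ 2 ≤ 0 := by
    rw [h2]
    exact mul_nonpos_of_nonneg_of_nonpos (by positivity) h3
  have h5 := eq_of_int (g := fun y => S⁻¹ * u (S • (y + S⁻¹ • x)) - 0 - ⟪a, y + S⁻¹ • x⟫ - (S⁻¹ * u (S • y) - 0 - ⟪a, y⟫))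
    (by fun_prop) (by norm_num : (0:ℝ) < 1/2) (h1.trans h4)
  simp only [zero_add, smul_zero, inner_zero_right, sub_zero, smul_smul, mul_inv_cancel₀ hS0.ne', one_smul, inner_smul_right] at h5
  have h6 : S⁻¹ * (u x - ⟪a, x⟫ - u 0) = 0 := by linarith
  rcases mul_eq_zero.mp h6 with h7 | h7
  · exact absurd h7 (by positivity)
  · linarith

lemma liouville_main (p : ℝ) (hp : 1 < p) {v : E → ℝ} (hv : PH p v) {C : ℝ} (hg : ∀ x, |v x| ≤ C * (1 + ‖x‖)) :
    ∃ a : E, ∀ x, v x = v 0 + ⟪a, x⟫ := by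
  obtain ⟨L, hL⟩ := global_bdd hp hv hg
  set T := Set.range (fun x => ‖gradient v x‖) with hT
  have hTb : BddAbove T := ⟨L, by rintro _ ⟨x, rfl⟩; exact hL x⟩
  have hTn : T.Nonempty := ⟨_, 0, rfl⟩
  set M := sSup T with hM
  have hle : ∀ x, ‖gradient v x‖ ≤ M := fun x => le_csSup hTb ⟨x, rfl⟩
  have hM0 : 0 ≤ M := (norm_nonneg _).trans (hle 0)
  rcases hM0.lt_or_eq with h | h
  · obtain ⟨a, ha⟩ := liouville p hp (hv.smul (inv_pos.mpr h)) (fun x => by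
      rw [gradient_smul' hv.diff, norm_smul, Real.norm_eq_abs, abs_of_pos (by positivity), inv_mul_le_iff₀ h, mul_one]
      exact hle x) (fun δ hδ => by
      obtain ⟨_, ⟨x, rfl⟩, hx⟩ := exists_lt_of_lt_csSup hTn (show M - M * δ < sSup T by
        have : 0 < M * δ := by positivity
        linarith)
      refine ⟨x, ?_⟩
      rw [gradient_smul' hv.diff, norm_smul, Real.norm_eq_abs, abs_of_pos (by positivity), lt_inv_mul_iff₀ h]
      simp only at hx
      linarith)
    refine ⟨M • a, fun x => ?_⟩
    have h1 := ha x
    rw [real_inner_smul_left]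
    field_simp at h1
    linarith
  · refine ⟨0, fun x => ?_⟩
    rw [← h] at hle
    have h1 := lip_global hv.diff hle x 0
    have h2 := lip_global hv.diff hle 0 x
    rw [inner_zero_left]
    linarith

end PartK4

end PLap

/-- Liouville theorem with normalization: an entire p-harmonic function with linear
growth, v(0) = 0 and sup_{B_{1/2}}|v| = 1 is a nonzero linear function v(x) = ⟨a, x⟩. -/
theorem stmt10 (n : ℕ) (p : ℝ) (hp : 1 < p)
    (v : EuclideanSpace ℝ (Fin n) → ℝ) (hv : Differentiable ℝ v)
    (hharm : ∀ φ : EuclideanSpace ℝ (Fin n) → ℝ, ContDiff ℝ 1 φ → HasCompactSupport φ →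
        ∫ x, ‖gradient v x‖ ^ (p - 2) * ⟪gradient v x, gradient φ x⟫ = 0)
    (C : ℝ) (hgrowth : ∀ x, |v x| ≤ C * (1 + ‖x‖))
    (h0 : v 0 = 0)
    (hsup : sSup ((fun x => |v x|) '' ball (0 : EuclideanSpace ℝ (Fin n)) (1 / 2)) = 1) :
    ∃ a : EuclideanSpace ℝ (Fin n), a ≠ 0 ∧ ∀ x, v x = ⟪a, x⟫ := by
  obtain ⟨a, ha⟩ := PLap.liouville_main p hp (v := v) ⟨hv, hharm⟩ hgrowth
  simp only [h0, zero_add] at ha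
  refine ⟨a, ?_, ha⟩
  rintro rfl
  have h1 : (fun x => |v x|) '' ball (0 : EuclideanSpace ℝ (Fin n)) (1 / 2) = {0} := by
    ext t
    simp only [Set.mem_image, Set.mem_singleton_iff, ha, inner_zero_left, abs_zero]
    constructor
    · rintro ⟨x, _, rfl⟩; rfl
    · rintro rfl; exact ⟨0, by simp, rfl⟩
  rw [h1, csSup_singleton] at hsup
  exact zero_ne_one hsup
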